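/- Let p be an odd prime and let q = p. The representation zeta function of the compact group SL₂(ℤ_p) is given, for every real s > 1, by the convergent series identity: ∑_{n≥1} rₙ(SL₂(ℤ_p))·n^{−s} = [1 + q^{−s} + ((q−3)/2)(q+1)^{−s} + ((q−1)/2)(q−1)^{−s} + 2((q+1)/2)^{−s} + 2((q−1)/2)^{−s}] + [4q((q²−1)/2)^{−s} + ((q²−1)/2)(q²−q)^{−s} + ((q−1)²/2)(q²+q)^{−s}] / (1 − q^{1−s}). -/

import Mathlib

open scoped MatrixGroups

/-- A submodule `W` of `ℂ^n` is invariant under a matrix representation `ρ` if it is stable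
under the action of every `ρ g`. -/
def RepInvariant {G : Type*} [Group G] {n : ℕ} (ρ : G →* GL (Fin n) ℂ)
    (W : Submodule ℂ (Fin n → ℂ)) : Prop :=
  ∀ g : G, ∀ v ∈ W, Matrix.mulVec (ρ g : Matrix (Fin n) (Fin n) ℂ) v ∈ W

/-- A matrix representation `ρ : G →* GLₙ(ℂ)` is irreducible if the associated `ℂG`-module
`ℂ^n` is simple, i.e. nonzero and without proper nonzero invariant submodules. -/
def RepIsIrreducible {G : Type*} [Group G] {n : ℕ} (ρ : G →* GL (Fin n) ℂ) : Prop :=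
  (⊥ : Submodule ℂ (Fin n → ℂ)) ≠ ⊤ ∧
    ∀ W : Submodule ℂ (Fin n → ℂ), RepInvariant ρ W → W = ⊥ ∨ W = ⊤

/-- Two matrix representations are isomorphic if they are conjugate by an element of
`GLₙ(ℂ)`. -/
def RepIso {G : Type*} [Group G] {n : ℕ} (ρ₁ ρ₂ : G →* GL (Fin n) ℂ) : Prop :=
  ∃ T : GL (Fin n) ℂ, ∀ g : G, T * ρ₁ g * T⁻¹ = ρ₂ g

/-- A matrix representation of a topological group is continuous if it is continuous into
`GLₙ(ℂ)` with its standard topology, i.e. the map on matrix entries is continuous. -/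
def RepContinuous {G : Type*} [Group G] [TopologicalSpace G] {n : ℕ}
    (ρ : G →* GL (Fin n) ℂ) : Prop :=
  Continuous fun g : G => (ρ g : Matrix (Fin n) (Fin n) ℂ)

/-- `rₙ(G)` for a topological group `G`: the number of isomorphism classes of continuous
`n`-dimensional irreducible complex representations of `G`. -/
noncomputable def contIrrRepCount (G : Type*) [Group G] [TopologicalSpace G] (n : ℕ) : ℕ :=
  Nat.card (Quot fun ρ₁ ρ₂ : {ρ : G →* GL (Fin n) ℂ // RepContinuous ρ ∧ RepIsIrreducible ρ} =>
    RepIso ρ₁.1 ρ₂.1)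

/-- The special linear group over a topological ring carries the topology induced from the
space of matrices. -/
noncomputable instance (n : Type*) [DecidableEq n] [Fintype n]
    (R : Type*) [CommRing R] [TopologicalSpace R] :
    TopologicalSpace (Matrix.SpecialLinearGroup n R) :=
  inferInstanceAs (TopologicalSpace {A : Matrix n n R // A.det = 1})

/-! ### Part A: Wedderburn decomposition of a finite group algebra -/

namespace SLZeta

/-- A Wedderburn decomposition of the complex group algebra. -/
structure Wed (G : Type*) [Group G] where
  r : ℕ
  d : Fin r → ℕ
  hd : ∀ i, NeZero (d i)
  Φ : MonoidAlgebra ℂ G ≃ₐ[ℂ] (Π i, Matrix (Fin (d i)) (Fin (d i)) ℂ)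

theorem exists_wed (G : Type*) [Group G] [Finite G] : Nonempty (Wed G) := by
  haveI : NeZero (Nat.card G : ℂ) := ⟨by exact_mod_cast (Nat.card_pos (α := G)).ne'⟩
  haveI : IsSemisimpleRing (MonoidAlgebra ℂ G) := inferInstance
  haveI : FiniteDimensional ℂ (MonoidAlgebra ℂ G) :=
    inferInstance
  obtain ⟨n, d, hd, ⟨e⟩⟩ :=
    IsSemisimpleRing.exists_algEquiv_pi_matrix_of_isAlgClosed ℂ (MonoidAlgebra ℂ G)
  exact ⟨⟨n, d, hd, e⟩⟩

theorem stdBasis_aux {n : ℕ} (x y : Matrix (Fin n) (Fin n) ℂ) (j k : Fin n) :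
    (Matrix.stdBasis ℂ (Fin n) (Fin n)).repr (x * (Matrix.single j k 1 * y)) (j, k) =
      x j j * y k k := by
  have h : ∀ M : Matrix (Fin n) (Fin n) ℂ,
      (Matrix.stdBasis ℂ (Fin n) (Fin n)).repr M (j, k) = M j k := by
    intro M
    simp [Matrix.stdBasis]
  rw [h, ← mul_assoc, Matrix.mul_apply, Finset.sum_eq_single k]
  · simp
  · intro b _ hb
    rw [Matrix.mul_single_apply_of_ne _ _ _ _ _ hb, zero_mul]
  · simp

theorem trace_pi_mul {r : ℕ} (d : Fin r → ℕ)
    (x y : Π i, Matrix (Fin (d i)) (Fin (d i)) ℂ) :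
    LinearMap.trace ℂ (Π i, Matrix (Fin (d i)) (Fin (d i)) ℂ)
      ((LinearMap.mulLeft ℂ x).comp (LinearMap.mulRight ℂ y)) =
    ∑ i, (x i).trace * (y i).trace := by
  classical
  rw [LinearMap.trace_eq_matrix_trace ℂ (Pi.basis fun i => Matrix.stdBasis ℂ (Fin (d i)) (Fin (d i)))]
  simp only [Matrix.trace, Matrix.diag_apply, LinearMap.toMatrix_apply]
  rw [Fintype.sum_sigma]
  refine Finset.sum_congr rfl fun i _ => ?_
  rw [Fintype.sum_prod_type, Finset.sum_mul_sum]
  refine Finset.sum_congr rfl fun j _ => Finset.sum_congr rfl fun k _ => ?_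
  rw [Pi.basis_apply, Matrix.stdBasis_eq_single]
  have h : (Pi.single i (Matrix.single j k (1 : ℂ)) : Π i, Matrix (Fin (d i)) (Fin (d i)) ℂ) i =
    Matrix.single j k 1 := Pi.single_eq_same _ _
  simp only [LinearMap.comp_apply, LinearMap.mulLeft_apply, LinearMap.mulRight_apply,
    Pi.basis_repr, Pi.mul_apply, h]
  exact stdBasis_aux (x i) (y i) j k

theorem trace_matrix_mul {n : ℕ} (x y : Matrix (Fin n) (Fin n) ℂ) :
    LinearMap.trace ℂ (Matrix (Fin n) (Fin n) ℂ)
      ((LinearMap.mulLeft ℂ x).comp (LinearMap.mulRight ℂ y)) = x.trace * y.trace := by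
  classical
  rw [LinearMap.trace_eq_matrix_trace ℂ (Matrix.stdBasis ℂ (Fin n) (Fin n))]
  simp only [Matrix.trace, Matrix.diag_apply, LinearMap.toMatrix_apply]
  rw [Fintype.sum_prod_type, Finset.sum_mul_sum]
  refine Finset.sum_congr rfl fun j _ => Finset.sum_congr rfl fun k _ => ?_
  rw [Matrix.stdBasis_eq_single]
  simp only [LinearMap.comp_apply, LinearMap.mulLeft_apply, LinearMap.mulRight_apply]
  exact stdBasis_aux x y j k

namespace Wed
variable {G : Type*} [Group G] (W : Wed G)

/-- The `i`-th irreducible character, extended to the group algebra. -/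
noncomputable def tr (i : Fin W.r) : MonoidAlgebra ℂ G →ₗ[ℂ] ℂ where
  toFun x := (W.Φ x i).trace
  map_add' x y := by simp
  map_smul' c x := by simp

theorem tr_def (i : Fin W.r) (x : MonoidAlgebra ℂ G) : W.tr i x = (W.Φ x i).trace := rfl

theorem tr_one (i : Fin W.r) : W.tr i 1 = W.d i := by simp [tr_def]

theorem tr_mul_comm (i : Fin W.r) (x y : MonoidAlgebra ℂ G) : W.tr i (x * y) = W.tr i (y * x) := by
  simp [tr_def, Matrix.trace_mul_comm (W.Φ x i)]

theorem ortho [Fintype G] [DecidableEq G] (x y : G) :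
    ∑ i, W.tr i (MonoidAlgebra.of ℂ G x) * W.tr i (MonoidAlgebra.of ℂ G y) =
      ((Finset.univ.filter fun g : G => x * g * y = g).card : ℂ) := by
  simp only [tr_def]
  rw [← trace_pi_mul]
  set X := MonoidAlgebra.of ℂ G x
  set Y := MonoidAlgebra.of ℂ G y
  have : ((LinearMap.mulLeft ℂ (W.Φ X)).comp (LinearMap.mulRight ℂ (W.Φ Y))) =
      W.Φ.toLinearEquiv.conj ((LinearMap.mulLeft ℂ X).comp (LinearMap.mulRight ℂ Y)) := by
    refine LinearMap.ext fun z => ?_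
    simp [LinearEquiv.conj_apply]
  rw [this, LinearMap.trace_conj']
  let b : Module.Basis G ℂ (MonoidAlgebra ℂ G) := MonoidAlgebra.basis G ℂ
  rw [LinearMap.trace_eq_matrix_trace ℂ b]
  simp only [Matrix.trace, Matrix.diag_apply, LinearMap.toMatrix_apply]
  rw [Finset.card_filter]
  push_cast
  refine Finset.sum_congr rfl fun g _ => ?_
  simp [b, X, Y, MonoidAlgebra.basis, Finsupp.single_apply, mul_assoc]

/-- multiplicity (rank) of an idempotent in the `i`-th representation -/
noncomputable def rk (i : Fin W.r) (e : MonoidAlgebra ℂ G) : ℕ := (W.Φ e i).rank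

theorem tr_eq_rk (i : Fin W.r) {e : MonoidAlgebra ℂ G} (he : e * e = e) :
    W.tr i e = W.rk i e := by
  have h : IsIdempotentElem (Matrix.toLin' (W.Φ e i)) := by
    unfold IsIdempotentElem
    rw [Module.End.mul_eq_comp, ← Matrix.toLin'_mul, ← Pi.mul_apply, ← map_mul, he]
  have := (LinearMap.IsIdempotentElem.isProj_range _ h).trace
  rw [Matrix.trace_toLin'_eq] at this
  rw [tr_def, this]
  rfl

theorem rk_eq_zero (i : Fin W.r) (e : MonoidAlgebra ℂ G) :
    W.rk i e = 0 ↔ W.Φ e i = 0 := by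
  unfold rk
  unfold Matrix.rank
  rw [Submodule.finrank_eq_zero, LinearMap.range_eq_bot]
  exact (Matrix.toLin' (R := ℂ) (m := Fin (W.d i)) (n := Fin (W.d i))).map_eq_zero_iff

theorem phi_surj (i : Fin W.r) (M : Matrix (Fin (W.d i)) (Fin (W.d i)) ℂ) :
    ∃ x, W.Φ x i = M := ⟨W.Φ.symm (Pi.single i M), by simp⟩

theorem commute_all {z : MonoidAlgebra ℂ G}
    (hz : ∀ g, MonoidAlgebra.of ℂ G g * z = z * MonoidAlgebra.of ℂ G g) (x : MonoidAlgebra ℂ G) :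
    x * z = z * x := by
  induction x using MonoidAlgebra.induction_on with
  | of g => exact hz g
  | add a b ha hb => rw [add_mul, mul_add, ha, hb]
  | smul c a ha => rw [smul_mul_assoc, mul_smul_comm, ha]

theorem central_scalar (i : Fin W.r) {z : MonoidAlgebra ℂ G}
    (hz : ∀ g, MonoidAlgebra.of ℂ G g * z = z * MonoidAlgebra.of ℂ G g) :
    ∃ c : ℂ, W.Φ z i = Matrix.scalar _ c := by
  have : W.Φ z i ∈ Set.range (Matrix.scalar (Fin (W.d i)) (α := ℂ)) := by
    rw [Matrix.mem_range_scalar_iff_commute_single']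
    intro a b
    obtain ⟨x, hx⟩ := W.phi_surj i (Matrix.single a b 1)
    rw [← hx]
    unfold Commute SemiconjBy
    rw [← Pi.mul_apply, ← map_mul, commute_all hz, map_mul, Pi.mul_apply]
  obtain ⟨c, hc⟩ := this
  exact ⟨c, hc.symm⟩

theorem central_idem (i : Fin W.r) {z : MonoidAlgebra ℂ G}
    (hz : ∀ g, MonoidAlgebra.of ℂ G g * z = z * MonoidAlgebra.of ℂ G g) (hi : z * z = z) :
    W.Φ z i = 0 ∨ W.Φ z i = 1 := by
  obtain ⟨c, hc⟩ := W.central_scalar i hz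
  have h2 : W.Φ z i * W.Φ z i = W.Φ z i := by rw [← Pi.mul_apply, ← map_mul, hi]
  haveI := W.hd i
  have h3 := congrFun (congrFun h2 0) 0
  rw [hc, ← map_mul] at h3
  simp only [Matrix.scalar_apply, Matrix.diagonal_apply_eq] at h3
  have h4 : c * (c - 1) = 0 := by linear_combination h3
  rcases mul_eq_zero.mp h4 with h | h
  · left; rw [hc, h, map_zero]
  · right; rw [hc, sub_eq_zero.mp h, map_one]

/-- pairwise non-conjugate elements give a lower bound for the number of irreps -/
theorem card_le_of_nonconj [Fintype G] {α : Type*} [Fintype α] (f : α → G)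
    (hf : ∀ a b, IsConj (f a) (f b) → a = b) : Fintype.card α ≤ W.r := by
  classical
  let v : α → (Fin W.r → ℂ) := fun a i => W.tr i (MonoidAlgebra.of ℂ G (f a))
  have hli : LinearIndependent ℂ v := by
    rw [Fintype.linearIndependent_iff]
    intro c hc b
    have h1 : ∑ a, c a * ∑ i, W.tr i (MonoidAlgebra.of ℂ G (f a)) *
        W.tr i (MonoidAlgebra.of ℂ G (f b)⁻¹) = 0 := by
      simp_rw [Finset.mul_sum]
      rw [Finset.sum_comm]
      refine Finset.sum_eq_zero fun i _ => ?_
      have := congrFun hc i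
      simp only [Finset.sum_apply, Pi.smul_apply, smul_eq_mul, Pi.zero_apply, v] at this
      simp_rw [← mul_assoc]
      rw [← Finset.sum_mul, this, zero_mul]
    rw [Finset.sum_eq_single b] at h1
    · rcases mul_eq_zero.mp h1 with h | h
      · exact h
      · rw [ortho, Nat.cast_eq_zero, Finset.card_eq_zero] at h
        have : (1 : G) ∈ Finset.univ.filter fun g : G => f b * g * (f b)⁻¹ = g := by simp
        rw [h] at this
        simp at this
    · intro a _ hab
      rw [ortho, Finset.filter_false_of_mem]
      · simp
      · intro g _ hg
        apply hab
        apply hf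
        rw [isConj_comm, isConj_iff]
        refine ⟨g, ?_⟩
        rw [mul_inv_eq_iff_eq_mul] at hg
        rw [mul_inv_eq_iff_eq_mul, hg]
    · simp
  have := hli.fintype_card_le_finrank
  simpa using this

end Wed
end SLZeta

namespace SLZeta
namespace Wed
variable {Γ G : Type*} [Group Γ] [Group G] (W : Wed G)

/-- `ρ` is equivalent to the `i`-th irreducible representation of `G` pulled back along `π`. -/
def Corr (π : Γ →* G) {n : ℕ} (ρ : Γ →* GL (Fin n) ℂ) (i : Fin W.r) : Prop :=
  ∃ L : (Fin (W.d i) → ℂ) ≃ₗ[ℂ] (Fin n → ℂ), ∀ g u,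
    L ((W.Φ (MonoidAlgebra.of ℂ G (π g)) i).mulVec u) =
      (ρ g : Matrix (Fin n) (Fin n) ℂ).mulVec (L u)

/-- the `i`-th irreducible representation -/
noncomputable def irr (i : Fin W.r) : G →* GL (Fin (W.d i)) ℂ :=
  MonoidHom.toHomUnits
    { toFun := fun g => W.Φ (MonoidAlgebra.of ℂ G g) i
      map_one' := by rw [map_one, map_one, Pi.one_apply]
      map_mul' := fun a b => by rw [map_mul, map_mul, Pi.mul_apply] }

theorem irr_coe (i : Fin W.r) (g : G) :
    (W.irr i g : Matrix (Fin (W.d i)) (Fin (W.d i)) ℂ) = W.Φ (MonoidAlgebra.of ℂ G g) i := rfl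

variable {W} in
theorem Corr.dim_eq {π : Γ →* G} {n : ℕ} {ρ : Γ →* GL (Fin n) ℂ} {i : Fin W.r}
    (h : W.Corr π ρ i) : W.d i = n := by
  obtain ⟨L, -⟩ := h
  have := L.finrank_eq
  simpa using this

variable {W} in
theorem Corr.of_iso {π : Γ →* G} {n : ℕ} {ρ ρ' : Γ →* GL (Fin n) ℂ} {i : Fin W.r}
    (h : W.Corr π ρ i) (hr : RepIso ρ ρ') : W.Corr π ρ' i := by
  obtain ⟨L, hL⟩ := h
  obtain ⟨T, hT⟩ := hr
  have h1 : (T : Matrix (Fin n) (Fin n) ℂ) * ((T⁻¹ : GL (Fin n) ℂ) : Matrix (Fin n) (Fin n) ℂ) = 1 :=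
    Units.mul_inv T
  have h2 : ((T⁻¹ : GL (Fin n) ℂ) : Matrix (Fin n) (Fin n) ℂ) * (T : Matrix (Fin n) (Fin n) ℂ) = 1 :=
    Units.inv_mul T
  refine ⟨L.trans (Matrix.toLin'OfInv h2 h1), fun g u => ?_⟩
  have h3 : T * ρ g = ρ' g * T := by rw [← hT g]; group
  have h4 := congrArg (Units.val) h3
  rw [Units.val_mul, Units.val_mul] at h4
  simp only [LinearEquiv.trans_apply, hL]
  change (T : Matrix (Fin n) (Fin n) ℂ).mulVec _ = (ρ' g : Matrix (Fin n) (Fin n) ℂ).mulVec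
    ((T : Matrix (Fin n) (Fin n) ℂ).mulVec _)
  rw [Matrix.mulVec_mulVec, Matrix.mulVec_mulVec, h4]

variable {W} in
theorem Corr.iso {π : Γ →* G} {n : ℕ} {ρ ρ' : Γ →* GL (Fin n) ℂ} {i : Fin W.r}
    (h : W.Corr π ρ i) (h' : W.Corr π ρ' i) : RepIso ρ ρ' := by
  obtain ⟨L, hL⟩ := h
  obtain ⟨L', hL'⟩ := h'
  let E := L.symm.trans L'
  let T : GL (Fin n) ℂ := ⟨LinearMap.toMatrix' (E : (Fin n → ℂ) →ₗ[ℂ] (Fin n → ℂ)),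
    LinearMap.toMatrix' (E.symm : (Fin n → ℂ) →ₗ[ℂ] (Fin n → ℂ)),
    by rw [← LinearMap.toMatrix'_comp, LinearEquiv.comp_coe, LinearEquiv.symm_trans_self]; simp,
    by rw [← LinearMap.toMatrix'_comp, LinearEquiv.comp_coe, LinearEquiv.self_trans_symm]; simp⟩
  refine ⟨T, fun g => ?_⟩
  rw [mul_inv_eq_iff_eq_mul]
  apply Units.ext
  rw [Units.val_mul, Units.val_mul]
  apply Matrix.mulVec_injective
  funext v
  have hT : ∀ w, (T : Matrix (Fin n) (Fin n) ℂ).mulVec w = E w := fun w => by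
    change (LinearMap.toMatrix' (E : (Fin n → ℂ) →ₗ[ℂ] (Fin n → ℂ))).mulVec w = _
    rw [← Matrix.toLin'_apply, Matrix.toLin'_toMatrix']; rfl
  rw [← Matrix.mulVec_mulVec, ← Matrix.mulVec_mulVec, hT, hT]
  obtain ⟨u, rfl⟩ := L.surjective v
  simp only [E, LinearEquiv.trans_apply, LinearEquiv.symm_apply_apply]
  rw [← hL, ← hL', LinearEquiv.symm_apply_apply]

/-- linear extension of a representation to the group algebra -/
noncomputable def ext {n : ℕ} (ρ : G →* GL (Fin n) ℂ) :
    MonoidAlgebra ℂ G →ₐ[ℂ] Matrix (Fin n) (Fin n) ℂ :=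
  MonoidAlgebra.lift ℂ _ G ((Units.coeHom _).comp ρ)

theorem ext_of {n : ℕ} (ρ : G →* GL (Fin n) ℂ) (g : G) :
    ext ρ (MonoidAlgebra.of ℂ G g) = ρ g := by simp [ext]

variable {W} in
theorem corr_ext {n : ℕ} {ρ : G →* GL (Fin n) ℂ} {i : Fin W.r}
    {L : (Fin (W.d i) → ℂ) ≃ₗ[ℂ] (Fin n → ℂ)}
    (h : ∀ g u, L ((W.Φ (MonoidAlgebra.of ℂ G g) i).mulVec u) =
      (ρ g : Matrix (Fin n) (Fin n) ℂ).mulVec (L u)) (x : MonoidAlgebra ℂ G) (u) :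
    L ((W.Φ x i).mulVec u) = (ext ρ x).mulVec (L u) := by
  induction x using MonoidAlgebra.induction_on with
  | of g => rw [h, ext_of]
  | add a b ha hb => simp only [map_add, Pi.add_apply, Matrix.add_mulVec, ha, hb]
  | smul c a ha => simp only [map_smul, Pi.smul_apply, Matrix.smul_mulVec, ha]

variable {W} in
theorem Corr.unique {n : ℕ} {ρ : G →* GL (Fin n) ℂ} {i j : Fin W.r}
    (h : W.Corr (MonoidHom.id G) ρ i) (h' : W.Corr (MonoidHom.id G) ρ j) : i = j := by
  by_contra hij
  have hn := h.dim_eq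
  haveI := W.hd i
  obtain ⟨L, hL⟩ := h
  obtain ⟨L', hL'⟩ := h'
  set x := W.Φ.symm (Pi.single i 1)
  have h1 : ∀ u, L u = (ext ρ x).mulVec (L u) := fun u => by
    rw [← corr_ext hL x u]; simp [x]
  have h2 : ∀ u, 0 = (ext ρ x).mulVec (L' u) := fun u => by
    rw [← corr_ext hL' x u]
    have : W.Φ x j = 0 := by simp [x, Ne.symm hij]
    rw [this]; simp
  have h3 : ∀ u, L u = 0 := fun u => by
    rw [h1 u, ← L'.apply_symm_apply (L u), ← h2]
  have h4 : (fun _ => 1 : Fin (W.d i) → ℂ) = 0 := L.injective (by rw [h3, map_zero])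
  exact one_ne_zero (congrFun h4 0)

theorem inv_of_ext {n : ℕ} {ρ : G →* GL (Fin n) ℂ} {V : Submodule ℂ (Fin n → ℂ)}
    (h : RepInvariant ρ V) (x : MonoidAlgebra ℂ G) : ∀ v ∈ V, (ext ρ x).mulVec v ∈ V := by
  intro v hv
  induction x using MonoidAlgebra.induction_on with
  | of g => rw [ext_of]; exact h g v hv
  | add a b ha hb => simp only [map_add, Matrix.add_mulVec]; exact V.add_mem ha hb
  | smul c a ha => simp only [map_smul, Matrix.smul_mulVec]; exact V.smul_mem _ ha

theorem inv_range {n : ℕ} {ρ : G →* GL (Fin n) ℂ} {m : ℕ} (L : (Fin m → ℂ) →ₗ[ℂ] (Fin n → ℂ))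
    (A : G → Matrix (Fin m) (Fin m) ℂ)
    (h : ∀ g u, L ((A g).mulVec u) = (ρ g : Matrix (Fin n) (Fin n) ℂ).mulVec (L u)) :
    RepInvariant ρ (LinearMap.range L) := by
  rintro g _ ⟨u, rfl⟩
  exact ⟨_, h g u⟩

theorem irr_irreducible (i : Fin W.r) : RepIsIrreducible (W.irr i) := by
  haveI := W.hd i
  refine ⟨bot_ne_top, fun V hV => ?_⟩
  by_contra! hcon
  obtain ⟨h0, h1⟩ := hcon
  obtain ⟨v, hv, hv0⟩ := V.ne_bot_iff.mp h0
  apply h1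
  rw [eq_top_iff]
  rintro w -
  obtain ⟨a, ha⟩ : ∃ a, v a ≠ 0 := by
    by_contra! hc; exact hv0 (funext hc)
  have key : ∀ M : Matrix (Fin (W.d i)) (Fin (W.d i)) ℂ, M.mulVec v ∈ V := by
    intro M
    obtain ⟨x, rfl⟩ := W.phi_surj i M
    have := inv_of_ext hV x v hv
    have h2 : (W.Φ x i).mulVec v = (ext (W.irr i) x).mulVec v :=
      corr_ext (ρ := W.irr i) (L := LinearEquiv.refl ℂ _) (fun g u => rfl) x v
    rwa [h2]
  have := key (Matrix.vecMulVec w (Pi.single a (v a)⁻¹))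
  convert this
  rw [Matrix.vecMulVec_mulVec]
  ext b
  simp [ha]

theorem exists_corr {n : ℕ} {ρ : G →* GL (Fin n) ℂ} (h : RepIsIrreducible ρ) :
    ∃ i, W.Corr (MonoidHom.id G) ρ i := by
  obtain ⟨hn, hirr⟩ := h
  let ψ : (Π i, Matrix (Fin (W.d i)) (Fin (W.d i)) ℂ) →ₐ[ℂ] Matrix (Fin n) (Fin n) ℂ :=
    (ext ρ).comp W.Φ.symm.toAlgHom
  have hψ : ∀ g, (ρ g : Matrix (Fin n) (Fin n) ℂ) = ψ (W.Φ (MonoidAlgebra.of ℂ G g)) := by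
    intro g; simp only [ψ, AlgHom.comp_apply]
    erw [AlgEquiv.symm_apply_apply]
    rw [ext_of]
  -- some matrix unit acts nontrivially
  have hex : ∃ (i : Fin W.r) (a : Fin (W.d i)) (v : Fin n → ℂ),
      (ψ (Pi.single i (Matrix.single a a 1))).mulVec v ≠ 0 := by
    by_contra! hc
    have h1 : ψ 1 = 0 := by
      have : (1 : Π i, Matrix (Fin (W.d i)) (Fin (W.d i)) ℂ) =
          ∑ i, ∑ a, Pi.single i (Matrix.single a a (1 : ℂ)) := by
        refine (Finset.univ_sum_single (1 : Π i, Matrix (Fin (W.d i)) (Fin (W.d i)) ℂ)).symm.trans ?_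
        refine Finset.sum_congr rfl fun i _ => ?_
        rw [Pi.one_apply, ← Matrix.sum_single_one]
        exact map_sum (AddMonoidHom.single (fun i => Matrix (Fin (W.d i)) (Fin (W.d i)) ℂ) i) _ _
      rw [this, map_sum]
      refine Finset.sum_eq_zero fun i _ => ?_
      rw [map_sum]
      refine Finset.sum_eq_zero fun a _ => ?_
      apply Matrix.mulVec_injective
      funext v
      rw [hc i a v, Matrix.zero_mulVec]
    rw [map_one] at h1
    apply hn
    rw [eq_comm, Submodule.eq_bot_iff]
    intro x _
    rw [← Matrix.one_mulVec x, h1, Matrix.zero_mulVec]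
  obtain ⟨i, a, v, hv⟩ := hex
  let L : (Fin (W.d i) → ℂ) →ₗ[ℂ] (Fin n → ℂ) :=
    { toFun := fun u => (ψ (Pi.single i (Matrix.vecMulVec u (Pi.single a 1)))).mulVec v
      map_add' := fun x y => by
        rw [Matrix.add_vecMulVec, Pi.single_add, map_add, Matrix.add_mulVec]
      map_smul' := fun c x => by
        rw [Matrix.smul_vecMulVec, Pi.single_smul, map_smul, Matrix.smul_mulVec]; rfl }
  have hLX : ∀ (X : Π i, Matrix (Fin (W.d i)) (Fin (W.d i)) ℂ) u,
      L ((X i).mulVec u) = (ψ X).mulVec (L u) := by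
    intro X u
    change (ψ (Pi.single i (Matrix.vecMulVec _ (Pi.single a 1)))).mulVec v = _
    change _ = (ψ X).mulVec ((ψ (Pi.single i (Matrix.vecMulVec u (Pi.single a 1)))).mulVec v)
    rw [Matrix.mulVec_mulVec, ← map_mul]
    congr 2
    funext j
    by_cases hj : j = i
    · subst hj
      simp [Matrix.mul_vecMulVec]
    · simp [hj]
  have hLne : L (Pi.single a 1) ≠ 0 := by
    change (ψ (Pi.single i (Matrix.vecMulVec (Pi.single a 1) (Pi.single a 1)))).mulVec v ≠ 0
    rwa [← Matrix.single_eq_single_vecMulVec_single]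
  have hker : Function.Injective L := by
    rw [injective_iff_map_eq_zero]
    intro u hu
    by_contra hu0
    obtain ⟨b, hb⟩ : ∃ b, u b ≠ 0 := by
      by_contra! hc; exact hu0 (funext hc)
    apply hLne
    have := hLX (Pi.single i (Matrix.vecMulVec (Pi.single a 1) (Pi.single b (u b)⁻¹))) u
    rw [hu, Matrix.mulVec_zero, Pi.single_eq_same, Matrix.vecMulVec_mulVec] at this
    rw [← this]
    congr 1
    ext x
    simp [hb]
  have hsurj : Function.Surjective L := by
    rw [← LinearMap.range_eq_top]
    refine (hirr (LinearMap.range L) (inv_range L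
      (fun g => W.Φ (MonoidAlgebra.of ℂ G g) i) fun g u => ?_)).resolve_left ?_
    · rw [hψ, hLX]
    · intro hb
      exact hLne (by rw [LinearMap.range_eq_bot] at hb; rw [hb]; rfl)
  refine ⟨i, LinearEquiv.ofBijective L ⟨hker, hsurj⟩, fun g u => ?_⟩
  rw [hψ]
  exact hLX _ u

end Wed
end SLZeta

namespace SLZeta
variable {Γ G H : Type*} [Group Γ] [Group G] [Group H]

theorem factor_of_trivial {n : ℕ} (π : Γ →* G) (hπ : Function.Surjective π)
    (ρ : Γ →* GL (Fin n) ℂ) (h : ∀ g, π g = 1 → ρ g = 1) :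
    ∃ ρ' : G →* GL (Fin n) ℂ, ρ = ρ'.comp π := by
  refine ⟨π.liftOfSurjective hπ ⟨ρ, fun g hg => h g hg⟩, ?_⟩
  ext1 g
  exact (MonoidHom.liftOfRightInverse_comp_apply π _ (Function.rightInverse_surjInv hπ) ⟨ρ, fun g hg => h g hg⟩ g).symm

theorem irr_comp_iff {n : ℕ} (π : Γ →* G) (hπ : Function.Surjective π)
    (ρ : G →* GL (Fin n) ℂ) : RepIsIrreducible (ρ.comp π) ↔ RepIsIrreducible ρ := by
  have : ∀ V, RepInvariant (ρ.comp π) V ↔ RepInvariant ρ V := by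
    intro V
    constructor
    · intro h g
      obtain ⟨g, rfl⟩ := hπ g
      exact h g
    · intro h g
      exact h (π g)
  unfold RepIsIrreducible
  simp only [this]

namespace Wed
variable (W : Wed G)

theorem corr_comp {n : ℕ} (π : Γ →* G) (hπ : Function.Surjective π)
    (ρ : G →* GL (Fin n) ℂ) (i) : W.Corr π (ρ.comp π) i ↔ W.Corr (MonoidHom.id G) ρ i := by
  constructor
  · rintro ⟨L, hL⟩
    refine ⟨L, fun g u => ?_⟩
    obtain ⟨g, rfl⟩ := hπ g
    exact hL g u
  · rintro ⟨L, hL⟩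
    exact ⟨L, fun g u => hL (π g) u⟩

theorem corr_irr (i) : W.Corr (MonoidHom.id G) (W.irr i) i :=
  ⟨LinearEquiv.refl ℂ _, fun _ _ => rfl⟩

theorem card_quot {n : ℕ} (π : Γ →* G) (hπ : Function.Surjective π)
    (Q : (Γ →* GL (Fin n) ℂ) → Prop)
    (h1 : ∀ ρ, Q ρ → RepIsIrreducible ρ → ∀ g, π g = 1 → ρ g = 1)
    (h2 : ∀ ρ' : G →* GL (Fin n) ℂ, RepIsIrreducible ρ' → Q (ρ'.comp π)) :
    Nat.card (Quot fun ρ₁ ρ₂ : {ρ : Γ →* GL (Fin n) ℂ // Q ρ ∧ RepIsIrreducible ρ} =>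
      RepIso ρ₁.1 ρ₂.1) = Nat.card {i // W.d i = n} := by
  have hex : ∀ ρ : {ρ : Γ →* GL (Fin n) ℂ // Q ρ ∧ RepIsIrreducible ρ}, ∃ i, W.Corr π ρ.1 i := by
    rintro ⟨ρ, hQ, hI⟩
    obtain ⟨ρ', rfl⟩ := factor_of_trivial π hπ ρ (h1 ρ hQ hI)
    obtain ⟨i, hi⟩ := W.exists_corr ((irr_comp_iff π hπ ρ').mp hI)
    exact ⟨i, (W.corr_comp π hπ ρ' i).mpr hi⟩
  have huniq : ∀ ρ : {ρ : Γ →* GL (Fin n) ℂ // Q ρ ∧ RepIsIrreducible ρ}, ∀ i j,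
      W.Corr π ρ.1 i → W.Corr π ρ.1 j → i = j := by
    rintro ⟨ρ, hQ, hI⟩ i j hi hj
    obtain ⟨ρ', rfl⟩ := factor_of_trivial π hπ ρ (h1 ρ hQ hI)
    exact Corr.unique ((W.corr_comp π hπ ρ' i).mp hi) ((W.corr_comp π hπ ρ' j).mp hj)
  choose f hf using hex
  refine Nat.card_congr (Equiv.ofBijective (Quot.lift (fun ρ => (⟨f ρ, (hf ρ).dim_eq⟩ :
    {i // W.d i = n})) ?_) ⟨?_, ?_⟩)
  · intro a b hab
    exact Subtype.ext (huniq b _ _ ((hf a).of_iso hab) (hf b))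
  · rintro ⟨a⟩ ⟨b⟩ hab
    refine Quot.sound ?_
    have : f a = f b := congrArg Subtype.val hab
    exact Corr.iso (hf a) (this ▸ hf b)
  · rintro ⟨i, rfl⟩
    have hI : RepIsIrreducible ((W.irr i).comp π) := (irr_comp_iff π hπ _).mpr (W.irr_irreducible i)
    refine ⟨Quot.mk _ ⟨(W.irr i).comp π, h2 _ (W.irr_irreducible i), hI⟩, ?_⟩
    apply Subtype.ext
    refine huniq _ _ _ (hf _) ?_
    exact (W.corr_comp π hπ _ i).mpr (W.corr_irr i)

theorem old_equiv (WH : Wed H) (π : G →* H) (hπ : Function.Surjective π) :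
    ∃ f : Fin WH.r → Fin W.r, Function.Injective f ∧ (∀ j, W.d (f j) = WH.d j) ∧
      ∀ i, i ∈ Set.range f ↔ ∀ g, π g = 1 → W.Φ (MonoidAlgebra.of ℂ G g) i = 1 := by
  have hex : ∀ j, ∃ i, W.Corr (MonoidHom.id G) ((WH.irr j).comp π) i := fun j =>
    W.exists_corr ((irr_comp_iff π hπ _).mpr (WH.irr_irreducible j))
  choose f hf using hex
  refine ⟨f, ?_, fun j => (hf j).dim_eq, fun i => ⟨?_, fun hi => ?_⟩⟩
  · intro j j' hjj
    obtain ⟨L, hL⟩ := hf j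
    obtain ⟨L', hL'⟩ : W.Corr (MonoidHom.id G) ((WH.irr j').comp π) (f j) := hjj ▸ hf j'
    refine Corr.unique (WH.corr_irr j) ⟨L'.symm.trans L, fun h u => ?_⟩
    obtain ⟨g, rfl⟩ := hπ h
    obtain ⟨v, rfl⟩ := L'.surjective u
    have e1 := hL g v
    have e2 := hL' g v
    simp only [LinearEquiv.trans_apply, LinearEquiv.symm_apply_apply]
    rw [MonoidHom.comp_apply] at e1 e2
    rw [← e1, MonoidHom.id_apply, ← irr_coe, ← e2, LinearEquiv.symm_apply_apply]
  · rintro ⟨j, rfl⟩ g hg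
    obtain ⟨L, hL⟩ := hf j
    apply Matrix.mulVec_injective
    funext u
    apply L.injective
    have := hL g u
    rw [MonoidHom.comp_apply, hg, map_one] at this
    rw [MonoidHom.id_apply] at this
    rw [this]
    simp
  · obtain ⟨ρ', hρ'⟩ := factor_of_trivial π hπ (W.irr i) (fun g hg => Units.ext (hi g hg))
    have hI : RepIsIrreducible ρ' := by
      rw [← irr_comp_iff π hπ, ← hρ']; exact W.irr_irreducible i
    obtain ⟨j, L, hL⟩ := WH.exists_corr hI
    refine ⟨j, Corr.unique (hf j) ⟨L.symm, fun g u => ?_⟩⟩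
    obtain ⟨v, rfl⟩ := L.surjective u
    have := hL (π g) v
    rw [← MonoidHom.comp_apply ρ' π, ← hρ'] at this
    rw [MonoidHom.id_apply, ← irr_coe, ← this, LinearEquiv.symm_apply_apply,
      LinearEquiv.symm_apply_apply]
    rfl

end Wed
end SLZeta

/-! ### Part C: Clifford theory for a system of permuted idempotents -/
namespace SLZeta

section
variable {G : Type*} [Group G]

/-- `δ g` is the group element `g` in the group algebra -/
noncomputable abbrev δ (g : G) : MonoidAlgebra ℂ G := MonoidAlgebra.of ℂ G g

theorem δ_mul (g h : G) : δ (g * h) = δ g * δ h := map_mul _ _ _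
theorem δ_one : δ (1 : G) = 1 := map_one _

namespace Wed
variable (W : Wed G)

theorem sum_tr_mul_d [Fintype G] (g : G) [Decidable (g = 1)] :
    ∑ i, W.tr i (δ g) * W.d i = if g = 1 then (Fintype.card G : ℂ) else 0 := by
  classical
  have := W.ortho g 1
  simp only [map_one, W.tr_one, mul_one] at this
  rw [this]
  split_ifs with h
  · subst h; simp
  · rw [Finset.filter_false_of_mem]
    · simp
    · intro x _ hx
      exact h (mul_eq_right.mp hx)

theorem tr_mul_idem_zero_of_scalar (i : Fin W.r) {x : MonoidAlgebra ℂ G} {c : ℂ} (hc : c ≠ 1)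
    (h : W.tr i x = c * W.tr i x) : W.tr i x = 0 := by
  have : (1 - c) * W.tr i x = 0 := by linear_combination h
  rcases mul_eq_zero.mp this with h | h
  · exact absurd (sub_eq_zero.mp h).symm hc
  · exact h

/-- lower bound for the rank of an idempotent from a trace-orthogonal family -/
theorem card_le_rk_sq (i : Fin W.r) {e : MonoidAlgebra ℂ G} (he : e * e = e)
    (hne : W.Φ e i ≠ 0) {τ : Type*} [Fintype τ] (t : τ → G)
    (hcomm : ∀ s, δ (t s) * e = e * δ (t s))
    (hcomm' : ∀ s, δ (t s)⁻¹ * e = e * δ (t s)⁻¹)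
    (horth : ∀ s s', s ≠ s' → W.tr i (δ (t s * (t s')⁻¹) * e) = 0) :
    Fintype.card τ ≤ W.rk i e ^ 2 := by
  classical
  set E := W.Φ e i with hE
  have hEE : E * E = E := by rw [hE, ← Pi.mul_apply, ← map_mul, he]
  let P := (LinearMap.mulLeft ℂ E).comp (LinearMap.mulRight ℂ E)
  have hP : IsIdempotentElem P := by
    refine LinearMap.ext fun x => ?_
    simp only [P, Module.End.mul_apply, LinearMap.comp_apply, LinearMap.mulLeft_apply,
      LinearMap.mulRight_apply]
    calc E * (E * (x * E) * E) = (E * E) * x * (E * E) := by noncomm_ring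
      _ = E * (x * E) := by rw [hEE, mul_assoc]
  have h1 := (LinearMap.IsIdempotentElem.isProj_range _ hP).trace
  rw [trace_matrix_mul, hE, ← tr_def, tr_eq_rk _ _ he] at h1
  have h2 : W.rk i e ^ 2 = Module.finrank ℂ (LinearMap.range P) := by
    rw [sq]; exact_mod_cast h1
  rw [h2]
  have hmem : ∀ s, W.Φ (δ (t s) * e) i ∈ LinearMap.range P := by
    intro s
    refine ⟨W.Φ (δ (t s)) i, ?_⟩
    simp only [P, LinearMap.comp_apply, LinearMap.mulLeft_apply, LinearMap.mulRight_apply, hE]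
    rw [← Pi.mul_apply, ← map_mul, ← Pi.mul_apply, ← map_mul, ← mul_assoc, ← hcomm, mul_assoc, he]
  let v : τ → LinearMap.range P := fun s => ⟨_, hmem s⟩
  have hli : LinearIndependent ℂ v := by
    rw [Fintype.linearIndependent_iff]
    intro c hc b
    have hc' : ∑ s, c s • W.Φ (δ (t s) * e) i = 0 := by
      have := congrArg Subtype.val hc
      simpa [v] using this
    have h3 : ∑ s, c s * W.tr i (δ (t s * (t b)⁻¹) * e) = 0 := by
      have h4 := congrArg (fun M => (M * W.Φ (δ (t b)⁻¹) i).trace) hc'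
      simp only [Finset.sum_mul, Matrix.trace_sum, zero_mul, Matrix.trace_zero,
        smul_mul_assoc, Matrix.trace_smul, smul_eq_mul] at h4
      rw [← h4]
      refine Finset.sum_congr rfl fun s _ => ?_
      rw [← Pi.mul_apply, ← map_mul, ← tr_def, mul_assoc, ← hcomm' b, ← mul_assoc, δ_mul]
    rw [Finset.sum_eq_single b] at h3
    · rw [mul_inv_cancel, δ_one, one_mul, tr_eq_rk _ _ he] at h3
      rcases mul_eq_zero.mp h3 with h | h
      · exact h
      · exact absurd ((W.rk_eq_zero i e).mp (by exact_mod_cast h)) hne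
    · intro s _ hs
      rw [horth s b hs, mul_zero]
    · simp
  exact hli.fintype_card_le_finrank

end Wed
end

/-- A complete system of orthogonal idempotents permuted by conjugation. -/
structure IdemSys (G Λ : Type*) [Group G] [Fintype Λ] [MulAction G Λ] where
  e : Λ → MonoidAlgebra ℂ G
  idem : ∀ a, e a * e a = e a
  orth : ∀ a b, a ≠ b → e a * e b = 0
  sum_one : ∑ a, e a = 1
  conj : ∀ (g : G) a, δ g * e a = e (g • a) * δ g

namespace IdemSys
variable {G Λ : Type*} [Group G] [Fintype G] [Fintype Λ] [MulAction G Λ] (S : IdemSys G Λ) (W : Wed G)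

/-- multiplicity -/
noncomputable def m (i : Fin W.r) (a : Λ) : ℕ := W.rk i (S.e a)

theorem m_cast (i) (a) : (S.m W i a : ℂ) = W.tr i (S.e a) := (W.tr_eq_rk i (S.idem a)).symm

theorem m_smul (i) (g : G) (a) : S.m W i (g • a) = S.m W i a := by
  have h : S.e (g • a) = δ g * (S.e a * δ g⁻¹) := by
    rw [← mul_assoc, S.conj, mul_assoc, ← δ_mul, mul_inv_cancel, δ_one, mul_one]
  have : (S.m W i (g • a) : ℂ) = S.m W i a := by
    rw [m_cast, m_cast, h, W.tr_mul_comm, mul_assoc, ← δ_mul, inv_mul_cancel, δ_one, mul_one]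
  exact_mod_cast this

theorem d_eq_sum (i) : W.d i = ∑ a, S.m W i a := by
  have : (W.d i : ℂ) = ((∑ a, S.m W i a : ℕ) : ℂ) := by
    push_cast
    simp_rw [m_cast]
    rw [← map_sum, S.sum_one, W.tr_one]
  exact_mod_cast this

open Classical in
theorem m_eq_zero_of_not_mem (i) (a b) (ha : S.m W i a ≠ 0) (hb : b ∉ MulAction.orbit G a) :
    S.m W i b = 0 := by
  let f := ∑ c ∈ Finset.univ.filter (· ∈ MulAction.orbit G a), S.e c
  have hmul : ∀ c, c ∈ MulAction.orbit G a → f * S.e c = S.e c := by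
    intro c hc
    simp only [f, Finset.sum_mul]
    rw [Finset.sum_eq_single c]
    · exact S.idem c
    · intro b _ hb; exact S.orth b c hb
    · intro h; exact absurd (by simpa using hc) h
  have hmul0 : ∀ c, c ∉ MulAction.orbit G a → f * S.e c = 0 := by
    intro c hc
    simp only [f, Finset.sum_mul]
    refine Finset.sum_eq_zero fun b hb => S.orth b c ?_
    rintro rfl
    exact hc (by simpa using hb)
  have hff : f * f = f := by
    conv_lhs => rw [show f = ∑ c ∈ Finset.univ.filter (· ∈ MulAction.orbit G a), S.e c from rfl,
      Finset.mul_sum]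
    refine Finset.sum_congr rfl fun c hc => hmul c (by simpa using hc)
  have hcen : ∀ g, δ g * f = f * δ g := by
    intro g
    simp only [f, Finset.mul_sum, Finset.sum_mul]
    simp_rw [S.conj]
    refine Finset.sum_bij (fun c _ => g • c) ?_ ?_ ?_ ?_
    · intro c hc
      simp only [Finset.mem_filter, Finset.mem_univ, true_and] at hc ⊢
      obtain ⟨h, rfl⟩ := hc
      exact ⟨g * h, mul_smul g h a⟩
    · intro c _ c' _ h; exact MulAction.injective g h
    · intro c hc
      refine ⟨g⁻¹ • c, ?_, by simp⟩
      simp only [Finset.mem_filter, Finset.mem_univ, true_and] at hc ⊢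
      obtain ⟨h, rfl⟩ := hc
      exact ⟨g⁻¹ * h, mul_smul g⁻¹ h a⟩
    · intro c _; rfl
  rcases W.central_idem i hcen hff with h | h
  · exfalso
    apply ha
    refine (W.rk_eq_zero i _).mpr ?_
    rw [← hmul a (MulAction.mem_orbit_self a), map_mul, Pi.mul_apply, h, zero_mul]
  · refine (W.rk_eq_zero i _).mpr ?_
    have := congrFun (congrArg W.Φ (hmul0 b hb)) i
    rwa [map_mul, Pi.mul_apply, h, one_mul, map_zero] at this

/-- orbit size -/
noncomputable def osz (G : Type*) {Λ : Type*} [Group G] [MulAction G Λ] (a : Λ) : ℕ := (MulAction.orbit G a).ncard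

theorem osz_pos [Finite G] (a : Λ) : 0 < osz G a :=
  (Set.ncard_pos (Set.toFinite _)).mpr ⟨a, MulAction.mem_orbit_self a⟩

theorem d_eq (i) (a) (ha : S.m W i a ≠ 0) : W.d i = osz G a * S.m W i a := by
  classical
  rw [S.d_eq_sum W, ← Finset.sum_subset (Finset.subset_univ
    (Finset.univ.filter (· ∈ MulAction.orbit G a)))]
  · rw [Finset.sum_congr rfl (g := fun _ => S.m W i a), Finset.sum_const, smul_eq_mul]
    · congr 1
      unfold osz
      rw [Set.ncard_eq_toFinset_card']
      congr 1
      ext; simp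
    · intro b hb
      simp only [Finset.mem_filter, Finset.mem_univ, true_and] at hb
      obtain ⟨g, rfl⟩ := hb
      exact S.m_smul W i g a
  · intro b _ hb
    exact S.m_eq_zero_of_not_mem W i a b ha (by simpa using hb)

open Classical in
/-- irreps lying over a nonzero index -/
noncomputable def new (z : Λ) : Finset (Fin W.r) := Finset.univ.filter fun i => ∃ a, a ≠ z ∧ S.m W i a ≠ 0

open Classical in
theorem sum_new (z : Λ) (hz : ∀ g : G, g • z = z) (F : Fin W.r → ℝ) :
    ∑ i ∈ S.new W z, F i = ∑ a ∈ Finset.univ.filter (· ≠ z), (1 / (osz G a : ℝ)) *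
      ∑ i ∈ Finset.univ.filter (fun i => S.m W i a ≠ 0), F i := by
  have h1 : ∀ i ∈ S.new W z, F i = ∑ a ∈ Finset.univ.filter (· ≠ z),
      (1 / (osz G a : ℝ)) * if S.m W i a ≠ 0 then F i else 0 := by
    intro i hi
    obtain ⟨a, haz, ha⟩ := (Finset.mem_filter.mp hi).2
    have horb : ∀ b, S.m W i b ≠ 0 ↔ b ∈ MulAction.orbit G a := by
      intro b
      constructor
      · intro hb; by_contra hc; exact hb (S.m_eq_zero_of_not_mem W i a b ha hc)
      · rintro ⟨g, rfl⟩
        change S.m W i (g • a) ≠ 0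
        rwa [S.m_smul]
    have hzo : ∀ b ∈ MulAction.orbit G a, b ≠ z := by
      rintro _ ⟨g, rfl⟩ h
      apply haz
      have : g⁻¹ • (g • a) = g⁻¹ • z := by rw [← h]
      rwa [inv_smul_smul, hz] at this
    have : ∀ b ∈ Finset.univ.filter (· ≠ z), ((1 / (osz G b : ℝ)) * if S.m W i b ≠ 0 then F i else 0) =
        if b ∈ MulAction.orbit G a then (1 / (osz G a : ℝ)) * F i else 0 := by
      intro b _
      by_cases hb : b ∈ MulAction.orbit G a
      · rw [if_pos hb, if_pos ((horb b).mpr hb)]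
        congr 3
        unfold osz
        rw [MulAction.orbit_eq_iff.mpr hb]
      · rw [if_neg hb, if_neg (fun h => hb ((horb b).mp h)), mul_zero]
    rw [Finset.sum_congr rfl this, ← Finset.sum_filter, Finset.sum_const, nsmul_eq_mul]
    have hcard : (Finset.filter (fun b => b ∈ MulAction.orbit G a)
        (Finset.univ.filter (· ≠ z))).card = osz G a := by
      unfold osz
      rw [Set.ncard_eq_toFinset_card']
      congr 1
      ext b
      simp only [Finset.mem_filter, Finset.mem_univ, true_and, Set.mem_toFinset]
      exact ⟨fun h => h.2, fun h => ⟨hzo b h, h⟩⟩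
    rw [hcard]
    have : (osz G a : ℝ) ≠ 0 := by exact_mod_cast (osz_pos (G := G) a).ne'
    field_simp
  rw [Finset.sum_congr rfl h1, Finset.sum_comm]
  refine Finset.sum_congr rfl fun a ha => ?_
  rw [← Finset.mul_sum]
  congr 1
  rw [← Finset.sum_filter]
  refine Finset.sum_congr ?_ fun _ _ => rfl
  ext i
  simp only [new, Finset.mem_filter, Finset.mem_univ, true_and, ne_eq] at ha ⊢
  exact ⟨fun h => h.2, fun h => ⟨⟨a, ha, h⟩, h⟩⟩

end IdemSys
end SLZeta

/-! ### Part C4: extremal counting -/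
namespace SLZeta
namespace IdemSys
variable {G Λ : Type*} [Group G] [Fintype G] [Fintype Λ] [MulAction G Λ] (S : IdemSys G Λ) (W : Wed G)

open Classical in
theorem sum_m_d (a : Λ) : ∑ i, (S.m W i a : ℝ) * W.d i =
    ∑ i ∈ Finset.univ.filter (fun i => S.m W i a ≠ 0), (osz G a : ℝ) * (S.m W i a : ℝ) ^ 2 := by
  rw [Finset.sum_filter]
  refine Finset.sum_congr rfl fun i _ => ?_
  split_ifs with h
  · rw [S.d_eq W i a h]; push_cast; ring
  · simp only [ne_eq, not_not] at h
    simp [h]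

open Classical in
theorem count_le (M : ℝ) (b : ℕ) (hb0 : 0 < b) (a : Λ)
    (hM : ∑ i, (S.m W i a : ℝ) * W.d i = M)
    (hb : ∀ i, S.m W i a ≠ 0 → b ≤ S.m W i a) :
    ((Finset.univ.filter (fun i => S.m W i a ≠ 0)).card : ℝ) ≤ M / (b ^ 2 * osz G a) ∧
    (((Finset.univ.filter (fun i => S.m W i a ≠ 0)).card : ℝ) = M / (b ^ 2 * osz G a) →
      ∀ i, S.m W i a ≠ 0 → S.m W i a = b) := by
  have ho : (0 : ℝ) < osz G a := by exact_mod_cast osz_pos (G := G) a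
  have hb0' : (0 : ℝ) < b := by exact_mod_cast hb0
  rw [S.sum_m_d W a] at hM
  set s := Finset.univ.filter (fun i => S.m W i a ≠ 0) with hs
  have key : ∀ i ∈ s, (osz G a : ℝ) * (b : ℝ) ^ 2 ≤ (osz G a : ℝ) * (S.m W i a : ℝ) ^ 2 := by
    intro i hi
    have : (b : ℝ) ≤ S.m W i a := by exact_mod_cast hb i (by simpa [hs] using hi)
    gcongr
  constructor
  · rw [le_div_iff₀ (by positivity), ← hM]
    calc _ = ∑ i ∈ s, (osz G a : ℝ) * (b : ℝ) ^ 2 := by rw [Finset.sum_const, nsmul_eq_mul]; ring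
      _ ≤ _ := Finset.sum_le_sum key
  · intro heq i hi
    rw [eq_div_iff (by positivity), ← hM] at heq
    have h2 : ∑ i ∈ s, (osz G a : ℝ) * (b : ℝ) ^ 2 = ∑ i ∈ s, (osz G a : ℝ) * (S.m W i a : ℝ) ^ 2 := by
      rw [← heq, Finset.sum_const, nsmul_eq_mul]; ring
    have h3 := (Finset.sum_eq_sum_iff_of_le key).mp h2 i (by simpa [hs] using hi)
    have h4 := mul_left_cancel₀ ho.ne' h3
    have h5 := (pow_left_inj₀ (by positivity) (by positivity) two_ne_zero).mp h4
    exact_mod_cast h5.symm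

open Classical in
theorem new_le (z : Λ) (hz : ∀ g : G, g • z = z) (M : ℝ) (b : ℕ) (hb0 : 0 < b)
    (hM : ∀ a, a ≠ z → ∑ i, (S.m W i a : ℝ) * W.d i = M)
    (hb : ∀ a, a ≠ z → ∀ i, S.m W i a ≠ 0 → b ≤ S.m W i a) :
    ((S.new W z).card : ℝ) ≤ ∑ a ∈ Finset.univ.filter (· ≠ z), M / (b ^ 2 * (osz G a : ℝ) ^ 2) ∧
    (((S.new W z).card : ℝ) = ∑ a ∈ Finset.univ.filter (· ≠ z), M / (b ^ 2 * (osz G a : ℝ) ^ 2) →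
      ∀ F : ℕ → ℝ, ∑ i ∈ S.new W z, F (W.d i) =
        ∑ a ∈ Finset.univ.filter (· ≠ z), M / (b ^ 2 * (osz G a : ℝ) ^ 2) * F (osz G a * b)) := by
  have hcard := S.sum_new W z hz (fun _ => 1)
  simp only [Finset.sum_const, nsmul_eq_mul, mul_one] at hcard
  have key : ∀ a ∈ Finset.univ.filter (· ≠ z), (1 / (osz G a : ℝ)) *
      ((Finset.univ.filter (fun i => S.m W i a ≠ 0)).card : ℝ) ≤ M / (b ^ 2 * (osz G a : ℝ) ^ 2) := by
    intro a ha
    have haz : a ≠ z := by simpa using ha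
    have ho : (0 : ℝ) < osz G a := by exact_mod_cast osz_pos (G := G) a
    have hb0' : (0 : ℝ) < b := by exact_mod_cast hb0
    calc _ ≤ (1 / (osz G a : ℝ)) * (M / (b ^ 2 * osz G a)) := by
          gcongr; exact (S.count_le W M b hb0 a (hM a haz) (hb a haz)).1
      _ = _ := by field_simp
  rw [hcard]
  refine ⟨Finset.sum_le_sum key, fun heq F => ?_⟩
  have h2 := (Finset.sum_eq_sum_iff_of_le key).mp heq
  rw [S.sum_new W z hz (fun i => F (W.d i))]
  refine Finset.sum_congr rfl fun a ha => ?_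
  have haz : a ≠ z := by simpa using ha
  have ho : (0 : ℝ) < osz G a := by exact_mod_cast osz_pos (G := G) a
  have hb0' : (0 : ℝ) < b := by exact_mod_cast hb0
  have h3 := h2 a ha
  have h4 : ((Finset.univ.filter (fun i => S.m W i a ≠ 0)).card : ℝ) = M / (b ^ 2 * osz G a) := by
    field_simp at h3 ⊢
    linarith
  have h5 := (S.count_le W M b hb0 a (hM a haz) (hb a haz)).2 h4
  rw [Finset.sum_congr rfl (g := fun _ => F (osz G a * b)), Finset.sum_const, nsmul_eq_mul,
    ← mul_assoc, h3]
  intro i hi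
  have hi' : S.m W i a ≠ 0 := by simpa using hi
  rw [S.d_eq W i a hi', h5 i hi']

end IdemSys
end SLZeta

/-! ### Part Fo: Fourier idempotents attached to a finite abelian subgroup -/
namespace SLZeta

/-- A homomorphism `n` from a finite abelian group together with a self-pairing. -/
structure FD (G V : Type*) [Group G] [AddCommGroup V] [Fintype V] where
  n : V → G
  n_add : ∀ x y, n (x + y) = n x * n y
  χ : V → V → ℂ
  χ_zero : ∀ a, χ a 0 = 1
  χ_add : ∀ a x y, χ a (x + y) = χ a x * χ a y
  orth : ∀ a a', a ≠ a' → ∑ x, χ a' x * χ a (-x) = 0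
  orth' : ∀ x, x ≠ 0 → ∑ a, χ a x = 0

namespace FD
variable {G V : Type*} [Group G] [AddCommGroup V] [Fintype V] (D : FD G V)

theorem n_zero : D.n 0 = 1 := by
  have := D.n_add 0 0
  rw [add_zero] at this
  exact (mul_eq_left.mp this.symm)

theorem n_neg (x) : D.n (-x) = (D.n x)⁻¹ := by
  rw [eq_inv_iff_mul_eq_one, ← D.n_add, neg_add_cancel, D.n_zero]

theorem χ_neg_mul (a x) : D.χ a x * D.χ a (-x) = 1 := by
  rw [← D.χ_add, add_neg_cancel, D.χ_zero]

/-- the Fourier idempotent -/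
noncomputable def e (a : V) : MonoidAlgebra ℂ G :=
  (Fintype.card V : ℂ)⁻¹ • ∑ x, D.χ a (-x) • δ (D.n x)

theorem card_ne : (Fintype.card V : ℂ) ≠ 0 := by
  exact_mod_cast Fintype.card_ne_zero

theorem n_mul_e (a x) : δ (D.n x) * D.e a = D.χ a x • D.e a := by
  unfold e
  rw [mul_smul_comm, smul_comm (D.χ a x)]
  congr 1
  rw [Finset.mul_sum, Finset.smul_sum]
  refine Fintype.sum_equiv (Equiv.addLeft x) _ _ fun y => ?_
  simp only [Equiv.coe_addLeft, mul_smul_comm]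
  rw [← δ_mul, ← D.n_add, smul_smul, neg_add, D.χ_add, ← mul_assoc, D.χ_neg_mul, one_mul]

theorem e_mul_n (a x) : D.e a * δ (D.n x) = D.χ a x • D.e a := by
  rw [← D.n_mul_e]
  unfold e
  rw [mul_smul_comm, smul_mul_assoc, Finset.mul_sum, Finset.sum_mul]
  congr 1
  refine Finset.sum_congr rfl fun y _ => ?_
  rw [smul_mul_assoc, mul_smul_comm, ← δ_mul, ← δ_mul, ← D.n_add, ← D.n_add, add_comm]

theorem e_mul_e (a a') : D.e a * D.e a' =
    ((Fintype.card V : ℂ)⁻¹ * ∑ x, D.χ a' x * D.χ a (-x)) • D.e a' := by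
  conv_lhs => unfold e
  rw [show ((Fintype.card V : ℂ)⁻¹ • ∑ x, D.χ a' (-x) • δ (D.n x)) = D.e a' from rfl]
  rw [smul_mul_assoc, Finset.sum_mul, mul_smul]
  congr 1
  rw [Finset.sum_smul]
  refine Finset.sum_congr rfl fun y _ => ?_
  rw [smul_mul_assoc, D.n_mul_e, smul_smul, mul_comm]

theorem e_idem (a) : D.e a * D.e a = D.e a := by
  rw [e_mul_e]
  simp_rw [D.χ_neg_mul]
  simp [card_ne]

theorem e_orth (a a') (h : a ≠ a') : D.e a * D.e a' = 0 := by
  rw [e_mul_e, D.orth a a' h]; simp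

theorem e_sum : ∑ a, D.e a = 1 := by
  classical
  unfold e
  rw [← Finset.smul_sum, Finset.sum_comm]
  simp_rw [← Finset.sum_smul]
  rw [Finset.sum_eq_single 0]
  · simp [D.χ_zero, D.n_zero, card_ne, ← δ_one]
  · intro x _ hx
    rw [D.orth' (-x) (by simpa using hx), zero_smul]
  · simp

theorem e_conj (g : G) (a a' : V) (σ : V ≃ V) (h1 : ∀ x, g * D.n x = D.n (σ x) * g)
    (h2 : ∀ x, D.χ a' (-(σ x)) = D.χ a (-x)) : δ g * D.e a = D.e a' * δ g := by
  unfold e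
  rw [mul_smul_comm, smul_mul_assoc, Finset.mul_sum, Finset.sum_mul]
  congr 1
  refine Fintype.sum_equiv σ _ _ fun y => ?_
  rw [mul_smul_comm, smul_mul_assoc, ← δ_mul, ← δ_mul, h1, h2]

/-- the associated idempotent system -/
noncomputable def sys [MulAction G V] (h1 : ∀ (g : G) x, g * D.n x = D.n (g • x) * g)
    (h2 : ∀ (g : G) a x, D.χ (g • a) (-(g • x)) = D.χ a (-x)) : IdemSys G V where
  e := D.e
  idem := D.e_idem
  orth := D.e_orth
  sum_one := D.e_sum
  conj g a := D.e_conj g a (g • a) (MulAction.toPerm g) (h1 g) (h2 g a)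

theorem sum_tr_d [Fintype G] (hn : ∀ x, D.n x = 1 → x = 0) (W : Wed G) (a : V) :
    ∑ i, W.tr i (D.e a) * W.d i = Fintype.card G / Fintype.card V := by
  classical
  have : ∀ i, W.tr i (D.e a) * W.d i = (Fintype.card V : ℂ)⁻¹ *
      ∑ x, D.χ a (-x) * (W.tr i (δ (D.n x)) * W.d i) := by
    intro i
    unfold e
    rw [map_smul, map_sum, smul_eq_mul, mul_assoc, Finset.sum_mul]
    congr 1
    refine Finset.sum_congr rfl fun x _ => ?_
    rw [map_smul, smul_eq_mul, mul_assoc]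
  simp_rw [this]
  rw [← Finset.mul_sum, Finset.sum_comm]
  simp_rw [← Finset.mul_sum, W.sum_tr_mul_d]
  rw [Finset.sum_eq_single 0]
  · rw [if_pos D.n_zero, neg_zero, D.χ_zero]; field_simp
  · intro x _ hx
    rw [if_neg (fun h => hx (hn x h)), mul_zero]
  · simp

/-- construction from a nondegenerate pairing into `ZMod p` -/
noncomputable def ofPairing (p : ℕ) [Fact p.Prime] (n : V → G) (n_add : ∀ x y, n (x + y) = n x * n y)
    (B : V → V → ZMod p) (hB : ∀ a x y, B a (x + y) = B a x + B a y)
    (hB' : ∀ a b x, B (a + b) x = B a x + B b x)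
    (hnd : ∀ a, a ≠ 0 → ∃ x, B a x ≠ 0) (hnd' : ∀ x, x ≠ 0 → ∃ a, B a x ≠ 0) : FD G V where
  n := n
  n_add := n_add
  χ a x := ZMod.stdAddChar (B a x)
  χ_zero a := by
    have : B a 0 = 0 := by simpa using hB a 0 0
    rw [this, AddChar.map_zero_eq_one]
  χ_add a x y := by rw [hB, AddChar.map_add_eq_mul]
  orth a a' h := by
    obtain ⟨x0, hx0⟩ := hnd (a' - a) (sub_ne_zero.mpr h.symm)
    let f : V →+ ZMod p := AddMonoidHom.mk' (fun x => B (a' - a) x) (fun x y => hB _ _ _)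
    have hne : (ZMod.stdAddChar (N := p)).compAddMonoidHom f ≠ 0 := by
      intro h
      apply hx0
      have := DFunLike.congr_fun h x0
      rw [AddChar.compAddMonoidHom_apply, AddChar.zero_apply,
        ← AddChar.map_zero_eq_one (ZMod.stdAddChar (N := p))] at this
      exact ZMod.injective_stdAddChar this
    have := AddChar.sum_eq_zero_iff_ne_zero.mpr hne
    rw [← this]
    refine Finset.sum_congr rfl fun x _ => ?_
    rw [AddChar.compAddMonoidHom_apply, ← AddChar.map_add_eq_mul]
    congr 1
    have e1 : B a x + B (a' - a) x = B a' x := by rw [← hB']; simp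
    have e2 : B a x + B a (-x) = 0 := by
      rw [← hB, add_neg_cancel]; simpa using hB a 0 0
    change _ = B (a' - a) x
    linear_combination e2 - e1
  orth' x hx := by
    obtain ⟨a0, ha0⟩ := hnd' x hx
    let f : V →+ ZMod p := AddMonoidHom.mk' (fun a => B a x) (fun a b => hB' _ _ _)
    have hne : (ZMod.stdAddChar (N := p)).compAddMonoidHom f ≠ 0 := by
      intro h
      apply ha0
      have := DFunLike.congr_fun h a0
      rw [AddChar.compAddMonoidHom_apply, AddChar.zero_apply,
        ← AddChar.map_zero_eq_one (ZMod.stdAddChar (N := p))] at this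
      exact ZMod.injective_stdAddChar this
    exact AddChar.sum_eq_zero_iff_ne_zero.mpr hne

end FD
end SLZeta

/-! ### Part SL: the groups `SL₂(ℤ/p^k)` -/
namespace SLZeta

section surj
variable {R S : Type*} [CommRing R] [CommRing S]

/-- build an element of `SL₂` from entries -/
def mkSL (a b c d : R) (h : a * d - b * c = 1) : SL(2, R) :=
  ⟨!![a, b; c, d], by rw [Matrix.det_fin_two_of]; exact h⟩

theorem sl_ext {g h : SL(2, R)} (h00 : g 0 0 = h 0 0) (h01 : g 0 1 = h 0 1) (h10 : g 1 0 = h 1 0)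
    (h11 : g 1 1 = h 1 1) : g = h := by
  ext i j; fin_cases i <;> fin_cases j <;> assumption

theorem sl_det (g : SL(2, R)) : g 0 0 * g 1 1 - g 0 1 * g 1 0 = 1 := by
  have := g.det_coe; rwa [Matrix.det_fin_two] at this

theorem mul00 (g h : SL(2, R)) : (g * h) 0 0 = g 0 0 * h 0 0 + g 0 1 * h 1 0 := by
  simp [Matrix.SpecialLinearGroup.coe_mul, Matrix.mul_apply, Fin.sum_univ_two]
theorem mul01 (g h : SL(2, R)) : (g * h) 0 1 = g 0 0 * h 0 1 + g 0 1 * h 1 1 := by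
  simp [Matrix.SpecialLinearGroup.coe_mul, Matrix.mul_apply, Fin.sum_univ_two]
theorem mul10 (g h : SL(2, R)) : (g * h) 1 0 = g 1 0 * h 0 0 + g 1 1 * h 1 0 := by
  simp [Matrix.SpecialLinearGroup.coe_mul, Matrix.mul_apply, Fin.sum_univ_two]
theorem mul11 (g h : SL(2, R)) : (g * h) 1 1 = g 1 0 * h 0 1 + g 1 1 * h 1 1 := by
  simp [Matrix.SpecialLinearGroup.coe_mul, Matrix.mul_apply, Fin.sum_univ_two]
theorem inv00 (g : SL(2, R)) : g⁻¹ 0 0 = g 1 1 := by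
  rw [Matrix.SpecialLinearGroup.SL2_inv_expl]; rfl
theorem inv01 (g : SL(2, R)) : g⁻¹ 0 1 = - g 0 1 := by
  rw [Matrix.SpecialLinearGroup.SL2_inv_expl]; rfl
theorem inv10 (g : SL(2, R)) : g⁻¹ 1 0 = - g 1 0 := by
  rw [Matrix.SpecialLinearGroup.SL2_inv_expl]; rfl
theorem inv11 (g : SL(2, R)) : g⁻¹ 1 1 = g 0 0 := by
  rw [Matrix.SpecialLinearGroup.SL2_inv_expl]; rfl
theorem one00 : (1 : SL(2, R)) 0 0 = 1 := rfl
theorem one01 : (1 : SL(2, R)) 0 1 = 0 := rfl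
theorem one10 : (1 : SL(2, R)) 1 0 = 0 := rfl
theorem one11 : (1 : SL(2, R)) 1 1 = 1 := rfl
theorem mk00 (a b c d : R) (h) : (mkSL a b c d h) 0 0 = a := rfl
theorem mk01 (a b c d : R) (h) : (mkSL a b c d h) 0 1 = b := rfl
theorem mk10 (a b c d : R) (h) : (mkSL a b c d h) 1 0 = c := rfl
theorem mk11 (a b c d : R) (h) : (mkSL a b c d h) 1 1 = d := rfl
theorem map_ij (f : R →+* S) (g : SL(2, R)) (i j) : (Matrix.SpecialLinearGroup.map f g) i j = f (g i j) := rfl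

theorem map_surj [IsLocalRing S] (f : R →+* S) (hf : Function.Surjective f) [IsLocalHom f] :
    Function.Surjective (Matrix.SpecialLinearGroup.map (n := Fin 2) f) := by
  intro g
  obtain ⟨a, ha⟩ := hf (g 0 0)
  obtain ⟨b, hb⟩ := hf (g 0 1)
  obtain ⟨c, hc⟩ := hf (g 1 0)
  obtain ⟨d, hd⟩ := hf (g 1 1)
  have hdet := sl_det g
  by_cases h : IsUnit (g 0 0)
  · have hu : IsUnit a := by rw [← ha] at h; exact isUnit_of_map_unit f a h
    obtain ⟨u, hu⟩ := hu.exists_right_inv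
    have hu' : g 0 0 * f u = 1 := by rw [← ha, ← map_mul, hu, map_one]
    refine ⟨mkSL a b c (u * (1 + b * c)) (by linear_combination (1 + b * c) * hu), ?_⟩
    apply sl_ext <;> rw [map_ij]
    · rw [mk00, ha]
    · rw [mk01, hb]
    · rw [mk10, hc]
    · rw [mk11, map_mul, map_add, map_mul, map_one, hb, hc]
      linear_combination g 1 1 * hu' - f u * hdet
  · have h1 : IsUnit (- (g 0 1 * g 1 0)) := by
      have := IsLocalRing.isUnit_or_isUnit_of_add_one (a := g 0 0 * g 1 1)
        (b := - (g 0 1 * g 1 0)) (by linear_combination hdet)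
      rcases this with h2 | h2
      · exact absurd (isUnit_of_mul_isUnit_left h2) h
      · exact h2
    have h2 : IsUnit (g 0 1) := isUnit_of_mul_isUnit_left ((IsUnit.neg_iff _).mp h1)
    have hu : IsUnit b := by rw [← hb] at h2; exact isUnit_of_map_unit f b h2
    obtain ⟨u, hu⟩ := hu.exists_right_inv
    have hu' : g 0 1 * f u = 1 := by rw [← hb, ← map_mul, hu, map_one]
    refine ⟨mkSL a b (u * (a * d - 1)) d (by linear_combination (1 - a * d) * hu), ?_⟩
    apply sl_ext <;> rw [map_ij]
    · rw [mk00, ha]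
    · rw [mk01, hb]
    · rw [mk10, map_mul, map_sub, map_mul, map_one, ha, hd]
      linear_combination g 1 0 * hu' + f u * hdet
    · rw [mk11, hd]

end surj

variable (p : ℕ) [hpp : Fact p.Prime]

instance (k : ℕ) : Nontrivial (ZMod (p ^ (k + 1))) :=
  ZMod.nontrivial_iff.mpr (Nat.one_lt_pow (Nat.succ_ne_zero k) hpp.out.one_lt).ne'

instance (k : ℕ) : NeZero (p ^ (k + 1)) := ⟨(pow_pos hpp.out.pos _).ne'⟩

theorem toZModPow_surj (k : ℕ) : Function.Surjective (PadicInt.toZModPow (p := p) k) :=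
  ZMod.ringHom_surjective _

instance (k : ℕ) : IsLocalRing (ZMod (p ^ (k + 1))) :=
  IsLocalRing.of_surjective' (PadicInt.toZModPow (p := p) (k + 1)) (toZModPow_surj p _)

/-- reduction modulo `p` -/
def red (k : ℕ) : ZMod (p ^ (k + 1)) →+* ZMod p :=
  ZMod.castHom (dvd_pow_self p (Nat.succ_ne_zero k)) (ZMod p)

/-- reduction by one level -/
def dn (k : ℕ) : ZMod (p ^ (k + 2)) →+* ZMod (p ^ (k + 1)) :=
  ZMod.castHom (pow_dvd_pow p (Nat.le_succ _)) _

theorem red_surj (k) : Function.Surjective (red p k) := ZMod.ringHom_surjective _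
theorem dn_surj (k) : Function.Surjective (dn p k) := ZMod.ringHom_surjective _

instance (k) : IsLocalHom (red p k) := IsLocalHom.of_surjective _ (red_surj p k)
instance (k) : IsLocalHom (dn p k) := IsLocalHom.of_surjective _ (dn_surj p k)
instance (k) : IsLocalHom (PadicInt.toZModPow (p := p) (k + 1)) :=
  IsLocalHom.of_surjective _ (toZModPow_surj p _)

theorem red_dn (k) (x) : red p k (dn p k x) = red p (k + 1) x := by
  have : (red p k).comp (dn p k) = red p (k + 1) := Subsingleton.elim _ _
  exact DFunLike.congr_fun this x

theorem isUnit_iff_red (k) (x : ZMod (p ^ (k + 1))) : IsUnit x ↔ red p k x ≠ 0 := by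
  rw [← isUnit_iff_ne_zero]
  exact (isUnit_map_iff (red p k) x).symm

/-- multiplication by `p^(k+1)` -/
def io (k : ℕ) : ZMod p →+ ZMod (p ^ (k + 2)) :=
  ZMod.lift p ⟨(AddMonoidHom.mulLeft ((p : ZMod (p ^ (k + 2))) ^ (k + 1))).comp
    (Int.castAddHom (ZMod (p ^ (k + 2)))), by
      simp only [AddMonoidHom.comp_apply, AddMonoidHom.coe_mulLeft, Int.coe_castAddHom, Int.cast_natCast]
      rw [← pow_succ]
      exact_mod_cast ZMod.natCast_self (p ^ (k + 2))⟩

theorem io_intCast (k) (z : ℤ) : io p k (z : ZMod p) = (p : ZMod (p ^ (k + 2))) ^ (k + 1) * z := by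
  unfold io
  rw [ZMod.lift_coe]
  rfl

theorem io_red (k) (x : ZMod (p ^ (k + 2))) :
    io p k (red p (k + 1) x) = (p : ZMod (p ^ (k + 2))) ^ (k + 1) * x := by
  obtain ⟨z, rfl⟩ := ZMod.intCast_surjective x
  rw [map_intCast, io_intCast]

theorem io_mul (k) (x : ZMod p) (y : ZMod (p ^ (k + 2))) :
    io p k x * y = io p k (x * red p (k + 1) y) := by
  obtain ⟨z, rfl⟩ := red_surj p (k + 1) x
  rw [← map_mul, io_red, io_red, mul_assoc]

theorem mul_io (k) (x : ZMod p) (y : ZMod (p ^ (k + 2))) :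
    y * io p k x = io p k (red p (k + 1) y * x) := by
  rw [mul_comm, io_mul, mul_comm]

theorem red_io (k) (x : ZMod p) : red p (k + 1) (io p k x) = 0 := by
  obtain ⟨z, rfl⟩ := red_surj p (k + 1) x
  rw [io_red, map_mul, map_pow, map_natCast, ZMod.natCast_self, zero_pow (Nat.succ_ne_zero k), zero_mul]

theorem io_mul_io (k) (x y : ZMod p) : io p k x * io p k y = 0 := by
  rw [io_mul, red_io, mul_zero, map_zero]

theorem io_eq_zero (k) (x : ZMod p) : io p k x = 0 ↔ x = 0 := by
  refine ⟨fun h => ?_, fun h => by rw [h, map_zero]⟩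
  obtain ⟨z, rfl⟩ := ZMod.intCast_surjective x
  rw [io_intCast] at h
  have h' : (((p : ℤ) ^ (k + 1) * z : ℤ) : ZMod (p ^ (k + 2))) = 0 := by push_cast; exact h
  rw [ZMod.intCast_zmod_eq_zero_iff_dvd] at h' 
  rw [ZMod.intCast_zmod_eq_zero_iff_dvd]
  push_cast at h'
  rw [pow_succ (p : ℤ) (k + 1)] at h'
  exact Int.dvd_of_mul_dvd_mul_left (pow_ne_zero _ (by exact_mod_cast hpp.out.ne_zero)) h'

theorem dn_eq_zero (k) (x : ZMod (p ^ (k + 2))) : dn p k x = 0 ↔ ∃ y, x = io p k y := by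
  constructor
  · intro h
    obtain ⟨z, rfl⟩ := ZMod.intCast_surjective x
    rw [map_intCast, ZMod.intCast_zmod_eq_zero_iff_dvd] at h
    obtain ⟨w, rfl⟩ := h
    exact ⟨w, by rw [io_intCast]; push_cast; rfl⟩
  · rintro ⟨y, rfl⟩
    obtain ⟨z, rfl⟩ := red_surj p (k + 1) y
    rw [io_red, map_mul, map_pow, map_natCast]
    have : (p : ZMod (p ^ (k + 1))) ^ (k + 1) = 0 := by
      exact_mod_cast ZMod.natCast_self (p ^ (k + 1))
    rw [this, zero_mul]

end SLZeta

/-! ### Part SM: the adjoint module and the congruence kernel -/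
namespace SLZeta

/-- traceless matrices over `F_p`, with coordinates `[[α, β], [γ, -α]]` -/
abbrev Vp (p : ℕ) : Type := ZMod p × ZMod p × ZMod p

variable {p : ℕ}
theorem vp_ext {A B : Vp p} (h1 : A.1 = B.1) (h2 : A.2.1 = B.2.1) (h3 : A.2.2 = B.2.2) : A = B :=
  Prod.ext h1 (Prod.ext h2 h3)

instance : SMul SL(2, ZMod p) (Vp p) where
  smul g A := (A.1 * (g 0 0 * g 1 1 + g 0 1 * g 1 0) + A.2.2 * g 0 1 * g 1 1 - A.2.1 * g 0 0 * g 1 0,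
    A.2.1 * g 0 0 ^ 2 - 2 * g 0 0 * g 0 1 * A.1 - g 0 1 ^ 2 * A.2.2,
    2 * g 1 0 * g 1 1 * A.1 + g 1 1 ^ 2 * A.2.2 - g 1 0 ^ 2 * A.2.1)

theorem smul_1 (g : SL(2, ZMod p)) (A : Vp p) : (g • A).1 =
  A.1 * (g 0 0 * g 1 1 + g 0 1 * g 1 0) + A.2.2 * g 0 1 * g 1 1 - A.2.1 * g 0 0 * g 1 0 := rfl
theorem smul_2 (g : SL(2, ZMod p)) (A : Vp p) : (g • A).2.1 =
  A.2.1 * g 0 0 ^ 2 - 2 * g 0 0 * g 0 1 * A.1 - g 0 1 ^ 2 * A.2.2 := rfl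
theorem smul_3 (g : SL(2, ZMod p)) (A : Vp p) : (g • A).2.2 =
  2 * g 1 0 * g 1 1 * A.1 + g 1 1 ^ 2 * A.2.2 - g 1 0 ^ 2 * A.2.1 := rfl

instance : MulAction SL(2, ZMod p) (Vp p) where
  one_smul A := by
    apply vp_ext
    · rw [smul_1, one00, one01, one10, one11]; ring
    · rw [smul_2, one00, one01]; ring
    · rw [smul_3, one10, one11]; ring
  mul_smul g h A := by
    have hd := sl_det h
    apply vp_ext
    · rw [smul_1 g, smul_1, smul_1, smul_2, smul_3, mul00, mul01, mul10, mul11]; ring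
    · rw [smul_2 g, smul_1, smul_2, smul_2, smul_3, mul00, mul01]; ring
    · rw [smul_3 g, smul_1, smul_2, smul_3, smul_3, mul10, mul11]; ring

/-- the pairing `tr (A X)` -/
def Bt (A X : Vp p) : ZMod p := 2 * A.1 * X.1 + A.2.1 * X.2.2 + A.2.2 * X.2.1

theorem Bt_smul (g : SL(2, ZMod p)) (A X : Vp p) : Bt (g • A) (g • X) = Bt A X := by
  have hd := sl_det g
  unfold Bt
  simp only [smul_1, smul_2, smul_3]
  generalize g 0 0 = x at *
  generalize g 0 1 = y at *
  generalize g 1 0 = z at *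
  generalize g 1 1 = w at *
  linear_combination (2 * A.1 * X.1 + A.2.1 * X.2.2 + A.2.2 * X.2.1) * (x * w - y * z + 1) * hd

/-- quadratic invariant -/
def Dl (A : Vp p) : ZMod p := A.1 ^ 2 + A.2.1 * A.2.2

theorem Dl_smul (g : SL(2, ZMod p)) (A : Vp p) : Dl (g • A) = Dl A := by
  have hd := sl_det g
  unfold Dl
  simp only [smul_1, smul_2, smul_3]
  generalize g 0 0 = x at *
  generalize g 0 1 = y at *
  generalize g 1 0 = z at *
  generalize g 1 1 = w at *
  linear_combination (A.1 ^ 2 + A.2.1 * A.2.2) * (x * w - y * z + 1) * hd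

variable (p) [hpp : Fact p.Prime]

/-- `SL₂(ℤ/p^(k+1))` -/
abbrev Gk (k : ℕ) : Type := SL(2, ZMod (p ^ (k + 1)))

noncomputable instance (k : ℕ) : Fintype (Gk p k) := Fintype.ofFinite _

/-- reduction to `SL₂(F_p)` -/
def redG (k : ℕ) : Gk p k →* SL(2, ZMod p) := Matrix.SpecialLinearGroup.map (red p k)
/-- reduction by one level -/
def dnG (k : ℕ) : Gk p (k + 1) →* Gk p k := Matrix.SpecialLinearGroup.map (dn p k)

theorem redG_surj (k) : Function.Surjective (redG p k) := map_surj _ (red_surj p k)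
theorem dnG_surj (k) : Function.Surjective (dnG p k) := map_surj _ (dn_surj p k)

theorem redG_ij (k) (g : Gk p k) (i j) : redG p k g i j = red p k (g i j) := rfl
theorem dnG_ij (k) (g : Gk p (k + 1)) (i j) : dnG p k g i j = dn p k (g i j) := rfl

instance (k : ℕ) : MulAction (Gk p k) (Vp p) := MulAction.compHom _ (redG p k)

theorem gk_smul (k) (g : Gk p k) (A : Vp p) : g • A = redG p k g • A := rfl

/-- the congruence kernel -/
def nn (k : ℕ) (X : Vp p) : Gk p (k + 1) :=
  mkSL (1 + io p k X.1) (io p k X.2.1) (io p k X.2.2) (1 - io p k X.1)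
    (by linear_combination - io_mul_io p k X.1 X.1 - io_mul_io p k X.2.1 X.2.2)

theorem vadd1 (X Y : Vp p) : (X + Y).1 = X.1 + Y.1 := rfl
theorem vadd2 (X Y : Vp p) : (X + Y).2.1 = X.2.1 + Y.2.1 := rfl
theorem vadd3 (X Y : Vp p) : (X + Y).2.2 = X.2.2 + Y.2.2 := rfl

theorem nn_add (k) (X Y : Vp p) : nn p k (X + Y) = nn p k X * nn p k Y := by
  have h := io_mul_io p k
  apply sl_ext
  · rw [mul00]; simp only [nn, mk00, mk01, mk10, mk11, vadd1, vadd2, vadd3, map_add]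
    linear_combination - h X.1 Y.1 - h X.2.1 Y.2.2
  · rw [mul01]; simp only [nn, mk00, mk01, mk10, mk11, vadd1, vadd2, vadd3, map_add]
    linear_combination - h X.1 Y.2.1 + h X.2.1 Y.1
  · rw [mul10]; simp only [nn, mk00, mk01, mk10, mk11, vadd1, vadd2, vadd3, map_add]
    linear_combination - h X.2.2 Y.1 + h X.1 Y.2.2
  · rw [mul11]; simp only [nn, mk00, mk01, mk10, mk11, vadd1, vadd2, vadd3, map_add]
    linear_combination - h X.1 Y.1 - h X.2.2 Y.2.1

theorem nn_inj (k) (X : Vp p) (h : nn p k X = 1) : X = 0 := by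
  have h0 := congrArg (fun g : Gk p (k + 1) => g 0 0) h
  have h1 := congrArg (fun g : Gk p (k + 1) => g 0 1) h
  have h2 := congrArg (fun g : Gk p (k + 1) => g 1 0) h
  simp only [nn, mk00, mk01, mk10, one00, one01, one10] at h0 h1 h2
  apply vp_ext
  · exact (io_eq_zero p k _).mp (by linear_combination h0)
  · exact (io_eq_zero p k _).mp h1
  · exact (io_eq_zero p k _).mp h2

theorem dnG_nn (k) (X : Vp p) : dnG p k (nn p k X) = 1 := by
  have h : ∀ x, dn p k (io p k x) = 0 := fun x => (dn_eq_zero p k _).mpr ⟨x, rfl⟩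
  apply sl_ext <;> rw [dnG_ij] <;>
    simp [nn, mk00, mk01, mk10, mk11, one00, one01, one10, one11, h]

theorem dnG_eq_one (k) (g : Gk p (k + 1)) (h : dnG p k g = 1) : ∃ X, g = nn p k X := by
  have h00 : dn p k (g 0 0) = 1 := by rw [← dnG_ij, h, one00]
  have h01 : dn p k (g 0 1) = 0 := by rw [← dnG_ij, h, one01]
  have h10 : dn p k (g 1 0) = 0 := by rw [← dnG_ij, h, one10]
  have h11 : dn p k (g 1 1) = 1 := by rw [← dnG_ij, h, one11]
  obtain ⟨a, ha⟩ := (dn_eq_zero p k (g 0 0 - 1)).mp (by rw [map_sub, h00, map_one, sub_self])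
  obtain ⟨b, hb⟩ := (dn_eq_zero p k (g 0 1)).mp h01
  obtain ⟨c, hc⟩ := (dn_eq_zero p k (g 1 0)).mp h10
  obtain ⟨d, hd⟩ := (dn_eq_zero p k (g 1 1 - 1)).mp (by rw [map_sub, h11, map_one, sub_self])
  refine ⟨((a, b, c) : ZMod p × ZMod p × ZMod p), ?_⟩
  have hdet := sl_det g
  have ha' : g 0 0 = 1 + io p k a := by rw [← ha]; ring
  have hd' : g 1 1 = 1 + io p k d := by rw [← hd]; ring
  apply sl_ext
  · exact ha'
  · exact hb
  · exact hc
  · change g 1 1 = 1 - io p k a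
    rw [ha', hd', hb, hc] at hdet
    rw [hd']
    linear_combination hdet - io_mul_io p k a d + io_mul_io p k b c

theorem nn_conj (k) (g : Gk p (k + 1)) (X : Vp p) : g * nn p k X = nn p k (g • X) * g := by
  rw [gk_smul]
  have hd := sl_det (redG p (k + 1) g)
  have key : ∀ u v, u = v → io p k u = io p k v := fun u v h => by rw [h]
  simp only [redG_ij] at hd
  apply sl_ext
  · have h := key (red p (k + 1) (g 0 0) * X.1 + red p (k + 1) (g 0 1) * X.2.2) ((redG p (k + 1) g • X).1 * red p (k + 1) (g 0 0) + (redG p (k + 1) g • X).2.1 * red p (k + 1) (g 1 0)) (by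
      simp only [smul_1, smul_2, smul_3, redG_ij]
      linear_combination - (red p (k + 1) (g 0 0) * X.1 + red p (k + 1) (g 0 1) * X.2.2) * hd)
    rw [mul00, mul00]; simp only [nn, mk00, mk01, mk10, mk11]
    simp only [map_add, map_sub] at h
    simp only [add_mul, sub_mul, mul_add, mul_sub, one_mul, mul_one, io_mul, mul_io]
    linear_combination h
  · have h := key (red p (k + 1) (g 0 0) * X.2.1 - red p (k + 1) (g 0 1) * X.1) ((redG p (k + 1) g • X).1 * red p (k + 1) (g 0 1) + (redG p (k + 1) g • X).2.1 * red p (k + 1) (g 1 1)) (by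
      simp only [smul_1, smul_2, smul_3, redG_ij]
      linear_combination - (red p (k + 1) (g 0 0) * X.2.1 - red p (k + 1) (g 0 1) * X.1) * hd)
    rw [mul01, mul01]; simp only [nn, mk00, mk01, mk10, mk11]
    simp only [map_add, map_sub] at h
    simp only [add_mul, sub_mul, mul_add, mul_sub, one_mul, mul_one, io_mul, mul_io]
    linear_combination h
  · have h := key (red p (k + 1) (g 1 0) * X.1 + red p (k + 1) (g 1 1) * X.2.2) ((redG p (k + 1) g • X).2.2 * red p (k + 1) (g 0 0) - (redG p (k + 1) g • X).1 * red p (k + 1) (g 1 0)) (by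
      simp only [smul_1, smul_2, smul_3, redG_ij]
      linear_combination - (red p (k + 1) (g 1 0) * X.1 + red p (k + 1) (g 1 1) * X.2.2) * hd)
    rw [mul10, mul10]; simp only [nn, mk00, mk01, mk10, mk11]
    simp only [map_add, map_sub] at h
    simp only [add_mul, sub_mul, mul_add, mul_sub, one_mul, mul_one, io_mul, mul_io]
    linear_combination h
  · have h := key (red p (k + 1) (g 1 0) * X.2.1 - red p (k + 1) (g 1 1) * X.1) ((redG p (k + 1) g • X).2.2 * red p (k + 1) (g 0 1) - (redG p (k + 1) g • X).1 * red p (k + 1) (g 1 1)) (by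
      simp only [smul_1, smul_2, smul_3, redG_ij]
      linear_combination - (red p (k + 1) (g 1 0) * X.2.1 - red p (k + 1) (g 1 1) * X.1) * hd)
    rw [mul11, mul11]; simp only [nn, mk00, mk01, mk10, mk11]
    simp only [map_add, map_sub] at h
    simp only [add_mul, sub_mul, mul_add, mul_sub, one_mul, mul_one, io_mul, mul_io]
    linear_combination h

theorem card_G_succ (k) : Fintype.card (Gk p (k + 1)) = Fintype.card (Gk p k) * p ^ 3 := by
  rw [← Nat.card_eq_fintype_card, ← Nat.card_eq_fintype_card]
  have h1 := Subgroup.card_eq_card_quotient_mul_card_subgroup (dnG p k).ker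
  rw [Nat.card_congr (QuotientGroup.quotientKerEquivOfSurjective _ (dnG_surj p k)).toEquiv] at h1
  rw [h1]
  congr 1
  have : Function.Bijective (fun X : Vp p => (⟨nn p k X, dnG_nn p k X⟩ : (dnG p k).ker)) := by
    constructor
    · intro X Y h
      have h' : nn p k X = nn p k Y := congrArg Subtype.val h
      have : nn p k (X - Y) = 1 := by
        have h2 := nn_add p k (X - Y) Y
        rw [sub_add_cancel, h'] at h2
        exact mul_eq_right.mp h2.symm
      exact sub_eq_zero.mp (nn_inj p k _ this)
    · rintro ⟨g, hg⟩
      obtain ⟨X, rfl⟩ := dnG_eq_one p k g hg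
      exact ⟨X, rfl⟩
  rw [← Nat.card_congr (Equiv.ofBijective _ this)]
  change Nat.card (ZMod p × ZMod p × ZMod p) = _
  simp [Nat.card_prod]
  ring

end SLZeta

/-! ### Part SN: the idempotent system at level `k + 2` and the lower bound for multiplicities -/
namespace SLZeta

theorem two_ne_zero_zmod (p : ℕ) [hpp : Fact p.Prime] (hp : p ≠ 2) : (2 : ZMod p) ≠ 0 := by
  intro h
  have : ((2 : ℕ) : ZMod p) = 0 := by exact_mod_cast h
  rw [ZMod.natCast_eq_zero_iff] at this
  exact hp ((Nat.prime_dvd_prime_iff_eq hpp.out Nat.prime_two).mp this)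

theorem exists_val (p : ℕ) [hpp : Fact p.Prime] (k : ℕ) (b b' : Fin (p ^ k)) (h : b ≠ b') :
    ∃ (j : ℕ) (y : ℤ), j < k ∧ ((b : ℕ) : ℤ) - ((b' : ℕ) : ℤ) = (p : ℤ) ^ j * y ∧ ¬ (p : ℤ) ∣ y := by
  set x : ℤ := ((b : ℕ) : ℤ) - ((b' : ℕ) : ℤ) with hx
  have hx0 : x ≠ 0 := by
    intro h0
    apply h
    ext
    have : ((b : ℕ) : ℤ) = ((b' : ℕ) : ℤ) := by linarith
    exact_mod_cast this
  have hfin : FiniteMultiplicity (p : ℤ) x :=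
    Int.finiteMultiplicity_iff.mpr ⟨by simpa using hpp.out.one_lt.ne', hx0⟩
  obtain ⟨y, hy, hny⟩ := hfin.exists_eq_pow_mul_and_not_dvd
  refine ⟨_, y, ?_, hy, hny⟩
  by_contra hj
  push Not at hj
  have hd : (p : ℤ) ^ k ∣ x := by
    rw [hy]; exact Dvd.dvd.mul_right (pow_dvd_pow _ hj) _
  have hlt : |x| < (p : ℤ) ^ k := by
    have h1 : ((b : ℕ) : ℤ) < (p : ℤ) ^ k := by exact_mod_cast b.2
    have h2 : ((b' : ℕ) : ℤ) < (p : ℤ) ^ k := by exact_mod_cast b'.2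
    rw [abs_lt]
    constructor <;> omega
  exact hx0 (Int.eq_zero_of_abs_lt_dvd hd hlt)

section ring
variable {R : Type*} [CommRing R]

/-- the transversal elements -/
def tt (P b c : R) : SL(2, R) := mkSL 1 (P * b) (P * c) (1 + P ^ 2 * b * c) (by ring)

/-- lower unipotent -/
def lo (x : R) : SL(2, R) := mkSL 1 0 x 1 (by ring)
/-- upper unipotent -/
def up (x : R) : SL(2, R) := mkSL 1 x 0 1 (by ring)

theorem tt_rel1 (P b b' c c' y : R) (j l : ℕ) (hP : P ^ (j + l + 3) = 0) (hb : b - b' = P ^ j * y)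
    (N : SL(2, R)) (h00 : N 0 0 = 1 - P ^ (j + l + 2) * y) (h01 : N 0 1 = 0) (h10 : N 1 0 = 0)
    (h11 : N 1 1 = 1 + P ^ (j + l + 2) * y) :
    lo (P ^ (l + 1)) * (tt P b c * (tt P b' c')⁻¹) =
      N * (tt P b c * (tt P b' c')⁻¹) * lo (P ^ (l + 1)) := by
  have hb2 : b = b' + P ^ j * y := by rw [← hb]; ring
  have e1 : P ^ (j + l + 3) = P ^ j * P ^ l * P ^ 3 := by ring
  have e2 : P ^ (j + l + 2) = P ^ j * P ^ l * P ^ 2 := by ring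
  have e3 : P ^ (l + 1) = P ^ l * P := by ring
  rw [e1] at hP
  rw [e2] at h00 h11
  rw [e3]
  generalize P ^ j = Q at *
  generalize P ^ l = L at *
  subst hb2
  apply sl_ext
  · simp only [mul00, mul01, mul10, mul11, inv00, inv01, inv10, inv11, h00, h01, h10, h11, lo, tt,
      mk00, mk01, mk10, mk11]
    linear_combination (-c' * P * Q * y^2 + y^2 * L * Q * P) * hP
  · simp only [mul00, mul01, mul10, mul11, inv00, inv01, inv10, inv11, h00, h01, h10, h11, lo, tt,
      mk00, mk01, mk10, mk11]
    linear_combination (Q * y^2) * hP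
  · simp only [mul00, mul01, mul10, mul11, inv00, inv01, inv10, inv11, h00, h01, h10, h11, lo, tt,
      mk00, mk01, mk10, mk11]
    linear_combination (-2 * y * c + P ^ 2 * c' * Q * y ^ 2 * c - L * y - L * P ^ 2 * Q * y ^ 2 * c) * hP
  · simp only [mul00, mul01, mul10, mul11, inv00, inv01, inv10, inv11, h00, h01, h10, h11, lo, tt,
      mk00, mk01, mk10, mk11]
    linear_combination (-c * P * Q * y^2) * hP

theorem tt_rel2 (P b c c' y : R) (j l : ℕ) (hP : P ^ (j + l + 3) = 0) (hc : c - c' = P ^ j * y)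
    (N : SL(2, R)) (h00 : N 0 0 = 1 + P ^ (j + l + 2) * y) (h01 : N 0 1 = 0) (h10 : N 1 0 = 0)
    (h11 : N 1 1 = 1 - P ^ (j + l + 2) * y) :
    up (P ^ (l + 1)) * (tt P b c * (tt P b c')⁻¹) =
      N * (tt P b c * (tt P b c')⁻¹) * up (P ^ (l + 1)) := by
  have hc2 : c = c' + P ^ j * y := by rw [← hc]; ring
  have e1 : P ^ (j + l + 3) = P ^ j * P ^ l * P ^ 3 := by ring
  have e2 : P ^ (j + l + 2) = P ^ j * P ^ l * P ^ 2 := by ring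
  have e3 : P ^ (l + 1) = P ^ l * P := by ring
  rw [e1] at hP
  rw [e2] at h00 h11
  rw [e3]
  generalize P ^ j = Q at *
  generalize P ^ l = L at *
  subst hc2
  apply sl_ext
  · simp only [mul00, mul01, mul10, mul11, inv00, inv01, inv10, inv11, h00, h01, h10, h11, up, tt,
      mk00, mk01, mk10, mk11]
    ring
  · simp only [mul00, mul01, mul10, mul11, inv00, inv01, inv10, inv11, h00, h01, h10, h11, up, tt,
      mk00, mk01, mk10, mk11]
    linear_combination (-L * y) * hP
  · simp only [mul00, mul01, mul10, mul11, inv00, inv01, inv10, inv11, h00, h01, h10, h11, up, tt,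
      mk00, mk01, mk10, mk11]
    linear_combination (Q * y^2) * hP
  · simp only [mul00, mul01, mul10, mul11, inv00, inv01, inv10, inv11, h00, h01, h10, h11, up, tt,
      mk00, mk01, mk10, mk11]
    linear_combination (L * Q * P * y^2) * hP
end ring

variable (p : ℕ) [hpp : Fact p.Prime]

/-- Fourier data on the last congruence layer -/
noncomputable def fdk (hp : p ≠ 2) (k : ℕ) : FD (Gk p (k + 1)) (Vp p) :=
  FD.ofPairing p (nn p k) (nn_add p k) Bt
    (fun a x y => by simp only [Bt, vadd1, vadd2, vadd3]; ring)
    (fun a x y => by simp only [Bt, vadd1, vadd2, vadd3]; ring)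
    (fun a ha => by
      by_contra! h
      apply ha
      have h2 := two_ne_zero_zmod p hp
      have h1 := h (1, 0, 0)
      have h3 := h (0, 1, 0)
      have h4 := h (0, 0, 1)
      simp only [Bt, mul_one, mul_zero, add_zero, zero_add] at h1 h3 h4
      exact vp_ext ((mul_eq_zero.mp h1).resolve_left h2) h4 h3)
    (fun x hx => by
      by_contra! h
      apply hx
      have h2 := two_ne_zero_zmod p hp
      have h1 := h (1, 0, 0)
      have h3 := h (0, 1, 0)
      have h4 := h (0, 0, 1)
      simp only [Bt, mul_one, one_mul, mul_zero, zero_mul, add_zero, zero_add] at h1 h3 h4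
      exact vp_ext ((mul_eq_zero.mp h1).resolve_left h2) h4 h3)

theorem fdk_χ (hp : p ≠ 2) (k) (A X : Vp p) : (fdk p hp k).χ A X = ZMod.stdAddChar (Bt A X) := rfl
theorem fdk_n (hp : p ≠ 2) (k) (X : Vp p) : (fdk p hp k).n X = nn p k X := rfl

theorem Bt_neg (A X : Vp p) : Bt A (-X) = - Bt A X := by
  simp only [Bt, Prod.fst_neg, Prod.snd_neg]; ring

/-- the idempotent system -/
noncomputable def sysk (hp : p ≠ 2) (k : ℕ) : IdemSys (Gk p (k + 1)) (Vp p) :=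
  (fdk p hp k).sys (nn_conj p k) (fun g a x => by
    rw [fdk_χ, fdk_χ, Bt_neg, Bt_neg, gk_smul, gk_smul, Bt_smul])

theorem sysk_e (hp : p ≠ 2) (k) (A) : (sysk p hp k).e A = (fdk p hp k).e A := rfl

theorem smul_of_red (k) (g : Gk p k) (h : redG p k g = 1) (A : Vp p) : g • A = A := by
  rw [gk_smul, h, one_smul]

theorem tr_kill (hp : p ≠ 2) (k) (W : Wed (Gk p (k + 1))) (i) (A : Vp p) (g h : Gk p (k + 1))
    (X : Vp p) (hh : redG p (k + 1) h = 1) (hrel : h * g = nn p k X * g * h)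
    (hX : Bt A X ≠ 0) : W.tr i (δ g * (sysk p hp k).e A) = 0 := by
  set S := sysk p hp k with hS
  have hc : δ h⁻¹ * S.e A = S.e A * δ h⁻¹ := by
    have := S.conj h⁻¹ A
    rwa [smul_of_red p _ _ (by rw [map_inv, hh, inv_one])] at this
  have h1 : W.tr i (δ (nn p k X * g) * S.e A) = W.tr i (δ g * S.e A) := by
    rw [show nn p k X * g = h * g * h⁻¹ by rw [hrel]; group, δ_mul, δ_mul, mul_assoc, hc,
      mul_assoc, W.tr_mul_comm, mul_assoc, mul_assoc, ← δ_mul, inv_mul_cancel, δ_one, mul_one]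
  have h2 : W.tr i (δ (nn p k X * g) * S.e A) = ZMod.stdAddChar (Bt A X) * W.tr i (δ g * S.e A) := by
    rw [δ_mul, mul_assoc, W.tr_mul_comm, mul_assoc, hS, sysk_e, ← fdk_n p hp, FD.e_mul_n, fdk_χ,
      mul_smul_comm, map_smul, smul_eq_mul]
  refine W.tr_mul_idem_zero_of_scalar i (c := ZMod.stdAddChar (Bt A X)) ?_ (h1.symm.trans h2)
  intro h
  rw [← AddChar.map_zero_eq_one (ZMod.stdAddChar (N := p))] at h
  exact hX (ZMod.injective_stdAddChar h)

theorem m_ge_aux (hp : p ≠ 2) (k) (W : Wed (Gk p (k + 1))) (i) (A : Vp p) (hA : A.1 ≠ 0)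
    (hm : (sysk p hp k).m W i A ≠ 0) : p ^ k ≤ (sysk p hp k).m W i A := by
  set S := sysk p hp k with hS
  have h2 := two_ne_zero_zmod p hp
  let P : ZMod (p ^ (k + 2)) := p
  have hP : P ^ (k + 2) = 0 := by
    simp only [P]; exact_mod_cast ZMod.natCast_self (p ^ (k + 2))
  have hrP : red p (k + 1) P = 0 := by simp only [P]; rw [map_natCast, ZMod.natCast_self]
  let t : Fin (p ^ k) × Fin (p ^ k) → Gk p (k + 1) := fun s =>
    tt P ((s.1 : ℕ) : ZMod (p ^ (k + 2))) ((s.2 : ℕ) : ZMod (p ^ (k + 2)))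
  have hrt : ∀ s, redG p (k + 1) (t s) = 1 := by
    intro s
    apply sl_ext <;> rw [redG_ij] <;>
    simp [t, tt, mk00, mk01, mk10, mk11, one00, one01, one10, one11, hrP]
  have key := W.card_le_rk_sq i (S.idem A) (fun h => hm ((W.rk_eq_zero i _).mpr h)) t
    (fun s => by
      have := S.conj (t s) A
      rwa [smul_of_red p _ _ (hrt s)] at this)
    (fun s => by
      have := S.conj (t s)⁻¹ A
      rwa [smul_of_red p _ _ (by rw [map_inv, hrt, inv_one])] at this)
    (by
      rintro ⟨b, c⟩ ⟨b', c'⟩ hne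
      by_cases hbb : b = b'
      · subst hbb
        have hcc : c ≠ c' := fun h => hne (by rw [h])
        obtain ⟨j, y, hj, hy, hny⟩ := exists_val p k c c' hcc
        obtain ⟨l, rfl⟩ := Nat.exists_eq_add_of_lt hj
        have hy' : ((c : ℕ) : ZMod (p ^ (j + l + 1 + 2))) - ((c' : ℕ) : ZMod (p ^ (j + l + 1 + 2))) =
            P ^ j * (y : ZMod (p ^ (j + l + 1 + 2))) := by
          have := congrArg (Int.cast : ℤ → ZMod (p ^ (j + l + 1 + 2))) hy
          push_cast at this
          exact this
        refine tr_kill p hp _ W i A _ (up (P ^ (l + 1))) ((y : ZMod p), 0, 0) ?_ ?_ ?_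
        · apply sl_ext <;> rw [redG_ij] <;>
          simp [up, mk00, mk01, mk10, mk11, one00, one01, one10, one11, hrP]
        · rw [tt_rel2 P _ _ _ (y : ZMod (p ^ (j + l + 1 + 2))) j l hP hy' (nn p _ ((y : ZMod p), 0, 0))]
          · simp only [nn, mk00]; rw [io_intCast]
          · simp only [nn, mk01, map_zero]
          · simp only [nn, mk10, map_zero]
          · simp only [nn, mk11]; rw [io_intCast]
        · simp only [Bt, mul_zero, add_zero]
          refine mul_ne_zero (mul_ne_zero h2 hA) ?_
          rwa [Ne, ZMod.intCast_zmod_eq_zero_iff_dvd]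
      · obtain ⟨j, y, hj, hy, hny⟩ := exists_val p k b b' hbb
        obtain ⟨l, rfl⟩ := Nat.exists_eq_add_of_lt hj
        have hy' : ((b : ℕ) : ZMod (p ^ (j + l + 1 + 2))) - ((b' : ℕ) : ZMod (p ^ (j + l + 1 + 2))) =
            P ^ j * (y : ZMod (p ^ (j + l + 1 + 2))) := by
          have := congrArg (Int.cast : ℤ → ZMod (p ^ (j + l + 1 + 2))) hy
          push_cast at this
          exact this
        refine tr_kill p hp _ W i A _ (lo (P ^ (l + 1))) (-(y : ZMod p), 0, 0) ?_ ?_ ?_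
        · apply sl_ext <;> rw [redG_ij] <;>
          simp [lo, mk00, mk01, mk10, mk11, one00, one01, one10, one11, hrP]
        · rw [tt_rel1 P _ _ _ _ (y : ZMod (p ^ (j + l + 1 + 2))) j l hP hy' (nn p _ (-(y : ZMod p), 0, 0))]
          · simp only [nn, mk00, map_neg]; rw [io_intCast]; ring
          · simp only [nn, mk01, map_zero]
          · simp only [nn, mk10, map_zero]
          · simp only [nn, mk11, map_neg]; rw [io_intCast]; ring
        · simp only [Bt, mul_zero, add_zero]
          refine mul_ne_zero (mul_ne_zero h2 hA) ?_
          rwa [neg_ne_zero, Ne, ZMod.intCast_zmod_eq_zero_iff_dvd])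
  rw [Fintype.card_prod, Fintype.card_fin, ← sq] at key
  exact (Nat.pow_le_pow_iff_left two_ne_zero).mp key

theorem m_ge (hp : p ≠ 2) (k) (W : Wed (Gk p (k + 1))) (i) (A : Vp p) (hA : A ≠ 0)
    (hm : (sysk p hp k).m W i A ≠ 0) : p ^ k ≤ (sysk p hp k).m W i A := by
  have h : ∃ g : SL(2, ZMod p), (g • A).1 ≠ 0 := by
    by_contra! h
    apply hA
    have h1 := h 1
    rw [one_smul] at h1
    have h2 := h (lo 1)
    have h3 := h (up 1)
    simp only [smul_1, lo, up, mk00, mk01, mk10, mk11, h1] at h2 h3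
    exact vp_ext h1 (by simpa using h2) (by simpa using h3)
  obtain ⟨g, hg⟩ := h
  obtain ⟨g', rfl⟩ := redG_surj p (k + 1) g
  rw [← gk_smul] at hg
  rw [← (sysk p hp k).m_smul W i g' A] at hm ⊢
  exact m_ge_aux p hp k W i _ hg hm

theorem sum_m_d_eq (hp : p ≠ 2) (k) (W : Wed (Gk p (k + 1))) (A : Vp p) :
    ∑ i, ((sysk p hp k).m W i A : ℝ) * W.d i = Fintype.card (Gk p k) := by
  have h := (fdk p hp k).sum_tr_d (fun x hx => nn_inj p k x hx) W A
  rw [card_G_succ] at h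
  have hV : Fintype.card (Vp p) = p ^ 3 := by simp [Fintype.card_prod, ZMod.card]; ring
  rw [hV, Nat.cast_mul, mul_div_cancel_right₀ _ (by exact_mod_cast (pow_pos hpp.out.pos 3).ne')] at h
  have h2 : ∑ i, ((sysk p hp k).m W i A : ℂ) * W.d i = Fintype.card (Gk p k) := by
    rw [← h]
    refine Finset.sum_congr rfl fun i _ => ?_
    rw [IdemSys.m_cast, sysk_e]
  exact_mod_cast h2

end SLZeta

/-! ### Part SO: old and new representations -/
namespace SLZeta

theorem FD.new_iff {G V : Type*} [Group G] [Fintype G] [AddCommGroup V] [Fintype V] (D : FD G V) [MulAction G V]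
    (h1 : ∀ (g : G) x, g * D.n x = D.n (g • x) * g)
    (h2 : ∀ (g : G) a x, D.χ (g • a) (-(g • x)) = D.χ a (-x)) (h3 : ∀ x, D.χ 0 x = 1) (W : Wed G) (i) :
    i ∉ (D.sys h1 h2).new W 0 ↔ ∀ x, W.Φ (δ (D.n x)) i = 1 := by
  classical
  set S := D.sys h1 h2
  have hn : i ∉ S.new W 0 ↔ ∀ a, a ≠ 0 → W.Φ (D.e a) i = 0 := by
    simp only [IdemSys.new, Finset.mem_filter, Finset.mem_univ, true_and, not_exists, not_and, ne_eq, not_not]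
    refine forall_congr' fun a => imp_congr_right fun _ => ?_
    exact W.rk_eq_zero i _
  rw [hn]
  constructor
  · intro h x
    have h0 : W.Φ (D.e 0) i = 1 := by
      have := congrFun (congrArg W.Φ D.e_sum) i
      rw [map_sum, Finset.sum_apply, Finset.sum_eq_single 0 (fun a _ ha => h a ha) (by simp), map_one] at this
      exact this
    have := congrFun (congrArg W.Φ (D.n_mul_e 0 x)) i
    rw [h3, one_smul, map_mul, Pi.mul_apply, h0, mul_one] at this
    exact this
  · intro h a ha
    have h0 : W.Φ (D.e 0) i = 1 := by
      unfold FD.e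
      simp only [h3, one_smul]
      rw [map_smul, map_sum, Pi.smul_apply, Finset.sum_apply, Finset.sum_congr rfl (fun x _ => h x),
        Finset.sum_const, ← Nat.cast_smul_eq_nsmul ℂ, smul_smul, Finset.card_univ,
        inv_mul_cancel₀ FD.card_ne, one_smul]
    have := congrFun (congrArg W.Φ (D.e_orth 0 a ha.symm)) i
    rwa [map_mul, Pi.mul_apply, h0, one_mul, map_zero] at this

variable (p : ℕ) [hpp : Fact p.Prime]

theorem new_iff (hp : p ≠ 2) (k) (W : Wed (Gk p (k + 1))) (i) :
    i ∉ (sysk p hp k).new W 0 ↔ ∀ g, dnG p k g = 1 → W.Φ (δ g) i = 1 := by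
  have := (fdk p hp k).new_iff (nn_conj p k) (fun g a x => by
    rw [fdk_χ, fdk_χ, Bt_neg, Bt_neg, gk_smul, gk_smul, Bt_smul]) (fun x => by
      rw [fdk_χ]
      have : Bt (0 : Vp p) x = 0 := by simp [Bt]
      rw [this, AddChar.map_zero_eq_one]) W i
  refine Iff.trans this ⟨fun h g hg => ?_, fun h X => h _ (dnG_nn p k X)⟩
  obtain ⟨X, rfl⟩ := dnG_eq_one p k g hg
  exact h X

theorem sum_succ (hp : p ≠ 2) (k) (W : Wed (Gk p (k + 1))) (W' : Wed (Gk p k)) (F : ℕ → ℝ) :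
    ∑ i, F (W.d i) = ∑ i, F (W'.d i) + ∑ i ∈ (sysk p hp k).new W 0, F (W.d i) := by
  classical
  obtain ⟨f, hf, hd, hr⟩ := W.old_equiv W' (dnG p k) (dnG_surj p k)
  have h1 : ∑ i, F (W'.d i) = ∑ i ∈ Finset.univ.map ⟨f, hf⟩, F (W.d i) := by
    rw [Finset.sum_map]
    refine Finset.sum_congr rfl fun j _ => ?_
    rw [← hd j]; rfl
  have h2 : Finset.univ.map ⟨f, hf⟩ = ((sysk p hp k).new W 0)ᶜ := by
    ext i
    rw [Finset.mem_compl, new_iff, ← hr i]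
    simp
  rw [h1, h2]
  exact (Finset.sum_compl_add_sum _ _).symm

theorem zero_fixed (k) (g : Gk p k) : g • (0 : Vp p) = 0 := by
  rw [gk_smul]
  apply vp_ext
  · rw [smul_1]; simp
  · rw [smul_2]; simp
  · rw [smul_3]; simp

theorem osz_gk (k) (A : Vp p) : IdemSys.osz (Gk p k) A = IdemSys.osz SL(2, ZMod p) A := by
  unfold IdemSys.osz
  congr 1
  ext B
  constructor
  · rintro ⟨g, rfl⟩; exact ⟨redG p k g, rfl⟩
  · rintro ⟨g, rfl⟩
    obtain ⟨g', rfl⟩ := redG_surj p k g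
    exact ⟨g', rfl⟩

/-- dimension at least `p^k` for new representations -/
theorem new_dim (hp : p ≠ 2) (k) (W : Wed (Gk p (k + 1))) (i) (hi : i ∈ (sysk p hp k).new W 0) :
    p ^ k ≤ W.d i := by
  classical
  simp only [IdemSys.new, Finset.mem_filter, Finset.mem_univ, true_and] at hi
  obtain ⟨A, hA, hm⟩ := hi
  rw [(sysk p hp k).d_eq W i A hm]
  exact (m_ge p hp k W i A hA hm).trans (Nat.le_mul_of_pos_left _ (IdemSys.osz_pos A))

end SLZeta

/-! ### Part OR: orbits on traceless matrices over `F_p` -/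
namespace SLZeta
variable (p : ℕ) [hpp : Fact p.Prime]

theorem card_mul_eq (n : ZMod p) : (Finset.univ.filter fun x : ZMod p × ZMod p => x.1 * x.2 = n).card =
    if n = 0 then 2 * p - 1 else p - 1 := by
  have h1 : ∀ b : ZMod p, (Finset.univ.filter fun c : ZMod p => b * c = n).card =
      if b = 0 then (if n = 0 then p else 0) else 1 := by
    intro b
    split_ifs with hb hn
    · subst hb; subst hn; simp [ZMod.card]
    · subst hb; simp [Ne.symm hn]
    · rw [Finset.card_eq_one]
      refine ⟨b⁻¹ * n, ?_⟩
      ext c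
      simp only [Finset.mem_filter, Finset.mem_univ, true_and, Finset.mem_singleton]
      rw [eq_inv_mul_iff_mul_eq₀ hb]
  have h2 : (Finset.univ.filter fun x : ZMod p × ZMod p => x.1 * x.2 = n).card =
      ∑ b : ZMod p, (Finset.univ.filter fun c : ZMod p => b * c = n).card := by
    simp_rw [Finset.card_filter]
    rw [← Finset.univ_product_univ, Finset.sum_product]
  rw [h2, Finset.sum_congr rfl (fun b _ => h1 b), Finset.sum_ite, Finset.sum_const, Finset.sum_const,
    Finset.filter_eq', if_pos (Finset.mem_univ _), Finset.card_singleton, Finset.filter_ne',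
    Finset.card_erase_of_mem (Finset.mem_univ _), Finset.card_univ, ZMod.card]
  have := hpp.out.pos
  split_ifs <;> simp <;> omega

theorem card_SL_zmod : Nat.card SL(2, ZMod p) = p * (p ^ 2 - 1) := by
  have e : SL(2, ZMod p) ≃ {x : (ZMod p × ZMod p) × (ZMod p × ZMod p) // x.2.1 * x.2.2 = x.1.1 * x.1.2 - 1} :=
    { toFun := fun g => ⟨((g 0 0, g 1 1), (g 0 1, g 1 0)), by
        have := sl_det g; dsimp only; linear_combination - this⟩
      invFun := fun x => mkSL x.1.1.1 x.1.2.1 x.1.2.2 x.1.1.2 (by linear_combination - x.2)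
      left_inv := fun g => by apply sl_ext <;> rfl
      right_inv := fun x => by rfl }
  have h2 : (Finset.univ.filter fun x : (ZMod p × ZMod p) × (ZMod p × ZMod p) =>
      x.2.1 * x.2.2 = x.1.1 * x.1.2 - 1).card =
      ∑ b : ZMod p × ZMod p, (if b.1 * b.2 = 1 then 2 * p - 1 else p - 1) := by
    simp_rw [Finset.card_filter]
    rw [← Finset.univ_product_univ, Finset.sum_product]
    refine Finset.sum_congr rfl fun b _ => ?_
    dsimp only
    rw [← Finset.card_filter, card_mul_eq]
    simp only [sub_eq_zero]
  rw [Nat.card_congr e, Nat.card_eq_fintype_card, Fintype.card_subtype, h2, Finset.sum_ite,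
    Finset.sum_const, Finset.sum_const, card_mul_eq, if_neg one_ne_zero]
  have h3 := Finset.card_filter_add_card_filter_not (s := (Finset.univ : Finset (ZMod p × ZMod p)))
    (p := fun b => b.1 * b.2 = 1)
  rw [card_mul_eq, if_neg one_ne_zero, Finset.card_univ, Fintype.card_prod, ZMod.card] at h3
  obtain ⟨m, hm⟩ : ∃ m, p = m + 2 := ⟨p - 2, by have := hpp.out.two_le; omega⟩
  have h4 : (Finset.univ.filter fun b : ZMod p × ZMod p => ¬ b.1 * b.2 = 1).card = p * p - (p - 1) := by omega
  rw [h4]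
  simp only [smul_eq_mul]
  have e1 : p - 1 = m + 1 := by omega
  have e2 : 2 * p - 1 = 2 * m + 3 := by omega
  have e3 : p * p - (p - 1) = m ^ 2 + 3 * m + 3 := by
    rw [e1, hm]; have : (m + 2) * (m + 2) = m ^ 2 + 3 * m + 3 + (m + 1) := by ring
    omega
  have e4 : p ^ 2 - 1 = m ^ 2 + 4 * m + 3 := by
    rw [hm]; have : (m + 2) ^ 2 = m ^ 2 + 4 * m + 3 + 1 := by ring
    omega
  rw [e3, e1, e2, e4, hm]
  ring

/-- number of square roots -/
def sq (D : ZMod p) : ℕ := (Finset.univ.filter fun a : ZMod p => a ^ 2 = D).card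

theorem card_Dl (D : ZMod p) : (Finset.univ.filter fun A : Vp p => Dl A = D).card =
    p * (p - 1) + p * sq p D := by
  have h2 : (Finset.univ.filter fun A : Vp p => Dl A = D).card =
      ∑ a : ZMod p, ((p - 1) + if a ^ 2 = D then p else 0) := by
    simp_rw [Finset.card_filter]
    rw [← Finset.univ_product_univ, Finset.sum_product]
    refine Finset.sum_congr rfl fun b _ => ?_
    have := card_mul_eq p (D - b ^ 2)
    rw [Finset.card_filter] at this
    simp only [Dl]
    rw [Finset.sum_congr rfl (g := fun x : ZMod p × ZMod p => if x.1 * x.2 = D - b ^ 2 then 1 else 0), this]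
    · simp only [sub_eq_zero]
      have := hpp.out.pos
      by_cases h : D = b ^ 2
      · rw [if_pos h, if_pos h.symm]; omega
      · rw [if_neg h, if_neg (fun h' => h h'.symm)]; omega
    · intro x _
      refine if_congr ?_ rfl rfl
      constructor
      · intro h; linear_combination h
      · intro h; linear_combination h
  rw [h2, Finset.sum_add_distrib, Finset.sum_const, Finset.card_univ, ZMod.card, ← Finset.sum_filter,
    Finset.sum_const, sq, smul_eq_mul, smul_eq_mul, mul_comm p (Finset.card _)]

theorem sq_zero : sq p 0 = 1 := by
  unfold sq
  rw [Finset.card_eq_one]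
  exact ⟨0, by ext; simp⟩

theorem sq_of_isSquare (hp : p ≠ 2) (D : ZMod p) (h0 : D ≠ 0) (h : IsSquare D) : sq p D = 2 := by
  obtain ⟨a, rfl⟩ := h
  have ha : a ≠ 0 := by rintro rfl; simp at h0
  unfold sq
  rw [Finset.card_eq_two]
  refine ⟨a, -a, ?_, ?_⟩
  · intro h
    have : 2 * a = 0 := by linear_combination h
    exact (mul_ne_zero (two_ne_zero_zmod p hp) ha) this
  · ext b
    simp only [Finset.mem_filter, Finset.mem_univ, true_and, Finset.mem_insert, Finset.mem_singleton]
    rw [← pow_two, sq_eq_sq_iff_eq_or_eq_neg]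

theorem sq_of_not_isSquare (D : ZMod p) (h : ¬ IsSquare D) : sq p D = 0 := by
  unfold sq
  rw [Finset.card_eq_zero]
  ext b
  simp only [Finset.mem_filter, Finset.mem_univ, true_and, Finset.notMem_empty, iff_false]
  rintro rfl
  exact h ⟨b, pow_two b⟩

open Classical in
theorem card_squares (hp : p ≠ 2) :
    2 * (Finset.univ.filter fun D : ZMod p => D ≠ 0 ∧ IsSquare D).card + 1 = p ∧
    2 * (Finset.univ.filter fun D : ZMod p => ¬ IsSquare D).card + 1 = p := by
  have h1 : ∑ D, sq p D = p := by
    unfold sq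
    rw [← Finset.card_eq_sum_card_fiberwise (t := Finset.univ) (s := Finset.univ)
      (f := fun a : ZMod p => a ^ 2) (fun _ _ => Finset.mem_coe.mpr (Finset.mem_univ _)), Finset.card_univ, ZMod.card]
  have h2 : ∑ D, sq p D = 2 * (Finset.univ.filter fun D : ZMod p => D ≠ 0 ∧ IsSquare D).card + 1 := by
    rw [← Finset.add_sum_erase _ _ (Finset.mem_univ 0), sq_zero, add_comm, Finset.card_filter, Finset.mul_sum]
    congr 1
    rw [← Finset.add_sum_erase (Finset.univ : Finset (ZMod p)) _ (Finset.mem_univ 0)]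
    simp only [ne_eq, not_true_eq_false, false_and, if_false, mul_zero, zero_add]
    refine Finset.sum_congr rfl fun D hD => ?_
    have hD0 : D ≠ 0 := Finset.ne_of_mem_erase hD
    by_cases h : IsSquare D
    · rw [sq_of_isSquare p hp D hD0 h, if_pos ⟨hD0, h⟩, mul_one]
    · rw [sq_of_not_isSquare p D h, if_neg (fun h' => h h'.2), mul_zero]
  have h3 : (Finset.univ.filter fun D : ZMod p => D ≠ 0 ∧ IsSquare D).card +
      (Finset.univ.filter fun D : ZMod p => ¬ IsSquare D).card + 1 = p := by
    have := Finset.card_filter_add_card_filter_not (s := (Finset.univ : Finset (ZMod p)))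
      (p := fun b => IsSquare b)
    rw [Finset.card_univ, ZMod.card] at this
    have h4 : (Finset.univ.filter fun D : ZMod p => IsSquare D) =
        insert 0 (Finset.univ.filter fun D : ZMod p => D ≠ 0 ∧ IsSquare D) := by
      ext D
      simp only [Finset.mem_filter, Finset.mem_univ, true_and, Finset.mem_insert]
      by_cases hD : D = 0
      · subst hD; simp
      · simp [hD]
    rw [h4, Finset.card_insert_of_notMem (by simp)] at this
    omega
  omega

theorem exists_nonsquare (hp : p ≠ 2) : ∃ ν : ZMod p, ¬ IsSquare ν := by
  classical
  have := (card_squares p hp).2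
  by_contra! h
  rw [Finset.filter_false_of_mem (by simpa using h)] at this
  simp at this
  exact hpp.out.one_lt.ne this

end SLZeta

namespace SLZeta
variable (p : ℕ) [hpp : Fact p.Prime]

/-- quadratic form attached to a traceless matrix -/
def QA {p : ℕ} (A : Vp p) (x y : ZMod p) : ZMod p := A.2.2 * x ^ 2 - 2 * A.1 * x * y - A.2.1 * y ^ 2

theorem mem_orbit_of_QA (A : Vp p) (x y c : ZMod p) (hc : c ≠ 0) (h : QA A x y = c) :
    A ∈ MulAction.orbit SL(2, ZMod p) ((0, Dl A * c⁻¹, c) : Vp p) := by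
  have hcc : c * c⁻¹ = 1 := mul_inv_cancel₀ hc
  generalize c⁻¹ = d at *
  obtain ⟨a, b, e⟩ := A
  simp only [QA, Dl] at *
  refine ⟨mkSL x (d * (a * x + b * y)) y (d * (e * x - a * y)) (by linear_combination hcc + d * h), ?_⟩
  apply vp_ext
  · dsimp only
    rw [smul_1, mk00, mk01, mk10, mk11]
    dsimp only
    subst h
    linear_combination (d * (a*x+b*y)*(e*x-a*y) + a) * hcc
  · dsimp only
    rw [smul_2, mk00, mk01]
    dsimp only
    subst h
    linear_combination (- d * (a*x+b*y)^2 + b) * hcc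
  · dsimp only
    rw [smul_3, mk10, mk11]
    dsimp only
    subst h
    linear_combination (d * (e*x-a*y)^2 + e) * hcc

theorem exists_QA_one (hp : p ≠ 2) (A : Vp p) (hA : Dl A ≠ 0) : ∃ x y, QA A x y = 1 := by
  have h2 := two_ne_zero_zmod p hp
  obtain ⟨a, b, e⟩ := A
  simp only [QA, Dl] at *
  by_cases he : e = 0
  · subst he
    have ha : a ≠ 0 := by rintro rfl; simp at hA
    refine ⟨-(1 + b) / (2 * a), 1, ?_⟩
    field_simp
    ring
  · -- `e * Q = (e x - a y)^2 - D y^2`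
    obtain ⟨u, y, h⟩ := FiniteField.exists_root_sum_quadratic (R := ZMod p)
      (f := Polynomial.X ^ 2) (g := Polynomial.C (-(a ^ 2 + b * e)) * Polynomial.X ^ 2 - Polynomial.C e)
      (by simp) (by
        rw [sub_eq_add_neg, ← Polynomial.C_neg]
        compute_degree!
        intro h; apply hA; linear_combination -h) (by
        rw [ZMod.card]; exact hpp.out.eq_two_or_odd.resolve_left hp)
    simp at h
    refine ⟨(u + a * y) / e, y, ?_⟩
    field_simp
    linear_combination h

theorem orbit_eq_Dl (hp : p ≠ 2) (A : Vp p) (hA : Dl A ≠ 0) :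
    MulAction.orbit SL(2, ZMod p) A = {B | Dl B = Dl A} := by
  have key : ∀ B : Vp p, Dl B ≠ 0 → B ∈ MulAction.orbit SL(2, ZMod p) ((0, Dl B, 1) : Vp p) := by
    intro B hB
    obtain ⟨x, y, h⟩ := exists_QA_one p hp B hB
    have := mem_orbit_of_QA p B x y 1 one_ne_zero h
    rwa [inv_one, mul_one] at this
  ext B
  constructor
  · rintro ⟨g, rfl⟩; exact Dl_smul g A
  · intro hB
    have hB' : Dl B = Dl A := hB
    have h1 := key A hA
    have h2 := key B (by rwa [hB'])
    rw [hB'] at h2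
    rw [← MulAction.orbit_eq_iff] at h1
    rwa [h1]

theorem osz_of_Dl (hp : p ≠ 2) (A : Vp p) (hA : Dl A ≠ 0) :
    IdemSys.osz SL(2, ZMod p) A = p * (p - 1) + p * sq p (Dl A) := by
  unfold IdemSys.osz
  rw [orbit_eq_Dl p hp A hA, ← card_Dl, ← Set.ncard_coe_finset]
  simp

/-- the nilpotent element `(0,0,c)` -/
def nil {p : ℕ} (c : ZMod p) : Vp p := (0, 0, c)

theorem mem_orbit_nil (A : Vp p) (hA : A ≠ 0) (hD : Dl A = 0) : ∃ c : ZMod p, c ≠ 0 ∧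
    A ∈ MulAction.orbit SL(2, ZMod p) (nil c) := by
  have : ∃ x y, QA A x y ≠ 0 := by
    by_contra! h
    apply hA
    have h1 := h 1 0
    have h2 := h 0 1
    simp [QA] at h1 h2
    simp [Dl, h1, h2] at hD
    exact vp_ext hD h2 h1
  obtain ⟨x, y, h⟩ := this
  refine ⟨_, h, ?_⟩
  have := mem_orbit_of_QA p A x y _ h rfl
  rwa [hD, zero_mul] at this

theorem nil_sq (c t : ZMod p) (ht : t ≠ 0) :
    nil (c * t ^ 2) ∈ MulAction.orbit SL(2, ZMod p) (nil c) := by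
  refine ⟨mkSL t⁻¹ 0 0 t (by field_simp; simp), ?_⟩
  apply vp_ext
  · dsimp only; rw [smul_1, mk00, mk01, mk10, mk11]; simp [nil]
  · dsimp only; rw [smul_2, mk00, mk01]; simp [nil]
  · dsimp only; rw [smul_3, mk10, mk11]; simp [nil]; ring

theorem orbit_nil_sq (c d : ZMod p) (h : nil d ∈ MulAction.orbit SL(2, ZMod p) (nil c)) :
    ∃ w, d = c * w ^ 2 := by
  obtain ⟨g, h⟩ := h
  dsimp only at h
  refine ⟨g 1 1, ?_⟩
  have : (g • (nil c : Vp p)).2.2 = (nil d : Vp p).2.2 := congrArg (fun A : Vp p => A.2.2) h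
  rw [smul_3] at this
  simp [nil] at this
  rw [← this]; ring

theorem isSquare_div_or (hp : p ≠ 2) (ν c : ZMod p) (hν : ¬ IsSquare ν) (hc : c ≠ 0) :
    ∃ t, t ≠ 0 ∧ (c = t ^ 2 ∨ c = ν * t ^ 2) := by
  have hν0 : ν ≠ 0 := by rintro rfl; exact hν ⟨0, by simp⟩
  by_cases h : IsSquare c
  · obtain ⟨t, rfl⟩ := h
    exact ⟨t, by rintro rfl; simp at hc, Or.inl (by ring)⟩
  · have h3 : IsSquare (c * ν⁻¹) := by
      have a1 : quadraticChar (ZMod p) c = -1 := (quadraticChar_neg_one_iff_not_isSquare).mpr h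
      have a2 : quadraticChar (ZMod p) ν = -1 := (quadraticChar_neg_one_iff_not_isSquare).mpr hν
      have a3 : quadraticChar (ZMod p) (c * ν) = 1 := by rw [map_mul, a1, a2]; norm_num
      obtain ⟨t, ht⟩ := (quadraticChar_one_iff_isSquare (mul_ne_zero hc hν0)).mp a3
      refine ⟨t * ν⁻¹, ?_⟩
      field_simp
      linear_combination ht
    obtain ⟨t, ht⟩ := h3
    have : c = ν * t ^ 2 := by rw [pow_two, ← ht]; field_simp
    refine ⟨t, ?_, Or.inr this⟩
    rintro rfl; simp at this; exact hc this

theorem osz_nil_scale (c ν : ZMod p) (hν : ν ≠ 0) :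
    IdemSys.osz SL(2, ZMod p) (nil (c * ν)) = IdemSys.osz SL(2, ZMod p) (nil c) := by
  unfold IdemSys.osz
  have hs : ∀ (g : SL(2, ZMod p)) (A : Vp p), g • (ν • A) = ν • (g • A) := by
    intro g A
    apply vp_ext
    · rw [smul_1]; simp only [Prod.smul_fst, Prod.smul_snd, smul_eq_mul]; rw [smul_1]; ring
    · rw [smul_2]; simp only [Prod.smul_fst, Prod.smul_snd, smul_eq_mul]; rw [smul_2]; ring
    · rw [smul_3]; simp only [Prod.smul_fst, Prod.smul_snd, smul_eq_mul]; rw [smul_3]; ring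
  have h1 : nil (c * ν) = ν • (nil c : Vp p) := by
    apply vp_ext <;> simp [nil, mul_comm]
  rw [h1]
  have : MulAction.orbit SL(2, ZMod p) (ν • (nil c : Vp p)) =
      (fun A : Vp p => ν • A) '' MulAction.orbit SL(2, ZMod p) (nil c) := by
    ext B
    constructor
    · rintro ⟨g, rfl⟩; exact ⟨g • nil c, ⟨g, rfl⟩, (hs g _).symm⟩
    · rintro ⟨_, ⟨g, rfl⟩, rfl⟩; exact ⟨g, hs g _⟩
  rw [this]
  apply Set.ncard_image_of_injective
  intro A B h
  exact smul_right_injective _ hν h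

theorem osz_nil (hp : p ≠ 2) (A : Vp p) (hA : A ≠ 0) (hD : Dl A = 0) :
    2 * IdemSys.osz SL(2, ZMod p) A = p ^ 2 - 1 := by
  classical
  obtain ⟨ν, hν⟩ := exists_nonsquare p hp
  have hν0 : ν ≠ 0 := by rintro rfl; exact hν ⟨0, by simp⟩
  have h1 : ∀ B : Vp p, B ≠ 0 → Dl B = 0 → B ∈ MulAction.orbit SL(2, ZMod p) (nil 1) ∨
      B ∈ MulAction.orbit SL(2, ZMod p) (nil ν) := by
    intro B hB hD
    obtain ⟨c, hc, hBc⟩ := mem_orbit_nil p B hB hD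
    obtain ⟨t, ht, h | h⟩ := isSquare_div_or p hp ν c hν hc
    · left
      have := nil_sq p 1 t ht
      rw [one_mul, ← h, ← MulAction.orbit_eq_iff] at this
      rwa [← this]
    · right
      have := nil_sq p ν t ht
      rw [← h, ← MulAction.orbit_eq_iff] at this
      rwa [← this]
  have h2 : IdemSys.osz SL(2, ZMod p) (nil ν) = IdemSys.osz SL(2, ZMod p) (nil (1 : ZMod p)) := by
    have := osz_nil_scale p 1 ν hν0
    rwa [one_mul] at this
  have h3 : IdemSys.osz SL(2, ZMod p) A = IdemSys.osz SL(2, ZMod p) (nil (1 : ZMod p)) := by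
    rcases h1 A hA hD with h | h
    · unfold IdemSys.osz; rw [MulAction.orbit_eq_iff.mpr h]
    · rw [← h2]; unfold IdemSys.osz; rw [MulAction.orbit_eq_iff.mpr h]
  have hn0 : ∀ c : ZMod p, c ≠ 0 → ∀ B ∈ MulAction.orbit SL(2, ZMod p) (nil c), B ≠ 0 := by
    rintro c hc B ⟨g, rfl⟩ h
    have h' : g • (nil c : Vp p) = 0 := h
    have h4 : (nil c : Vp p) = 0 := by
      have e : (nil c : Vp p) = g⁻¹ • (0 : Vp p) := by rw [← h', inv_smul_smul]
      rw [e]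
      apply vp_ext
      · rw [smul_1]; simp
      · rw [smul_2]; simp
      · rw [smul_3]; simp
    have := congrArg (fun A : Vp p => A.2.2) h4
    exact hc this
  have h4 : (MulAction.orbit SL(2, ZMod p) (nil (1 : ZMod p))) ∪ (MulAction.orbit SL(2, ZMod p) (nil ν)) =
      ((((Finset.univ.filter fun A : Vp p => Dl A = 0).erase 0 : Finset (Vp p))) : Set (Vp p)) := by
    ext B
    simp only [Set.mem_union, Finset.coe_erase, Finset.coe_filter, Finset.mem_univ, true_and,
      Set.mem_diff, Set.mem_setOf_eq, Set.mem_singleton_iff]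
    constructor
    · rintro (h | h)
      · refine ⟨?_, hn0 1 one_ne_zero B h⟩
        obtain ⟨g, rfl⟩ := h
        rw [Dl_smul]; simp [Dl, nil]
      · refine ⟨?_, hn0 ν hν0 B h⟩
        obtain ⟨g, rfl⟩ := h
        rw [Dl_smul]; simp [Dl, nil]
    · rintro ⟨hD, h0⟩; exact h1 B h0 hD
  have h5 : Disjoint (MulAction.orbit SL(2, ZMod p) (nil (1 : ZMod p))) (MulAction.orbit SL(2, ZMod p) (nil ν)) := by
    rw [Set.disjoint_left]
    intro B hB1 hB2
    rw [← MulAction.orbit_eq_iff] at hB1 hB2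
    have : nil ν ∈ MulAction.orbit SL(2, ZMod p) (nil (1 : ZMod p)) := by
      rw [← hB1, hB2]; exact MulAction.mem_orbit_self _
    obtain ⟨w, hw⟩ := orbit_nil_sq p _ _ this
    exact hν ⟨w, by rw [hw]; ring⟩
  have h6 := Set.ncard_union_eq h5 (Set.toFinite _) (Set.toFinite _)
  rw [h4, Set.ncard_coe_finset, Finset.card_erase_of_mem (by rw [Finset.mem_filter]; simp [Dl]), card_Dl, sq_zero] at h6
  rw [h3]
  unfold IdemSys.osz at h2 ⊢
  rw [h2] at h6
  obtain ⟨m, hm⟩ : ∃ m, p = m + 1 := ⟨p - 1, by have := hpp.out.pos; omega⟩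
  have : p * (p - 1) + p * 1 = p ^ 2 := by rw [hm]; simp; ring
  omega

open Classical in
theorem sum_osz (hp : p ≠ 2) (f : ℕ → ℝ) :
    ∑ A ∈ Finset.univ.filter (fun A : Vp p => A ≠ 0), f (IdemSys.osz SL(2, ZMod p) A) =
      ((p:ℝ) ^ 2 - 1) * f ((p ^ 2 - 1) / 2) + ((p:ℝ) - 1) / 2 * (p * (p + 1)) * f (p * (p + 1))
      + ((p:ℝ) - 1) / 2 * (p * (p - 1)) * f (p * (p - 1)) := by
  have hp1 := hpp.out.one_lt
  have hc : ((p - 1 : ℕ) : ℝ) = (p : ℝ) - 1 := by rw [Nat.cast_sub hp1.le]; simp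
  have h1 : ∑ A ∈ Finset.univ.filter (fun A : Vp p => A ≠ 0), f (IdemSys.osz SL(2, ZMod p) A) =
      ∑ D : ZMod p, ∑ A ∈ (Finset.univ.filter (fun A : Vp p => A ≠ 0)).filter (fun A => Dl A = D),
        f (IdemSys.osz SL(2, ZMod p) A) :=
    (Finset.sum_fiberwise _ _ _).symm
  have h0 : ∑ A ∈ (Finset.univ.filter (fun A : Vp p => A ≠ 0)).filter (fun A => Dl A = 0),
        f (IdemSys.osz SL(2, ZMod p) A) = ((p:ℝ) ^ 2 - 1) * f ((p ^ 2 - 1) / 2) := by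
    rw [Finset.sum_congr rfl (g := fun _ => f ((p ^ 2 - 1) / 2)), Finset.sum_const]
    · have : (Finset.univ.filter (fun A : Vp p => A ≠ 0)).filter (fun A => Dl A = 0) =
          (Finset.univ.filter fun A : Vp p => Dl A = 0).erase 0 := by
        ext A; simp
      rw [this, Finset.card_erase_of_mem (by rw [Finset.mem_filter]; simp [Dl]), card_Dl, sq_zero, nsmul_eq_mul,
        Nat.cast_sub (by nlinarith)]
      push_cast [hc]
      ring
    · intro A hA
      simp only [Finset.mem_filter, Finset.mem_univ, true_and] at hA
      have := osz_nil p hp A hA.1 hA.2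
      congr 1; omega
  have hD : ∀ D : ZMod p, D ≠ 0 → ∑ A ∈ (Finset.univ.filter (fun A : Vp p => A ≠ 0)).filter (fun A => Dl A = D),
        f (IdemSys.osz SL(2, ZMod p) A) = ((p * (p - 1) + p * sq p D : ℕ) : ℝ) * f (p * (p - 1) + p * sq p D) := by
    intro D hD
    rw [Finset.sum_congr rfl (g := fun _ => f (p * (p - 1) + p * sq p D)), Finset.sum_const]
    · have : (Finset.univ.filter (fun A : Vp p => A ≠ 0)).filter (fun A => Dl A = D) =
          (Finset.univ.filter fun A : Vp p => Dl A = D) := by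
        ext A
        simp only [Finset.mem_filter, Finset.mem_univ, true_and, and_iff_right_iff_imp]
        rintro rfl rfl; simp [Dl] at hD
      rw [this, card_Dl, nsmul_eq_mul]
    · intro A hA
      simp only [Finset.mem_filter, Finset.mem_univ, true_and] at hA
      rw [osz_of_Dl p hp A (by rw [hA.2]; exact hD), hA.2]
  obtain ⟨c1, c2⟩ := card_squares p hp
  have c1' : ((Finset.univ.filter fun D : ZMod p => D ≠ 0 ∧ IsSquare D).card : ℝ) = ((p:ℝ) - 1) / 2 := by
    have := congrArg (Nat.cast (R := ℝ)) c1
    push_cast at this; linarith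
  have c2' : ((Finset.univ.filter fun D : ZMod p => ¬ IsSquare D).card : ℝ) = ((p:ℝ) - 1) / 2 := by
    have := congrArg (Nat.cast (R := ℝ)) c2
    push_cast at this; linarith
  have e1 : p * (p - 1) + p * 2 = p * (p + 1) := by
    obtain ⟨m, hm⟩ : ∃ m, p = m + 1 := ⟨p - 1, by omega⟩
    rw [hm]; simp; ring
  rw [h1, ← Finset.add_sum_erase _ _ (Finset.mem_univ 0), h0,
    Finset.sum_congr rfl (fun D hD' => hD D (Finset.ne_of_mem_erase hD')),
    ← Finset.sum_filter_add_sum_filter_not _ (fun D => IsSquare D), add_assoc]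
  congr 1
  congr 1
  · rw [Finset.sum_congr (s₂ := Finset.univ.filter fun D : ZMod p => D ≠ 0 ∧ IsSquare D)
      (g := fun _ => ((p * (p + 1) : ℕ) : ℝ) * f (p * (p + 1))) _ _, Finset.sum_const, nsmul_eq_mul, c1']
    · push_cast; ring
    · ext D; simp
    · intro D hD
      simp only [Finset.mem_filter, Finset.mem_univ, true_and] at hD
      rw [sq_of_isSquare p hp D hD.1 hD.2, e1]
  · rw [Finset.sum_congr (s₂ := Finset.univ.filter fun D : ZMod p => ¬ IsSquare D)
      (g := fun _ => ((p * (p - 1) : ℕ) : ℝ) * f (p * (p - 1))) _ _, Finset.sum_const, nsmul_eq_mul, c2']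
    · push_cast [hc]; ring
    · ext D
      simp only [Finset.mem_filter, Finset.mem_erase, Finset.mem_univ, and_true, true_and, and_iff_right_iff_imp]
      rintro h rfl; exact h ⟨0, by simp⟩
    · intro D hD
      simp only [Finset.mem_filter, Finset.mem_univ, true_and] at hD
      rw [sq_of_not_isSquare p D hD, mul_zero, add_zero]

theorem redG_bij : Function.Bijective (redG p 0) := by
  refine ⟨?_, redG_surj p 0⟩
  have hb : Function.Injective (red p 0) := by
    refine ((red_surj p 0).bijective_of_nat_card_le ?_).1
    rw [Nat.card_zmod, Nat.card_zmod]; simp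
  intro g h hgh
  apply sl_ext <;> apply hb <;> rw [← redG_ij, ← redG_ij, hgh]

/-- order of `SL₂(ℤ/p^(k+1))` -/
theorem card_Gk (k : ℕ) : (Fintype.card (Gk p k) : ℝ) = (p:ℝ) ^ (3 * k) * (p * ((p:ℝ) ^ 2 - 1)) := by
  induction k with
  | zero =>
    rw [← Nat.card_eq_fintype_card, Nat.card_congr (Equiv.ofBijective _ (redG_bij p)), card_SL_zmod, Nat.cast_mul,
      Nat.cast_sub (Nat.one_le_pow _ _ hpp.out.pos)]
    simp
  | succ k ih =>
    rw [card_G_succ, Nat.cast_mul, ih]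
    push_cast
    ring

end SLZeta

namespace SLZeta
variable (p : ℕ) [hpp : Fact p.Prime]

theorem sum_new_val (hp : p ≠ 2) (k : ℕ) (F : ℕ → ℝ) (s : Finset (Vp p)) (hs : ∀ a, a ∈ s ↔ a ≠ 0) :
    ∑ a ∈ s, (Fintype.card (Gk p k) : ℝ) / (((p ^ k : ℕ) : ℝ) ^ 2 *
      (IdemSys.osz (Gk p (k + 1)) a : ℝ) ^ 2) * F (IdemSys.osz (Gk p (k + 1)) a * p ^ k) =
    4 * p * (p:ℝ) ^ k * F ((p ^ 2 - 1) / 2 * p ^ k) + ((p:ℝ) - 1) ^ 2 / 2 * (p:ℝ) ^ k * F (p * (p + 1) * p ^ k)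
      + ((p:ℝ) ^ 2 - 1) / 2 * (p:ℝ) ^ k * F (p * (p - 1) * p ^ k) := by
  classical
  have hs' : s = Finset.univ.filter (fun A : Vp p => A ≠ 0) := by ext a; simp [hs]
  have hp1 := hpp.out.one_lt
  have hc : ((p - 1 : ℕ) : ℝ) = (p : ℝ) - 1 := by rw [Nat.cast_sub hp1.le]; simp
  have hc2 : (((p ^ 2 - 1) / 2 : ℕ) : ℝ) = ((p : ℝ) ^ 2 - 1) / 2 := by
    have h1 : 2 ∣ p ^ 2 - 1 := by
      have hodd : p % 2 = 1 := hpp.out.eq_two_or_odd.resolve_left hp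
      have : p ^ 2 % 2 = 1 := by rw [Nat.pow_mod, hodd]
      have : 0 < p ^ 2 := by positivity
      omega
    rw [Nat.cast_div h1 (by norm_num), Nat.cast_sub (Nat.one_le_pow _ _ hpp.out.pos)]
    simp
  have hq : (1 : ℝ) < p := by exact_mod_cast hp1
  simp_rw [osz_gk p (k + 1)]
  have key := sum_osz p hp (fun o => (Fintype.card (Gk p k) : ℝ) / (((p ^ k : ℕ) : ℝ) ^ 2 *
      (o : ℝ) ^ 2) * F (o * p ^ k))
  have key' := Eq.trans (Finset.sum_congr (s₁ := s) (by ext; simp [hs]) (fun _ _ => rfl)) key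
  refine key'.trans ?_
  rw [hc2, card_Gk]
  push_cast
  rw [hc]
  have a1 : (p:ℝ) - 1 ≠ 0 := by linarith
  have a2 : (p:ℝ) + 1 ≠ 0 := by linarith
  have a3 : (p:ℝ) ≠ 0 := by linarith
  have a4 : (p:ℝ) ^ 2 - 1 ≠ 0 := by
    have : (p:ℝ) ^ 2 - 1 = (p - 1) * (p + 1) := by ring
    rw [this]; exact mul_ne_zero a1 a2
  have a5 : (p:ℝ) ^ k ≠ 0 := pow_ne_zero _ a3
  have e3 : (p:ℝ) ^ (3 * k) = (p ^ k) ^ 3 := by rw [← pow_mul]; ring_nf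
  rw [e3]
  congr 1
  congr 1
  · rw [← mul_assoc]; congr 1; field_simp; ring
  · rw [← mul_assoc]; congr 1; field_simp; ring
  · rw [← mul_assoc]; congr 1; field_simp

theorem new_bound (hp : p ≠ 2) (k : ℕ) (W : Wed (Gk p (k + 1))) :
    (((sysk p hp k).new W 0).card : ℝ) ≤ (p:ℝ) ^ k * (p ^ 2 + 3 * p) ∧
    ((((sysk p hp k).new W 0).card : ℝ) = (p:ℝ) ^ k * (p ^ 2 + 3 * p) →
      ∀ F : ℕ → ℝ, ∑ i ∈ (sysk p hp k).new W 0, F (W.d i) =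
        4 * p * (p:ℝ) ^ k * F ((p ^ 2 - 1) / 2 * p ^ k) + ((p:ℝ) - 1) ^ 2 / 2 * (p:ℝ) ^ k * F (p * (p + 1) * p ^ k)
      + ((p:ℝ) ^ 2 - 1) / 2 * (p:ℝ) ^ k * F (p * (p - 1) * p ^ k)) := by
  classical
  obtain ⟨s, hs', h⟩ : ∃ s : Finset (Vp p), (∀ a, a ∈ s ↔ a ≠ 0) ∧
      ((((sysk p hp k).new W 0).card : ℝ) ≤ ∑ a ∈ s, (Fintype.card (Gk p k) : ℝ) / (((p ^ k : ℕ) : ℝ) ^ 2 *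
        (IdemSys.osz (Gk p (k + 1)) a : ℝ) ^ 2) ∧
      ((((sysk p hp k).new W 0).card : ℝ) = ∑ a ∈ s, (Fintype.card (Gk p k) : ℝ) / (((p ^ k : ℕ) : ℝ) ^ 2 *
        (IdemSys.osz (Gk p (k + 1)) a : ℝ) ^ 2) →
        ∀ F : ℕ → ℝ, ∑ i ∈ (sysk p hp k).new W 0, F (W.d i) =
        ∑ a ∈ s, (Fintype.card (Gk p k) : ℝ) / (((p ^ k : ℕ) : ℝ) ^ 2 *
        (IdemSys.osz (Gk p (k + 1)) a : ℝ) ^ 2) * F (IdemSys.osz (Gk p (k + 1)) a * p ^ k))) := by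
    refine ⟨_, ?_,
      (sysk p hp k).new_le W 0 (zero_fixed p _) (Fintype.card (Gk p k)) (p ^ k)
    (pow_pos hpp.out.pos k) (fun A hA => sum_m_d_eq p hp k W A) (fun A hA i hm => m_ge p hp k W i A hA hm)⟩
    intro a; simp
  have h1 := sum_new_val p hp k (fun _ => 1) s hs'
  simp only [mul_one] at h1
  rw [h1] at h
  have e : 4 * p * (p:ℝ) ^ k + ((p:ℝ) - 1) ^ 2 / 2 * (p:ℝ) ^ k + ((p:ℝ) ^ 2 - 1) / 2 * (p:ℝ) ^ k =
    (p:ℝ) ^ k * (p ^ 2 + 3 * p) := by ring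
  rw [e] at h
  refine ⟨h.1, fun heq F => ?_⟩
  rw [h.2 heq F]
  exact sum_new_val p hp k F s hs'

end SLZeta

/-! ### Part E: many conjugacy classes in `SL₂(ℤ/p^K)` -/
namespace SLZeta
variable (p : ℕ) [hpp : Fact p.Prime]

theorem sgn_sq (e : ℤ) (he : e = 1 ∨ e = -1) : e * e = 1 := by rcases he with rfl | rfl <;> norm_num

/-- the representative `e * [[1, p^j b], [p^j c, 1 + p^(2j) b c]]` -/
def rep (n : ℕ) (e : ℤ) (he : e = 1 ∨ e = -1) (P b c : ℤ) : SL(2, ZMod n) :=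
  mkSL ((e : ℤ) : ZMod n) ((e * (P * b) : ℤ) : ZMod n) ((e * (P * c) : ℤ) : ZMod n)
    ((e * (1 + P * P * b * c) : ℤ) : ZMod n) (by
      have := sgn_sq e he
      norm_cast
      rw [show e * (e * (1 + P * P * b * c)) - e * (P * b) * (e * (P * c)) = e * e by ring, this, Int.cast_one])

theorem rep_conj (n : ℕ) [NeZero n] {e e' : ℤ} {he he'} {P P' b b' c c' : ℤ}
    (h : IsConj (rep n e he P b c) (rep n e' he' P' b' c')) :
    ∃ x y z w : ℤ, (n : ℤ) ∣ x * w - y * z - 1 ∧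
      (n : ℤ) ∣ e * (x + y * (P * c)) - e' * (x + P' * b' * z) ∧
      (n : ℤ) ∣ e * (x * (P * b) + y * (1 + P * P * b * c)) - e' * (y + P' * b' * w) ∧
      (n : ℤ) ∣ e * (z + w * (P * c)) - e' * (P' * c' * x + (1 + P' * P' * b' * c') * z) ∧
      (n : ℤ) ∣ e * (z * (P * b) + w * (1 + P * P * b * c)) - e' * (P' * c' * y + (1 + P' * P' * b' * c') * w) := by
  rw [isConj_iff] at h
  obtain ⟨g, hg⟩ := h
  rw [mul_inv_eq_iff_eq_mul] at hg
  have hd := sl_det g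
  have h00 := congrArg (fun g : SL(2, ZMod n) => g 0 0) hg
  have h01 := congrArg (fun g : SL(2, ZMod n) => g 0 1) hg
  have h10 := congrArg (fun g : SL(2, ZMod n) => g 1 0) hg
  have h11 := congrArg (fun g : SL(2, ZMod n) => g 1 1) hg
  simp only [mul00, mul01, mul10, mul11, rep, mk00, mk01, mk10, mk11] at h00 h01 h10 h11
  obtain ⟨x, hx⟩ := ZMod.intCast_surjective (g 0 0)
  obtain ⟨y, hy⟩ := ZMod.intCast_surjective (g 0 1)
  obtain ⟨z, hz⟩ := ZMod.intCast_surjective (g 1 0)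
  obtain ⟨w, hw⟩ := ZMod.intCast_surjective (g 1 1)
  rw [← hx, ← hy, ← hz, ← hw] at hd
  rw [← hx, ← hy, ← hz] at h00
  rw [← hx, ← hy, ← hw] at h01
  rw [← hx, ← hz, ← hw] at h10
  rw [← hy, ← hz, ← hw] at h11
  have cv : ∀ u : ℤ, (u : ZMod n) = 0 → (n : ℤ) ∣ u := fun u hu => (ZMod.intCast_zmod_eq_zero_iff_dvd u n).mp hu
  refine ⟨x, y, z, w, cv _ ?_, cv _ ?_, cv _ ?_, cv _ ?_, cv _ ?_⟩
  · push_cast; linear_combination hd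
  · push_cast at *; linear_combination h00
  · push_cast at *; linear_combination h01
  · push_cast at *; linear_combination h10
  · push_cast at *; linear_combination h11

/-- levels agree -/
theorem level_le {K j j' : ℕ} {e e' : ℤ} (he : e = 1 ∨ e = -1) {b b' c c' : ℤ} (hb : ¬ (p : ℤ) ∣ b)
    (hj : j < K) (hj' : j < j')
    (h : ∃ x y z w : ℤ, ((p ^ K : ℕ) : ℤ) ∣ x * w - y * z - 1 ∧
      ((p ^ K : ℕ) : ℤ) ∣ e * (x + y * (p ^ j * c)) - e' * (x + p ^ j' * b' * z) ∧
      ((p ^ K : ℕ) : ℤ) ∣ e * (x * (p ^ j * b) + y * (1 + p ^ j * p ^ j * b * c)) - e' * (y + p ^ j' * b' * w) ∧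
      ((p ^ K : ℕ) : ℤ) ∣ e * (z + w * (p ^ j * c)) - e' * (p ^ j' * c' * x + (1 + p ^ j' * p ^ j' * b' * c') * z) ∧
      ((p ^ K : ℕ) : ℤ) ∣ e * (z * (p ^ j * b) + w * (1 + p ^ j * p ^ j * b * c)) - e' * (p ^ j' * c' * y + (1 + p ^ j' * p ^ j' * b' * c') * w)) :
    False := by
  obtain ⟨x, y, z, w, hd, h1, h2, h3, h4⟩ := h
  have hq : ((p:ℤ) ^ (j + 1)) ∣ ((p ^ K : ℕ) : ℤ) := by push_cast; exact pow_dvd_pow _ hj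
  have hq' : ((p:ℤ) ^ (j + 1)) ∣ (p:ℤ) ^ j' := pow_dvd_pow _ hj'
  replace hd := hq.trans hd
  replace h1 := hq.trans h1
  replace h2 := hq.trans h2
  replace h3 := hq.trans h3
  replace h4 := hq.trans h4
  obtain ⟨u, hu⟩ := hq'
  rw [hu] at h1 h2 h3 h4
  obtain ⟨d, hd⟩ := hd
  obtain ⟨r1, h1⟩ := h1
  obtain ⟨r2, h2⟩ := h2
  obtain ⟨r3, h3⟩ := h3
  obtain ⟨r4, h4⟩ := h4
  have key : (p:ℤ) ^ (j + 1) ∣ e * (p ^ j * b) := by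
    generalize (p:ℤ) ^ (j + 1) = q at *
    generalize (p:ℤ) ^ j = P at *
    -- `h⁻¹ (h g - e' h)`, entry `01`
    refine ⟨w * (r2 + e' * u * b' * w) - y * (r4 + e' * (u * c' * y + u * q * u * b' * c' * w)) - e * P * b * d, ?_⟩
    linear_combination w * h2 - y * h4 - e * P * b * hd
  have h5 : (p:ℤ) ^ (j + 1) ∣ p ^ j * b := by
    have := key.mul_left e
    rwa [← mul_assoc, sgn_sq e he, one_mul] at this
  rw [pow_succ] at h5
  have hp0 : (p:ℤ) ^ j ≠ 0 := pow_ne_zero _ (by exact_mod_cast hpp.out.ne_zero)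
  exact hb (Int.dvd_of_mul_dvd_mul_left hp0 h5)

theorem sign_eq (hp : p ≠ 2) {K j : ℕ} (hK : 0 < K) {e e' : ℤ} (he : e = 1 ∨ e = -1) (he' : e' = 1 ∨ e' = -1)
    {b b' c c' : ℤ}
    (hj0 : j = 0 → e = 1 → ¬ (p:ℤ) ∣ b * c + 4) (hj0' : j = 0 → e' = -1 → (p:ℤ) ∣ c')
    (h : ∃ x y z w : ℤ, ((p ^ K : ℕ) : ℤ) ∣ x * w - y * z - 1 ∧
      ((p ^ K : ℕ) : ℤ) ∣ e * (x + y * (p ^ j * c)) - e' * (x + p ^ j * b' * z) ∧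
      ((p ^ K : ℕ) : ℤ) ∣ e * (x * (p ^ j * b) + y * (1 + p ^ j * p ^ j * b * c)) - e' * (y + p ^ j * b' * w) ∧
      ((p ^ K : ℕ) : ℤ) ∣ e * (z + w * (p ^ j * c)) - e' * (p ^ j * c' * x + (1 + p ^ j * p ^ j * b' * c') * z) ∧
      ((p ^ K : ℕ) : ℤ) ∣ e * (z * (p ^ j * b) + w * (1 + p ^ j * p ^ j * b * c)) - e' * (p ^ j * c' * y + (1 + p ^ j * p ^ j * b' * c') * w)) :
    ¬ (e = 1 ∧ e' = -1) := by
  rintro ⟨rfl, rfl⟩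
  obtain ⟨x, y, z, w, hd, h1, h2, h3, h4⟩ := h
  have hq : (p:ℤ) ∣ ((p ^ K : ℕ) : ℤ) := by push_cast; exact dvd_pow_self _ hK.ne'
  replace hd := hq.trans hd
  replace h1 := hq.trans h1
  replace h2 := hq.trans h2
  replace h3 := hq.trans h3
  replace h4 := hq.trans h4
  obtain ⟨d, hd⟩ := hd
  obtain ⟨r1, h1⟩ := h1
  obtain ⟨r2, h2⟩ := h2
  obtain ⟨r3, h3⟩ := h3
  obtain ⟨r4, h4⟩ := h4
  by_cases hj : j = 0
  · subst hj
    obtain ⟨v, hv⟩ := hj0' rfl rfl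
    apply hj0 rfl rfl
    simp only [pow_zero, one_mul, mul_one] at *
    subst hv
    refine ⟨(w*r1 - z*r2 - y * r3 + x * r4) - (4 + b * c + b' * p * v) * d - b' * v, ?_⟩
    linear_combination w * h1 - z * h2 - y * h3 + x * h4 - (4 + b * c + b' * p * v) * hd
  · have : (p:ℤ) ∣ p ^ j := dvd_pow_self _ hj
    obtain ⟨u, hu⟩ := this
    rw [hu] at h1 h2 h3 h4
    have h5 : (p:ℤ) ∣ 2 := by
      generalize (p:ℤ) = q at *
      refine ⟨w * (r1 - y * u * c - u * b' * z) - y * (r3 - w * u * c - u * c' * x - u * q * u * b' * c' * z) - 2 * d, ?_⟩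
      linear_combination w * h1 - y * h3 - 2 * hd
    have h6 : p ∣ 2 := by exact_mod_cast h5
    exact hp ((Nat.prime_dvd_prime_iff_eq hpp.out Nat.prime_two).mp h6)

theorem det_eq {K j : ℕ} (hj : j ≤ K) {e : ℤ} (he : e = 1 ∨ e = -1) {b b' c c' : ℤ}
    (h : ∃ x y z w : ℤ, ((p ^ K : ℕ) : ℤ) ∣ x * w - y * z - 1 ∧
      ((p ^ K : ℕ) : ℤ) ∣ e * (x + y * (p ^ j * c)) - e * (x + p ^ j * b' * z) ∧
      ((p ^ K : ℕ) : ℤ) ∣ e * (x * (p ^ j * b) + y * (1 + p ^ j * p ^ j * b * c)) - e * (y + p ^ j * b' * w) ∧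
      ((p ^ K : ℕ) : ℤ) ∣ e * (z + w * (p ^ j * c)) - e * (p ^ j * c' * x + (1 + p ^ j * p ^ j * b' * c') * z) ∧
      ((p ^ K : ℕ) : ℤ) ∣ e * (z * (p ^ j * b) + w * (1 + p ^ j * p ^ j * b * c)) - e * (p ^ j * c' * y + (1 + p ^ j * p ^ j * b' * c') * w)) :
    (p:ℤ) ^ (K - j) ∣ b * c - b' * c' ∧ (j < K → ¬ (p:ℤ) ∣ b' → (p:ℤ) ∣ c → ∃ x : ℤ, (p:ℤ) ∣ x ^ 2 * b - b') := by
  obtain ⟨x, y, z, w, hd, h1, h2, h3, h4⟩ := h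
  have hq : ((p ^ K : ℕ) : ℤ) = (p:ℤ) ^ j * p ^ (K - j) := by push_cast; rw [← pow_add]; congr 1; omega
  have hp0 : (p:ℤ) ^ j ≠ 0 := pow_ne_zero _ (by exact_mod_cast hpp.out.ne_zero)
  have cv : ∀ u v : ℤ, ((p ^ K : ℕ) : ℤ) ∣ u → u = e * (p ^ j * v) → (p:ℤ) ^ (K - j) ∣ v := by
    intro u v hu huv
    have : ((p ^ K : ℕ) : ℤ) ∣ p ^ j * v := by
      have := hu.mul_left e
      rwa [huv, ← mul_assoc, sgn_sq e he, one_mul] at this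
    rw [hq] at this
    exact Int.dvd_of_mul_dvd_mul_left hp0 this
  have hd' : (p:ℤ) ^ (K - j) ∣ x * w - y * z - 1 := (Dvd.intro_left _ hq.symm).trans hd
  have g1 := cv _ (y * c - b' * z) h1 (by ring)
  have g2 := cv _ (x * b + y * p ^ j * b * c - b' * w) h2 (by ring)
  have g3 := cv _ (w * c - c' * x - p ^ j * b' * c' * z) h3 (by ring)
  have g4 := cv _ (z * b + w * p ^ j * b * c - c' * y - p ^ j * b' * c' * w) h4 (by ring)
  clear h1 h2 h3 h4 hd cv
  constructor
  · obtain ⟨d, hd⟩ := hd'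
    obtain ⟨r1, h1⟩ := g1
    obtain ⟨r2, h2⟩ := g2
    obtain ⟨r3, h3⟩ := g3
    obtain ⟨r4, h4⟩ := g4
    generalize (p:ℤ) ^ (K - j) = q at *
    generalize (p:ℤ) ^ j = P at *
    refine ⟨- d * (b * c - b' * c') - r1 * (z * b + w * P * b * c) - b' * z * r4
      + r2 * (w * c) + b' * w * r3, ?_⟩
    linear_combination - (b * c - b' * c') * hd - (z * b + w * P * b * c) * h1 - b' * z * h4 + w * c * h2
      + b' * w * h3
  · intro hjK hb' hc
    have hpq : (p:ℤ) ∣ p ^ (K - j) := dvd_pow_self _ (by omega)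
    obtain ⟨v, rfl⟩ := hc
    obtain ⟨d, hd⟩ := hpq.trans hd'
    obtain ⟨r1, h1⟩ := hpq.trans g1
    obtain ⟨r2, h2⟩ := hpq.trans g2
    have hz : (p:ℤ) ∣ b' * z := ⟨y * v - r1, by linear_combination - h1⟩
    have hz' : (p:ℤ) ∣ z := (Int.Prime.dvd_mul' hpp.out hz).resolve_left hb'
    obtain ⟨s, rfl⟩ := hz'
    refine ⟨x, x * r2 - x * y * p ^ j * b * v + b' * d + b' * y * s, ?_⟩
    linear_combination x * h2 + b' * hd

end SLZeta

namespace SLZeta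
variable (p : ℕ) [hpp : Fact p.Prime]

/-- sign of a boolean -/
def sg (e : Bool) : ℤ := if e then 1 else -1
theorem sg_or (e : Bool) : sg e = 1 ∨ sg e = -1 := by cases e <;> simp [sg]

/-- admissible parameters -/
def Adm (K j : ℕ) (x : Bool × Bool × ℕ) : Prop :=
  (x.2.1 = true → p ∣ x.2.2 ∧ j < K) ∧ (j = 0 → x.1 = true → ¬ p ∣ x.2.2 + 4) ∧ (j = 0 → x.1 = false → p ∣ x.2.2)

open Classical in
/-- parameters at level `j` -/
noncomputable def TT (K j : ℕ) : Finset (Bool × Bool × ℕ) :=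
  (Finset.univ ×ˢ Finset.univ ×ˢ Finset.range (p ^ (K - j))).filter (Adm p K j)

theorem count_dvd (n c : ℕ) : ((Finset.range (p * n)).filter fun x => p ∣ x + c).card = n := by
  have h := Nat.count_modEq_card (p * n) (r := p) hpp.out.pos ((p - 1) * c)
  rw [Nat.count_eq_card_filter_range] at h
  have h0 : p * n / p = n := Nat.mul_div_cancel_left n hpp.out.pos
  rw [h0, Nat.mul_mod_right] at h
  simp only [not_lt_zero, if_false, add_zero] at h
  refine Eq.trans ?_ h
  congr 1
  ext x
  simp only [Finset.mem_filter]
  refine and_congr_right fun _ => ?_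
  have h1 : (p - 1) * c + c = p * c := by
    obtain ⟨m, hm⟩ : ∃ m, p = m + 1 := ⟨p - 1, by have := hpp.out.pos; omega⟩
    rw [hm]; simp; ring
  constructor
  · intro hx
    have : x + c ≡ (p - 1) * c + c [MOD p] := by
      rw [h1]
      exact ((Nat.modEq_zero_iff_dvd).mpr hx).trans ((Nat.modEq_zero_iff_dvd).mpr (dvd_mul_right p c)).symm
    exact Nat.ModEq.add_right_cancel' c this
  · intro hx
    have := Nat.ModEq.add_right c hx
    rw [h1] at this
    exact (Nat.modEq_zero_iff_dvd).mp (this.trans ((Nat.modEq_zero_iff_dvd).mpr (dvd_mul_right p c)))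

open Classical in
theorem card_TT_split (K j : ℕ) : (TT p K j).card =
    ((Finset.range (p ^ (K - j))).filter fun x => Adm p K j (true, true, x)).card +
    ((Finset.range (p ^ (K - j))).filter fun x => Adm p K j (true, false, x)).card +
    (((Finset.range (p ^ (K - j))).filter fun x => Adm p K j (false, true, x)).card +
    ((Finset.range (p ^ (K - j))).filter fun x => Adm p K j (false, false, x)).card) := by
  unfold TT
  simp_rw [Finset.card_filter]
  rw [Finset.sum_product, Fintype.sum_bool, Finset.sum_product, Finset.sum_product, Fintype.sum_bool, Fintype.sum_bool]

theorem card_TT_last (K : ℕ) (hK : 0 < K) : (TT p K K).card = 2 := by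
  classical
  rw [card_TT_split, Nat.sub_self, pow_zero]
  have : K ≠ 0 := hK.ne'
  simp [Adm, this]

theorem card_TT_mid (K j n : ℕ) (hj : j ≠ 0) (hn : K - j = n + 1) :
    (TT p K j).card = 2 * (p ^ (n + 1) + p ^ n) := by
  classical
  have hc := count_dvd p (p ^ n) 0
  rw [← pow_succ'] at hc
  have hjK : j < K := by omega
  rw [card_TT_split, hn]
  simp only [Adm, hj, hjK, and_true, true_implies, false_implies, Bool.false_eq_true, Finset.filter_true,
    Finset.card_range]
  simp only [add_zero] at hc
  rw [hc]
  ring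

theorem card_TT_zero (hp : p ≠ 2) (n : ℕ) : (TT p (n + 1) 0).card = p ^ (n + 1) + 2 * p ^ n := by
  classical
  have hc := count_dvd p (p ^ n) 0
  have hc4 := count_dvd p (p ^ n) 4
  rw [← pow_succ'] at hc hc4
  simp only [add_zero] at hc
  have h4 := Finset.card_filter_add_card_filter_not (s := Finset.range (p ^ (n + 1))) (p := fun x => p ∣ x + 4)
  rw [hc4, Finset.card_range] at h4
  rw [card_TT_split, Nat.sub_zero]
  simp only [Adm, Nat.succ_pos, and_true, true_implies, false_implies, Bool.false_eq_true, Bool.true_eq_false,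
    true_and, and_self]
  have hx : ((Finset.range (p ^ (n + 1))).filter fun x => p ∣ x ∧ ¬ p ∣ x + 4) =
      (Finset.range (p ^ (n + 1))).filter fun x => p ∣ x := by
    ext x
    simp only [Finset.mem_filter, and_congr_right_iff, and_iff_left_iff_imp]
    intro _ h1 h2
    have h3 : p ∣ 4 := (Nat.dvd_add_right h1).mp h2
    have h5 : p ∣ 2 := by
      have : (4 : ℕ) = 2 ^ 2 := by norm_num
      rw [this] at h3; exact hpp.out.dvd_of_dvd_pow h3
    exact hp ((Nat.prime_dvd_prime_iff_eq hpp.out Nat.prime_two).mp h5)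
  rw [hx, hc]
  omega

/-- number of classes -/
def kap (k : ℕ) : ℕ := p + 4 + ∑ i ∈ Finset.range k, p ^ i * (p ^ 2 + 3 * p)

theorem card_index (hp : p ≠ 2) (k : ℕ) :
    ((Finset.range (k + 2)).sigma (TT p (k + 1))).card = kap p k := by
  rw [Finset.card_sigma, Finset.sum_range_succ, Finset.sum_range_succ', card_TT_last p _ (Nat.succ_pos _),
    card_TT_zero p hp]
  have h1 : ∑ i ∈ Finset.range k, (TT p (k + 1) (i + 1)).card =
      ∑ i ∈ Finset.range k, 2 * (p ^ (k - 1 - i + 1) + p ^ (k - 1 - i)) := by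
    refine Finset.sum_congr rfl fun i hi => ?_
    have := Finset.mem_range.mp hi
    exact card_TT_mid p _ _ _ (Nat.succ_ne_zero _) (by omega)
  rw [h1, Finset.sum_range_reflect (fun i => 2 * (p ^ (i + 1) + p ^ i)) k]
  unfold kap
  induction k with
  | zero => simp
  | succ k ih =>
    rw [Finset.sum_range_succ, Finset.sum_range_succ]
    have := ih ?_
    · ring_nf at this ⊢
      linarith
    · refine Finset.sum_congr rfl fun i hi => ?_
      have := Finset.mem_range.mp hi
      exact card_TT_mid p _ _ _ (Nat.succ_ne_zero _) (by omega)

/-- the second parameter -/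
def bet (ν : ℕ) (f : Bool) : ℤ := if f then (ν : ℤ) else 1

theorem flag_false (ν : ℕ) (hν : ¬ IsSquare (ν : ZMod p)) {K j : ℕ} (hjK : j < K) (e e' : Bool) {c c' : ℕ}
    (hb : ∀ f, ¬ (p:ℤ) ∣ bet ν f)
    (hc : p ∣ c) (he : sg e = sg e')
    (h : IsConj (rep (p ^ K) (sg e) (sg_or e) (p ^ j) (bet ν true) c)
      (rep (p ^ K) (sg e') (sg_or e') (p ^ j) (bet ν false) c')) : False := by
  have h2 := rep_conj (p ^ K) h
  rw [← he] at h2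
  obtain ⟨x, hx⟩ := (det_eq p hjK.le (sg_or e) h2).2 hjK (hb _) (by exact_mod_cast hc)
  have h3 := (ZMod.intCast_zmod_eq_zero_iff_dvd _ p).mpr hx
  simp only [bet] at h3
  push_cast at h3
  have hx0 : (x : ZMod p) ≠ 0 := by
    intro h0; rw [h0] at h3; simp at h3
  apply hν
  refine ⟨(x : ZMod p)⁻¹, ?_⟩
  field_simp
  linear_combination h3

theorem rep_inj (hp : p ≠ 2) (ν : ℕ) (hν : ¬ IsSquare (ν : ZMod p)) {K : ℕ} (hK : 0 < K) {j j' : ℕ} (hj : j ≤ K) (hj' : j' ≤ K)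
    (x x' : Bool × Bool × ℕ) (hx : x ∈ TT p K j) (hx' : x' ∈ TT p K j')
    (h : IsConj (rep (p ^ K) (sg x.1) (sg_or _) (p ^ j) (bet ν x.2.1) x.2.2)
      (rep (p ^ K) (sg x'.1) (sg_or _) (p ^ j') (bet ν x'.2.1) x'.2.2)) : j = j' ∧ x = x' := by
  classical
  obtain ⟨e, f, c⟩ := x
  obtain ⟨e', f', c'⟩ := x'
  simp only [TT, Finset.mem_filter, Finset.mem_product, Finset.mem_univ, true_and, Finset.mem_range] at hx hx'
  obtain ⟨hc, hA⟩ := hx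
  obtain ⟨hc', hA'⟩ := hx'
  simp only [Adm] at hA hA'
  dsimp only at h
  have hp2 : ¬ (p:ℤ) ∣ 4 := by
    intro h
    have h3 : p ∣ 4 := by exact_mod_cast h
    have h5 : p ∣ 2 := by
      have : (4 : ℕ) = 2 ^ 2 := by norm_num
      rw [this] at h3; exact hpp.out.dvd_of_dvd_pow h3
    exact hp ((Nat.prime_dvd_prime_iff_eq hpp.out Nat.prime_two).mp h5)
  have hb : ∀ f, ¬ (p:ℤ) ∣ bet ν f := by
    intro f h
    cases f
    · simp only [bet] at h
      have : p ∣ 1 := by exact_mod_cast h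
      exact hpp.out.one_lt.ne' (Nat.dvd_one.mp this)
    · simp only [bet] at h
      have : p ∣ ν := by exact_mod_cast h
      apply hν
      rw [(ZMod.natCast_eq_zero_iff ν p).mpr this]
      exact ⟨0, by simp⟩
  have hlt : ¬ j < j' := fun hlt => level_le p (sg_or e) (hb f) (lt_of_lt_of_le hlt hj') hlt (rep_conj (p ^ K) h)
  have hlt' : ¬ j' < j := fun hlt => level_le p (sg_or e') (hb f') (lt_of_lt_of_le hlt hj) hlt (rep_conj (p ^ K) h.symm)
  obtain rfl : j = j' := by omega
  refine ⟨rfl, ?_⟩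
  have aux : ∀ (e f) (c : ℕ), (f = true → p ∣ c ∧ j < K) → (j = 0 → e = true → ¬ p ∣ c + 4) →
      (j = 0 → sg e = 1 → ¬ (p:ℤ) ∣ bet ν f * c + 4) := by
    intro e f c h1 h2 h3 h4 h5
    have he : e = true := by cases e; · simp [sg] at h4
                             · rfl
    cases f
    · simp only [bet] at h5
      apply h2 h3 he
      simp only [Bool.false_eq_true, if_false, one_mul] at h5
      exact_mod_cast h5
    · have h6 : (p:ℤ) ∣ bet ν true * c := (by exact_mod_cast (h1 rfl).1 : (p:ℤ) ∣ c).mul_left _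
      exact hp2 ((dvd_add_right h6).mp h5)
  have aux' : ∀ (e : Bool) (c : ℕ), (j = 0 → e = false → p ∣ c) → (j = 0 → sg e = -1 → (p:ℤ) ∣ c) := by
    intro e c h1 h2 h3
    have he : e = false := by cases e; · rfl
                              · simp [sg] at h3
    exact_mod_cast h1 h2 he
  have hs := sign_eq p hp hK (sg_or e) (sg_or e') (aux e f c hA.1 hA.2.1) (aux' e' c' hA'.2.2) (rep_conj (p ^ K) h)
  have hs' := sign_eq p hp hK (sg_or e') (sg_or e) (aux e' f' c' hA'.1 hA'.2.1) (aux' e c hA.2.2) (rep_conj (p ^ K) h.symm)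
  have hee : e = e' := by
    cases e <;> cases e' <;> simp [sg] at hs hs' ⊢
  subst hee
  have hff : f = f' := by
    cases f <;> cases f'
    · rfl
    · exact (flag_false p ν hν (hA'.1 rfl).2 e e hb (hA'.1 rfl).1 rfl h.symm).elim
    · exact (flag_false p ν hν (hA.1 rfl).2 e e hb (hA.1 rfl).1 rfl h).elim
    · rfl
  subst hff
  have hd := (det_eq p hj (sg_or e) (rep_conj (p ^ K) h)).1
  rw [← mul_sub] at hd
  have hcop : IsCoprime ((p:ℤ) ^ (K - j)) (bet ν f) := by
    apply IsCoprime.pow_left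
    rw [Int.isCoprime_iff_gcd_eq_one, Int.gcd_comm]
    by_contra hne
    have h8 := (Nat.prime_iff_prime_int.mp hpp.out).coprime_iff_not_dvd (n := bet ν f)
    exact hne (by rw [Int.gcd_comm]; exact Int.isCoprime_iff_gcd_eq_one.mp (h8.mpr (hb f)))
  have hd2 := hcop.dvd_of_dvd_mul_left hd
  have hmod : c' ≡ c [MOD p ^ (K - j)] := by
    rw [Nat.modEq_iff_dvd]
    push_cast
    exact hd2
  rw [Nat.ModEq.eq_of_lt_of_lt hmod hc' hc]

theorem kap_le (hp : p ≠ 2) (k : ℕ) (W : Wed (Gk p k)) : kap p k ≤ W.r := by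
  obtain ⟨ν, hν⟩ := exists_nonsquare p hp
  have hν' : ¬ IsSquare ((ν.val : ℕ) : ZMod p) := by rwa [ZMod.natCast_zmod_val]
  rw [← card_index p hp k]
  have := W.card_le_of_nonconj (α := {x // x ∈ (Finset.range (k + 2)).sigma (TT p (k + 1))})
    (fun x => rep (p ^ (k + 1)) (sg x.1.2.1) (sg_or _) (p ^ x.1.1) (bet ν.val x.1.2.2.1) x.1.2.2.2) (by
      rintro ⟨⟨j, x⟩, hx⟩ ⟨⟨j', x'⟩, hx'⟩ h
      rw [Finset.mem_sigma, Finset.mem_range] at hx hx'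
      obtain ⟨rfl, rfl⟩ := rep_inj p hp ν.val hν' (Nat.succ_pos k) (Nat.le_of_lt_succ hx.1) (Nat.le_of_lt_succ hx'.1) x x' hx.2 hx'.2 h
      rfl)
  rwa [Fintype.card_coe] at this

end SLZeta

/-! ### Part L: irreducible representations of `SL₂(F_p)` -/
namespace SLZeta
variable (p : ℕ) [hpp : Fact p.Prime]

/-- element of the Borel subgroup -/
def bb (b : (ZMod p)ˣ × ZMod p) : SL(2, ZMod p) :=
  mkSL (b.1 : ZMod p) (b.1 * b.2) 0 ((b.1⁻¹ : (ZMod p)ˣ) : ZMod p) (by rw [Units.mul_inv]; ring)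

/-- element of the big cell -/
def big (z : (ZMod p)ˣ × ZMod p × ZMod p) : SL(2, ZMod p) :=
  mkSL (z.1 * z.2.1 : ZMod p) (z.1 * z.2.1 * z.2.2 - ((z.1⁻¹ : (ZMod p)ˣ) : ZMod p)) z.1 (z.1 * z.2.2)
    (by
      have : ((z.1⁻¹ : (ZMod p)ˣ) : ZMod p) * z.1 = 1 := Units.inv_mul _
      linear_combination this)

theorem sum_cells (f : SL(2, ZMod p) → ℂ) :
    ∑ g, f g = ∑ z, f (big p z) + ∑ b, f (bb p b) := by
  classical
  rw [← Finset.sum_filter_not_add_sum_filter _ (fun g : SL(2, ZMod p) => g 1 0 = 0)]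
  congr 1
  · symm
    refine Finset.sum_bij (fun z _ => big p z) ?_ ?_ ?_ ?_
    · intro z _
      simp [-ZMod.inv_coe_unit, big, mk10]
    · rintro ⟨c, a, d⟩ _ ⟨c', a', d'⟩ _ h
      have h1 := congrArg (fun g : SL(2, ZMod p) => g 1 0) h
      have h2 := congrArg (fun g : SL(2, ZMod p) => g 0 0) h
      have h3 := congrArg (fun g : SL(2, ZMod p) => g 1 1) h
      simp only [big, mk10, mk00, mk11] at h1 h2 h3
      have h1' := Units.ext h1
      subst h1'
      simp at h2 h3
      rw [h2, h3]
    · intro g hg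
      have hg : g 1 0 ≠ 0 := by simpa using hg
      refine ⟨(Units.mk0 _ hg, g 0 0 / g 1 0, g 1 1 / g 1 0), Finset.mem_univ _, ?_⟩
      have hd := sl_det g
      apply sl_ext
      · simp only [big, mk00]; simp; field_simp
      · simp only [big, mk01]; simp; field_simp; linear_combination hd
      · simp [-ZMod.inv_coe_unit, big, mk10]
      · simp only [big, mk11]; simp; field_simp
    · intros; rfl
  · symm
    refine Finset.sum_bij (fun z _ => bb p z) ?_ ?_ ?_ ?_
    · intro z _
      simp [-ZMod.inv_coe_unit, bb, mk10]
    · rintro ⟨t, x⟩ _ ⟨t', x'⟩ _ h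
      have h1 := congrArg (fun g : SL(2, ZMod p) => g 0 0) h
      have h2 := congrArg (fun g : SL(2, ZMod p) => g 0 1) h
      simp only [bb, mk01, mk00] at h1 h2
      have h1' := Units.ext h1
      subst h1'
      simp at h2
      rw [h2]
    · intro g hg
      have hg : g 1 0 = 0 := by simpa using hg
      have hd := sl_det g
      rw [hg, mul_zero, sub_zero] at hd
      refine ⟨(⟨g 0 0, g 1 1, hd, by rw [mul_comm]; exact hd⟩, g 1 1 * g 0 1), Finset.mem_univ _, ?_⟩
      apply sl_ext
      · simp [-ZMod.inv_coe_unit, bb, mk00]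
      · simp only [bb, mk01]; linear_combination g 0 1 * hd
      · simp [-ZMod.inv_coe_unit, bb, mk10, hg]
      · simp only [bb, mk11]; rfl
    · intros; rfl

theorem bb_mul (t s : (ZMod p)ˣ) (x w : ZMod p) :
    bb p (t, x) * bb p (s, w) = bb p (t * s, w + x * ((s⁻¹ : (ZMod p)ˣ) : ZMod p) ^ 2) := by
  have hs : (s : ZMod p) * ((s⁻¹ : (ZMod p)ˣ) : ZMod p) = 1 := Units.mul_inv _
  apply sl_ext
  · simp [-ZMod.inv_coe_unit, bb, mul00, mk00, mk01, mk10]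
  · simp only [bb, mul01, mk00, mk01, mk11, Units.val_mul]
    linear_combination (- (t:ZMod p) * x * ((s⁻¹ : (ZMod p)ˣ) : ZMod p)) * hs
  · simp [-ZMod.inv_coe_unit, bb, mul10, mk00, mk11, mk10]
  · simp [-ZMod.inv_coe_unit, bb, mul11, mk11, mk01, mk10, mul_comm]

theorem bb_eq_iff (t s : (ZMod p)ˣ) (x w : ZMod p) : bb p (t, x) = bb p (s, w) ↔ t = s ∧ x = w := by
  constructor
  · intro h
    have h1 := congrArg (fun g : SL(2, ZMod p) => g 0 0) h
    have h2 := congrArg (fun g : SL(2, ZMod p) => g 0 1) h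
    simp only [bb, mk01, mk00] at h1 h2
    have h1' := Units.ext h1
    subst h1'
    simpa using h2
  · rintro ⟨rfl, rfl⟩; rfl

theorem bb_small (t t' s : (ZMod p)ˣ) (x x' w : ZMod p) :
    bb p (t, x) * bb p (s, w) * bb p (t', x') = bb p (s, w) ↔
      t' = t⁻¹ ∧ x' = w - (w + x * ((s⁻¹ : (ZMod p)ˣ) : ZMod p) ^ 2) * (t : ZMod p) ^ 2 := by
  rw [bb_mul, bb_mul, bb_eq_iff]
  have : t * s * t' = s ↔ t' = t⁻¹ := by
    rw [mul_right_comm, mul_eq_right, eq_inv_iff_mul_eq_one, mul_comm]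
  rw [this]
  refine and_congr_right ?_
  rintro rfl
  rw [inv_inv, eq_sub_iff_add_eq]

theorem bb_big (t t' c : (ZMod p)ˣ) (x x' a d : ZMod p) :
    bb p (t, x) * big p (c, a, d) * bb p (t', x') = big p (c, a, d) ↔
      t' = t ∧ x = a * ((t⁻¹ : (ZMod p)ˣ) : ZMod p) ^ 2 - a ∧
        x' = d - d * ((t⁻¹ : (ZMod p)ˣ) : ZMod p) ^ 2 := by
  have hc : (c : ZMod p) ≠ 0 := c.ne_zero
  have ht : (t : ZMod p) ≠ 0 := t.ne_zero
  have ht' : (t' : ZMod p) ≠ 0 := t'.ne_zero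
  constructor
  · intro h
    have h1 := congrArg (fun g : SL(2, ZMod p) => g 1 0) h
    have h2 := congrArg (fun g : SL(2, ZMod p) => g 0 0) h
    have h3 := congrArg (fun g : SL(2, ZMod p) => g 1 1) h
    simp only [bb, big, mul00, mul01, mul10, mul11, mk00, mk01, mk10, mk11, Units.val_inv_eq_inv_val] at h1 h2 h3
    have e1 : (t' : ZMod p) = t := by
      field_simp at h1
      apply mul_left_cancel₀ (pow_ne_zero 2 hc)
      linear_combination h1
    have e1' : t' = t := Units.ext e1
    subst e1'
    refine ⟨rfl, ?_, ?_⟩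
    · rw [Units.val_inv_eq_inv_val]
      field_simp at h2 ⊢
      apply mul_left_cancel₀ (pow_ne_zero 2 hc)
      linear_combination h2
    · rw [Units.val_inv_eq_inv_val]
      field_simp at h3 ⊢
      apply mul_left_cancel₀ (pow_ne_zero 2 hc)
      linear_combination h3
  · rintro ⟨rfl, rfl, rfl⟩
    apply sl_ext <;>
    simp only [bb, big, mul00, mul01, mul10, mul11, mk00, mk01, mk10, mk11, Units.val_inv_eq_inv_val] <;>
    field_simp <;> ring

/-- element of the group algebra of the Borel subgroup -/
noncomputable def EE (α : (ZMod p)ˣ → ZMod p → ℂ) : MonoidAlgebra ℂ SL(2, ZMod p) :=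
  ∑ t, ∑ x, α t x • δ (bb p (t, x))

theorem tr_EE (W : Wed SL(2, ZMod p)) (i) (α) : W.tr i (EE p α) = ∑ t, ∑ x, α t x * W.tr i (δ (bb p (t, x))) := by
  simp only [EE, map_sum, map_smul, smul_eq_mul]

theorem sum_ite_aux {ι κ : Type*} [Fintype ι] [Fintype κ] [DecidableEq ι] [DecidableEq κ]
    (f : ι → κ → ℂ) (P : ι → κ → Prop) [∀ i k, Decidable (P i k)] (i0 : ι) (k0 : κ) (h : ∀ i k, P i k ↔ i = i0 ∧ k = k0) :
    (∑ i, ∑ k, if P i k then f i k else 0) = f i0 k0 := by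
  rw [Finset.sum_eq_single i0]
  · rw [Finset.sum_eq_single k0]
    · rw [if_pos ((h _ _).2 ⟨rfl, rfl⟩)]
    · intro k _ hk; rw [if_neg]; rw [h]; tauto
    · simp
  · intro i _ hi
    refine Finset.sum_eq_zero fun k _ => ?_
    rw [if_neg]; rw [h]; tauto
  · simp

theorem J_form (W : Wed SL(2, ZMod p)) (α β : (ZMod p)ˣ → ZMod p → ℂ) :
    ∑ i, W.tr i (EE p α) * W.tr i (EE p β) =
      ((p : ℂ) - 1) * (∑ a : ZMod p, ∑ d : ZMod p, ∑ t : (ZMod p)ˣ,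
        α t (a * ((t⁻¹ : (ZMod p)ˣ) : ZMod p) ^ 2 - a) * β t (d - d * ((t⁻¹ : (ZMod p)ˣ) : ZMod p) ^ 2)) +
      ∑ s : (ZMod p)ˣ, ∑ w : ZMod p, ∑ t : (ZMod p)ˣ, ∑ x : ZMod p,
        α t x * β t⁻¹ (w - (w + x * ((s⁻¹ : (ZMod p)ˣ) : ZMod p) ^ 2) * (t : ZMod p) ^ 2) := by
  classical
  have h1 : ∑ i, W.tr i (EE p α) * W.tr i (EE p β) =
      ∑ g, ∑ t, ∑ x, ∑ t', ∑ x', if bb p (t, x) * g * bb p (t', x') = g then α t x * β t' x' else 0 := by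
    have h2 : ∀ i, W.tr i (EE p α) * W.tr i (EE p β) = ∑ b : (ZMod p)ˣ × ZMod p, ∑ b' : (ZMod p)ˣ × ZMod p,
        α b.1 b.2 * β b'.1 b'.2 * (W.tr i (δ (bb p b)) * W.tr i (δ (bb p b'))) := by
      intro i
      rw [tr_EE, tr_EE, ← Fintype.sum_prod_type (f := fun b => α b.1 b.2 * W.tr i (δ (bb p b))),
        ← Fintype.sum_prod_type (f := fun b => β b.1 b.2 * W.tr i (δ (bb p b))), Finset.sum_mul_sum]
      refine Finset.sum_congr rfl fun b _ => Finset.sum_congr rfl fun b' _ => ?_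
      ring
    have h3 : ∀ g, (∑ t, ∑ x, ∑ t', ∑ x', if bb p (t, x) * g * bb p (t', x') = g then α t x * β t' x' else 0) =
        ∑ b : (ZMod p)ˣ × ZMod p, ∑ b' : (ZMod p)ˣ × ZMod p,
          if bb p b * g * bb p b' = g then α b.1 b.2 * β b'.1 b'.2 else 0 := by
      intro g
      simp_rw [Fintype.sum_prod_type]
    simp_rw [h2, h3]
    rw [Finset.sum_comm]
    rw [Finset.sum_comm (s := (Finset.univ : Finset SL(2, ZMod p)))]
    refine Finset.sum_congr rfl fun b _ => ?_
    rw [Finset.sum_comm]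
    rw [Finset.sum_comm (s := (Finset.univ : Finset SL(2, ZMod p)))]
    refine Finset.sum_congr rfl fun b' _ => ?_
    rw [← Finset.mul_sum, W.ortho, ← Finset.sum_filter, Finset.sum_const, nsmul_eq_mul, mul_comm]
  rw [h1, sum_cells]
  congr 1
  · rw [Fintype.sum_prod_type]
    have hq : ((p : ℂ) - 1) = ((Finset.univ : Finset (ZMod p)ˣ).card : ℂ) := by
      rw [Finset.card_univ, ZMod.card_units, Nat.cast_sub hpp.out.one_le, Nat.cast_one]
    rw [hq, ← nsmul_eq_mul, ← Finset.sum_const]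
    refine Finset.sum_congr rfl fun c _ => ?_
    rw [Fintype.sum_prod_type]
    refine Finset.sum_congr rfl fun a _ => Finset.sum_congr rfl fun d _ => Finset.sum_congr rfl fun t _ => ?_
    rw [Finset.sum_eq_single (a * ((t⁻¹ : (ZMod p)ˣ) : ZMod p) ^ 2 - a)]
    · exact sum_ite_aux (fun t' x' => α t _ * β t' x') _ t _ (fun t' x' => by rw [bb_big]; tauto)
    · intro x _ hx
      refine Finset.sum_eq_zero fun t' _ => Finset.sum_eq_zero fun x' _ => ?_
      rw [if_neg]; rw [bb_big]; tauto
    · exact fun h => absurd (Finset.mem_univ _) h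
  · rw [Fintype.sum_prod_type]
    refine Finset.sum_congr rfl fun s _ => Finset.sum_congr rfl fun w _ => Finset.sum_congr rfl fun t _ =>
      Finset.sum_congr rfl fun x _ => ?_
    exact sum_ite_aux (fun t' x' => α t x * β t' x') _ t⁻¹ _ (fun t' x' => by rw [bb_small])

end SLZeta

namespace SLZeta
variable (p : ℕ) [hpp : Fact p.Prime]

theorem sum_psi (c : ZMod p) : ∑ x : ZMod p, ZMod.stdAddChar (x * c) = if c = 0 then (p : ℂ) else 0 := by
  have := AddChar.sum_mulShift c (ZMod.isPrimitive_stdAddChar p)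
  rw [this]
  simp [ZMod.card]

/-- Fourier data for the unipotent subgroup -/
noncomputable def DU : FD SL(2, ZMod p) (ZMod p) :=
  FD.ofPairing p (fun x => bb p (1, x)) (fun x y => by rw [bb_mul, bb_eq_iff]; simp [add_comm])
    (fun a x => a * x) (fun a x y => mul_add a x y) (fun a b x => add_mul a b x)
    (fun a ha => ⟨1, by simpa using ha⟩) (fun a ha => ⟨1, by simpa using ha⟩)

theorem DU_n (x) : (DU p).n x = bb p (1, x) := rfl
theorem DU_χ (a x) : (DU p).χ a x = ZMod.stdAddChar (a * x) := rfl

/-- coefficients of `e y` -/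
noncomputable def aE (y : ZMod p) (t : (ZMod p)ˣ) (x : ZMod p) : ℂ :=
  if t = 1 then (p : ℂ)⁻¹ * ZMod.stdAddChar (x * (-y)) else 0

theorem e_eq (y : ZMod p) : (DU p).e y = EE p (aE p y) := by
  unfold FD.e EE
  symm
  rw [Finset.sum_eq_single 1]
  · rw [Finset.smul_sum]
    refine Finset.sum_congr rfl fun x _ => ?_
    rw [smul_smul, aE, if_pos rfl, ZMod.card, DU_n, DU_χ]
    congr 3
    ring
  · intro t _ ht
    refine Finset.sum_eq_zero fun x _ => ?_
    rw [aE, if_neg ht, zero_smul]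
  · exact fun h => absurd (Finset.mem_univ _) h

/-- coefficients of `eB θ` -/
noncomputable def aB (θ : DirichletCharacter ℂ p) (t : (ZMod p)ˣ) (x : ZMod p) : ℂ :=
  ((p : ℂ) * (p - 1))⁻¹ * θ ((t⁻¹ : (ZMod p)ˣ) : ZMod p)

/-- idempotents of the Borel subgroup -/
noncomputable def eB (θ : DirichletCharacter ℂ p) : MonoidAlgebra ℂ SL(2, ZMod p) := EE p (aB p θ)

theorem pne : (p : ℂ) ≠ 0 := by exact_mod_cast hpp.out.ne_zero
theorem p1ne : (p : ℂ) - 1 ≠ 0 := by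
  rw [sub_ne_zero]; exact_mod_cast hpp.out.one_lt.ne'

theorem card_T : ((Finset.univ : Finset (ZMod p)ˣ).card : ℂ) = p - 1 := by
  rw [Finset.card_univ, ZMod.card_units, Nat.cast_sub hpp.out.one_le, Nat.cast_one]

theorem sum_char (θ : DirichletCharacter ℂ p) [Decidable (θ = 1)] :
    ∑ t : (ZMod p)ˣ, θ (t : ZMod p) = if θ = 1 then (p : ℂ) - 1 else 0 := by
  split_ifs with h
  · subst h
    simp only [MulChar.one_apply_coe]
    rw [Finset.sum_const, nsmul_eq_mul, card_T, mul_one]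
  · obtain ⟨s, hs⟩ := MulChar.ne_one_iff.mp h
    have : ∑ t : (ZMod p)ˣ, θ (t : ZMod p) = θ (s : ZMod p) * ∑ t : (ZMod p)ˣ, θ (t : ZMod p) := by
      rw [Finset.mul_sum]
      symm
      refine Fintype.sum_equiv (Equiv.mulLeft s) _ _ fun t => ?_
      rw [Equiv.coe_mulLeft, Units.val_mul, map_mul]
    have h2 : (θ (s : ZMod p) - 1) * ∑ t : (ZMod p)ˣ, θ (t : ZMod p) = 0 := by linear_combination -this
    exact (mul_eq_zero.mp h2).resolve_left (sub_ne_zero.mpr hs)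

theorem char_inv_mul (θ : DirichletCharacter ℂ p) (t : (ZMod p)ˣ) :
    θ ((t⁻¹ : (ZMod p)ˣ) : ZMod p) * θ (t : ZMod p) = 1 := by
  rw [← map_mul, Units.inv_mul, map_one]

theorem inv_char (θ : DirichletCharacter ℂ p) (t : (ZMod p)ˣ) :
    θ⁻¹ (t : ZMod p) = θ ((t⁻¹ : (ZMod p)ˣ) : ZMod p) := by
  rw [MulChar.inv_apply, Ring.inverse_unit]

theorem bb_mul_eB (θ) (t : (ZMod p)ˣ) (x : ZMod p) : δ (bb p (t, x)) * eB p θ = θ (t : ZMod p) • eB p θ := by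
  unfold eB EE
  rw [Finset.mul_sum, Finset.smul_sum]
  refine Fintype.sum_equiv (Equiv.mulLeft t) _ _ fun s => ?_
  rw [Finset.mul_sum, Finset.smul_sum]
  refine Fintype.sum_equiv (Equiv.addRight (x * ((s⁻¹ : (ZMod p)ˣ) : ZMod p) ^ 2)) _ _ fun w => ?_
  rw [Equiv.coe_mulLeft, Equiv.coe_addRight, mul_smul_comm, ← δ_mul, bb_mul, smul_smul]
  congr 1
  unfold aB
  beta_reduce
  rw [mul_inv t s, Units.val_mul, map_mul]
  linear_combination (-((p : ℂ) * (p - 1))⁻¹ * θ ((s⁻¹ : (ZMod p)ˣ) : ZMod p)) * char_inv_mul p θ t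

theorem eB_idem (θ) : eB p θ * eB p θ = eB p θ := by
  conv_lhs => lhs; rw [eB, EE]
  rw [Finset.sum_mul]
  have : ∀ t : (ZMod p)ˣ, (∑ x : ZMod p, aB p θ t x • δ (bb p (t, x))) * eB p θ = ((p : ℂ) - 1)⁻¹ • eB p θ := by
    intro t
    rw [Finset.sum_mul]
    have h : ∀ x : ZMod p, aB p θ t x • δ (bb p (t, x)) * eB p θ = ((p : ℂ) * (p - 1))⁻¹ • eB p θ := by
      intro x
      rw [smul_mul_assoc, bb_mul_eB, smul_smul, aB, mul_assoc, char_inv_mul, mul_one]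
    simp_rw [h]
    rw [Finset.sum_const, Finset.card_univ, ZMod.card, ← Nat.cast_smul_eq_nsmul ℂ, smul_smul]
    congr 1
    have := pne p; have := p1ne p
    field_simp
  simp_rw [this]
  rw [Finset.sum_const, ← Nat.cast_smul_eq_nsmul ℂ, card_T, smul_smul, mul_inv_cancel₀ (p1ne p), one_smul]

theorem sum_chars (t : (ZMod p)ˣ) [Decidable (t = 1)] :
    ∑ θ : DirichletCharacter ℂ p, θ (t : ZMod p) = if t = 1 then (p : ℂ) - 1 else 0 := by
  classical
  rw [DirichletCharacter.sum_characters_eq]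
  rw [Nat.totient_prime hpp.out, Nat.cast_sub hpp.out.one_le, Nat.cast_one]
  refine if_congr ?_ rfl rfl
  exact Units.val_eq_one

theorem eB_sum : ∑ θ, eB p θ = (DU p).e 0 := by
  classical
  rw [e_eq]
  unfold eB EE
  rw [Finset.sum_comm]
  refine Finset.sum_congr rfl fun t _ => ?_
  rw [Finset.sum_comm]
  refine Finset.sum_congr rfl fun x _ => ?_
  rw [← Finset.sum_smul]
  congr 1
  unfold aB aE
  rw [← Finset.mul_sum, sum_chars]
  simp only [inv_eq_one, neg_zero, mul_zero, AddChar.map_zero_eq_one]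
  have := pne p; have := p1ne p
  split_ifs
  · field_simp
  · simp

theorem sum_ee (W : Wed SL(2, ZMod p)) (y z : ZMod p) :
    ∑ i, W.tr i ((DU p).e y) * W.tr i ((DU p).e z) = (p : ℂ) - 1 +
      ((Finset.univ.filter fun s : (ZMod p)ˣ => z * (s : ZMod p) ^ 2 = y).card : ℂ) := by
  classical
  have hp0 := pne p; have hp1 := p1ne p
  rw [e_eq, e_eq, J_form]
  congr 1
  · have : ∀ a d : ZMod p, (∑ t : (ZMod p)ˣ,
        aE p y t (a * ((t⁻¹ : (ZMod p)ˣ) : ZMod p) ^ 2 - a) * aE p z t (d - d * ((t⁻¹ : (ZMod p)ˣ) : ZMod p) ^ 2)) = ((p:ℂ)⁻¹) ^ 2 := by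
      intro a d
      rw [Finset.sum_eq_single 1]
      · simp [aE, pow_two]
      · intro t _ ht; rw [aE, if_neg ht, zero_mul]
      · exact fun h => absurd (Finset.mem_univ _) h
    simp_rw [this]
    rw [Finset.sum_const, Finset.sum_const, Finset.card_univ, ZMod.card, nsmul_eq_mul, nsmul_eq_mul]
    field_simp
  · have : ∀ s : (ZMod p)ˣ, ∀ w : ZMod p, (∑ t : (ZMod p)ˣ, ∑ x : ZMod p,
        aE p y t x * aE p z t⁻¹ (w - (w + x * ((s⁻¹ : (ZMod p)ˣ) : ZMod p) ^ 2) * (t : ZMod p) ^ 2)) =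
        if z * ((s⁻¹ : (ZMod p)ˣ) : ZMod p) ^ 2 = y then (p:ℂ)⁻¹ else 0 := by
      intro s w
      rw [Finset.sum_eq_single 1]
      · have h : ∀ x : ZMod p, aE p y 1 x * aE p z 1⁻¹ (w - (w + x * ((s⁻¹ : (ZMod p)ˣ) : ZMod p) ^ 2) * ((1 : (ZMod p)ˣ) : ZMod p) ^ 2) = ((p:ℂ)⁻¹) ^ 2 * ZMod.stdAddChar (x * (z * ((s⁻¹ : (ZMod p)ˣ) : ZMod p) ^ 2 - y)) := by
          intro x
          rw [aE, aE, if_pos rfl, if_pos inv_one, mul_mul_mul_comm, ← AddChar.map_add_eq_mul, ← pow_two, Units.val_one]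
          congr 2
          ring
        simp_rw [h]
        rw [← Finset.mul_sum, sum_psi]
        simp only [sub_eq_zero]
        split_ifs
        · field_simp
        · simp
      · intro t _ ht
        refine Finset.sum_eq_zero fun x _ => ?_
        rw [aE, if_neg ht, zero_mul]
      · exact fun h => absurd (Finset.mem_univ _) h
    simp_rw [this]
    simp_rw [Finset.sum_const, Finset.card_univ, ZMod.card, nsmul_eq_mul]
    rw [← Finset.mul_sum]
    rw [Fintype.sum_equiv (Equiv.inv (ZMod p)ˣ) (fun s : (ZMod p)ˣ => if z * ((s⁻¹ : (ZMod p)ˣ) : ZMod p) ^ 2 = y then (p:ℂ)⁻¹ else 0) (fun s : (ZMod p)ˣ => if z * (s : ZMod p) ^ 2 = y then (p:ℂ)⁻¹ else 0) (fun s => rfl)]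
    rw [← Finset.sum_filter, Finset.sum_const, nsmul_eq_mul]
    field_simp

theorem sum_Be (W : Wed SL(2, ZMod p)) (θ) (z : ZMod p) (hz : z ≠ 0) :
    ∑ i, W.tr i (eB p θ) * W.tr i ((DU p).e z) = 1 := by
  classical
  have hp0 := pne p; have hp1 := p1ne p
  rw [e_eq, eB, J_form]
  have h1 : ∀ a d : ZMod p, (∑ t : (ZMod p)ˣ,
        aB p θ t (a * ((t⁻¹ : (ZMod p)ˣ) : ZMod p) ^ 2 - a) * aE p z t (d - d * ((t⁻¹ : (ZMod p)ˣ) : ZMod p) ^ 2)) = ((p : ℂ) * (p - 1))⁻¹ * (p:ℂ)⁻¹ := by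
    intro a d
    rw [Finset.sum_eq_single 1]
    · simp [aE, aB]
    · intro t _ ht; rw [aE, if_neg ht, mul_zero]
    · exact fun h => absurd (Finset.mem_univ _) h
  have h2 : ∀ s : (ZMod p)ˣ, ∀ w : ZMod p, (∑ t : (ZMod p)ˣ, ∑ x : ZMod p,
        aB p θ t x * aE p z t⁻¹ (w - (w + x * ((s⁻¹ : (ZMod p)ˣ) : ZMod p) ^ 2) * (t : ZMod p) ^ 2)) = 0 := by
    intro s w
    refine Finset.sum_eq_zero fun t _ => ?_
    by_cases ht : t = 1
    · subst ht
      have h : ∀ x : ZMod p, aB p θ 1 x * aE p z 1⁻¹ (w - (w + x * ((s⁻¹ : (ZMod p)ˣ) : ZMod p) ^ 2) * ((1 : (ZMod p)ˣ) : ZMod p) ^ 2) = ((p : ℂ) * (p - 1))⁻¹ * (p:ℂ)⁻¹ * ZMod.stdAddChar (x * (z * ((s⁻¹ : (ZMod p)ˣ) : ZMod p) ^ 2)) := by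
          intro x
          rw [aB, aE, if_pos inv_one, Units.val_one, inv_one, Units.val_one, map_one, mul_one, ← mul_assoc]
          congr 2
          ring
      simp_rw [h]
      rw [← Finset.mul_sum, sum_psi, if_neg, mul_zero]
      exact mul_ne_zero hz (pow_ne_zero _ (Units.ne_zero _))
    · refine Finset.sum_eq_zero fun x _ => ?_
      rw [aE, if_neg (by simpa using ht), mul_zero]
  simp_rw [h1, h2]
  simp only [Finset.sum_const_zero, add_zero]
  rw [Finset.sum_const, Finset.sum_const, Finset.card_univ, ZMod.card, nsmul_eq_mul, nsmul_eq_mul]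
  field_simp

theorem sum_BB (W : Wed SL(2, ZMod p)) (θ θ' : DirichletCharacter ℂ p) [Decidable (θ * θ' = 1)] [Decidable (θ = θ')] :
    ∑ i, W.tr i (eB p θ) * W.tr i (eB p θ') = (if θ * θ' = 1 then 1 else 0) + (if θ = θ' then 1 else 0) := by
  classical
  have hp0 := pne p; have hp1 := p1ne p
  rw [eB, eB, J_form]
  have h1 : ∑ t : (ZMod p)ˣ, θ ((t⁻¹ : (ZMod p)ˣ) : ZMod p) * θ' ((t⁻¹ : (ZMod p)ˣ) : ZMod p) = if θ * θ' = 1 then (p : ℂ) - 1 else 0 := by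
    rw [← sum_char]
    exact Fintype.sum_equiv (Equiv.inv (ZMod p)ˣ) _ _ (fun s => rfl)
  have h2 : ∑ t : (ZMod p)ˣ, θ ((t⁻¹ : (ZMod p)ˣ) : ZMod p) * θ' (t : ZMod p) = if θ = θ' then (p : ℂ) - 1 else 0 := by
    have := sum_char p (θ⁻¹ * θ')
    simp_rw [inv_mul_eq_one] at this
    rw [← this]
    refine Finset.sum_congr rfl fun t _ => ?_
    rw [MulChar.mul_apply, inv_char]
  congr 1
  · unfold aB
    simp_rw [mul_mul_mul_comm _ (θ _), ← Finset.mul_sum, h1]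
    rw [Finset.sum_const, Finset.sum_const, Finset.card_univ, ZMod.card, nsmul_eq_mul, nsmul_eq_mul]
    split_ifs
    · field_simp
    · simp
  · unfold aB
    simp_rw [mul_mul_mul_comm _ (θ _), inv_inv, Finset.sum_const, Finset.card_univ, ZMod.card, nsmul_eq_mul]
    simp_rw [← Finset.mul_sum]
    rw [h2]
    rw [← Finset.card_univ, card_T]
    split_ifs
    · field_simp
    · simp

end SLZeta

namespace SLZeta
variable (p : ℕ) [hpp : Fact p.Prime]

/-- multiplicity of the additive character `y` -/
noncomputable def mm (W : Wed SL(2, ZMod p)) (i : Fin W.r) (y : ZMod p) : ℕ := W.rk i ((DU p).e y)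
/-- multiplicity of the Borel character `θ` -/
noncomputable def AA (W : Wed SL(2, ZMod p)) (i : Fin W.r) (θ : DirichletCharacter ℂ p) : ℕ := W.rk i (eB p θ)

variable (W : Wed SL(2, ZMod p))

theorem mm_cast (i y) : (mm p W i y : ℂ) = W.tr i ((DU p).e y) := (W.tr_eq_rk i ((DU p).e_idem y)).symm
theorem AA_cast (i θ) : (AA p W i θ : ℂ) = W.tr i (eB p θ) := (W.tr_eq_rk i (eB_idem p θ)).symm

theorem mm_zero (i) : mm p W i 0 = ∑ θ, AA p W i θ := by
  have : (mm p W i 0 : ℂ) = ∑ θ, (AA p W i θ : ℂ) := by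
    simp_rw [mm_cast, AA_cast, ← map_sum, eB_sum]
  exact_mod_cast this

theorem d_sum (i) : W.d i = ∑ y, mm p W i y := by
  have : (W.d i : ℂ) = ∑ y, (mm p W i y : ℂ) := by
    simp_rw [mm_cast, ← map_sum, (DU p).e_sum, W.tr_one]
  exact_mod_cast this

theorem mm_sq (i) (y : ZMod p) (t : (ZMod p)ˣ) : mm p W i (y * (t : ZMod p) ^ 2) = mm p W i y := by
  have ht : (t : ZMod p) ≠ 0 := t.ne_zero
  have h := (DU p).e_conj (bb p (t, 0)) (y * (t : ZMod p) ^ 2) y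
    (Equiv.mulLeft₀ ((t : ZMod p) ^ 2) (pow_ne_zero 2 ht))
    (by
      intro x
      rw [DU_n, DU_n, bb_mul, bb_mul, bb_eq_iff]
      refine ⟨mul_comm _ _, ?_⟩
      have h9 : (Equiv.mulLeft₀ ((t : ZMod p) ^ 2) (pow_ne_zero 2 ht)) x = (t : ZMod p) ^ 2 * x := rfl
      simp only [h9, Units.val_inv_eq_inv_val]
      have : (((1 : (ZMod p)ˣ) : ZMod p)) = 1 := rfl
      rw [this]
      field_simp
      ring)
    (by
      intro x
      rw [DU_χ, DU_χ]
      congr 1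
      have h9 : (Equiv.mulLeft₀ ((t : ZMod p) ^ 2) (pow_ne_zero 2 ht)) x = (t : ZMod p) ^ 2 * x := rfl
      rw [h9]
      ring)
  have h2 : (DU p).e (y * (t : ZMod p) ^ 2) = δ (bb p (t, 0))⁻¹ * ((DU p).e y * δ (bb p (t, 0))) := by
    rw [← h, ← mul_assoc, ← δ_mul, inv_mul_cancel, δ_one, one_mul]
  have h3 : (mm p W i (y * (t : ZMod p) ^ 2) : ℂ) = mm p W i y := by
    rw [mm_cast, mm_cast, h2, W.tr_mul_comm, mul_assoc, ← δ_mul, mul_inv_cancel, δ_one, mul_one]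
  exact_mod_cast h3

theorem mm_cases (hp : p ≠ 2) (ν : ZMod p) (hν : ¬ IsSquare ν) (i) (y : ZMod p) (hy : y ≠ 0) :
    (IsSquare y ∧ mm p W i y = mm p W i 1) ∨ (¬ IsSquare y ∧ mm p W i y = mm p W i ν) := by
  obtain ⟨t, ht, h | h⟩ := isSquare_div_or p hp ν y hν hy
  · left
    refine ⟨⟨t, by rw [h]; ring⟩, ?_⟩
    have := mm_sq p W i 1 (Units.mk0 t ht)
    rw [← this, h]; simp
  · right
    constructor
    · rintro ⟨r, hr⟩
      exact hν ⟨r / t, by field_simp; rw [← h, hr]; ring⟩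
    · have := mm_sq p W i ν (Units.mk0 t ht)
      rw [← this, h]; simp

theorem two_d (hp : p ≠ 2) (ν : ZMod p) (hν : ¬ IsSquare ν) (i) :
    W.d i = mm p W i 0 + (p - 1) / 2 * (mm p W i 1 + mm p W i ν) := by
  classical
  obtain ⟨h1, h2⟩ := card_squares p hp
  rw [d_sum, ← Finset.sum_filter_add_sum_filter_not _ (fun y : ZMod p => IsSquare y)]
  have e1 : (Finset.univ.filter fun y : ZMod p => IsSquare y) =
      insert 0 (Finset.univ.filter fun D : ZMod p => D ≠ 0 ∧ IsSquare D) := by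
    ext y
    simp only [Finset.mem_filter, Finset.mem_univ, true_and, Finset.mem_insert]
    by_cases hy : y = 0
    · subst hy; simp
    · simp [hy]
  rw [e1, Finset.sum_insert (by simp)]
  have e2 : ∑ y ∈ Finset.univ.filter (fun D : ZMod p => D ≠ 0 ∧ IsSquare D), mm p W i y = (p - 1) / 2 * mm p W i 1 := by
    have : (Finset.univ.filter fun D : ZMod p => D ≠ 0 ∧ IsSquare D).card = (p - 1) / 2 := by omega
    rw [← this, ← smul_eq_mul, ← Finset.sum_const]
    refine Finset.sum_congr rfl fun y hy => ?_
    simp only [Finset.mem_filter] at hy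
    rcases mm_cases p W hp ν hν i y hy.2.1 with h | h
    · exact h.2
    · exact absurd hy.2.2 h.1
  have e3 : ∑ y ∈ Finset.univ.filter (fun D : ZMod p => ¬ IsSquare D), mm p W i y = (p - 1) / 2 * mm p W i ν := by
    have : (Finset.univ.filter fun D : ZMod p => ¬ IsSquare D).card = (p - 1) / 2 := by omega
    rw [← this, ← smul_eq_mul, ← Finset.sum_const]
    refine Finset.sum_congr rfl fun y hy => ?_
    simp only [Finset.mem_filter] at hy
    have hy0 : y ≠ 0 := by rintro rfl; exact hy.2 ⟨0, by simp⟩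
    rcases mm_cases p W hp ν hν i y hy0 with h | h
    · exact absurd h.1 hy.2
    · exact h.2
  rw [e2, e3]
  ring

theorem gen_U (H : Subgroup SL(2, ZMod p)) [H.Normal] (hU : ∀ x, bb p (1, x) ∈ H) : H = ⊤ := by
  have hl : ∀ x : ZMod p, mkSL 1 0 x 1 (by ring) ∈ H := by
    intro x
    have := (inferInstance : H.Normal).conj_mem _ (hU (-x)) (mkSL 0 (-1) 1 0 (by ring))
    convert this using 1
    have h1 : (((1 : (ZMod p)ˣ) : ZMod p)) = 1 := rfl
    apply sl_ext <;> simp [bb, mul00, mul01, mul10, mul11, mk00, mk01, mk10, mk11, inv00, inv01, inv10, inv11, h1]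
  have hbig : ∀ g : SL(2, ZMod p), g 1 0 ≠ 0 → g ∈ H := by
    intro g hg
    have : g = bb p (1, (g 0 0 - 1) / g 1 0) * mkSL 1 0 (g 1 0) 1 (by ring) * bb p (1, (g 1 1 - 1) / g 1 0) := by
      have hd := sl_det g
      have h1 : (((1 : (ZMod p)ˣ) : ZMod p)) = 1 := rfl
      have h2 : (((1⁻¹ : (ZMod p)ˣ) : ZMod p)) = 1 := by rw [inv_one]; rfl
      apply sl_ext <;> simp only [bb, mul00, mul01, mul10, mul11, mk00, mk01, mk10, mk11, h1, h2] <;> field_simp <;> try ring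
      linear_combination -hd
    rw [this]
    exact H.mul_mem (H.mul_mem (hU _) (hl _)) (hU _)
  rw [eq_top_iff]
  intro g _
  by_cases hg : g 1 0 = 0
  · have h1 := hl 1
    have h2 : g * mkSL 1 0 1 1 (by ring) ∈ H := by
      apply hbig
      rw [mul10, mk00, mk10, hg]
      have hd := sl_det g
      intro h
      have h11 : g 1 1 = 0 := by linear_combination h
      rw [hg, h11] at hd
      simp at hd
    exact (H.mul_mem_cancel_right h1).mp h2
  · exact hbig g hg

theorem triv_of (hp : p ≠ 2) (ν : ZMod p) (hν : ¬ IsSquare ν) (i) (hb : mm p W i 1 = 0) (hc : mm p W i ν = 0) :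
    ∀ g, W.Φ (δ g) i = 1 := by
  have h0 : ∀ y, y ≠ 0 → W.Φ ((DU p).e y) i = 0 := by
    intro y hy
    rw [← W.rk_eq_zero]
    change mm p W i y = 0
    rcases mm_cases p W hp ν hν i y hy with h | h
    · rw [h.2, hb]
    · rw [h.2, hc]
  have h1 : W.Φ ((DU p).e 0) i = 1 := by
    have := congrArg (fun z => W.Φ z i) (DU p).e_sum
    simp only [map_sum, map_one, Finset.sum_apply, Pi.one_apply] at this
    rw [← this]
    symm
    exact Finset.sum_eq_single 0 (fun y _ hy => h0 y hy) (fun h => absurd (Finset.mem_univ _) h)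
  have hU : ∀ x, W.Φ (δ (bb p (1, x))) i = 1 := by
    intro x
    have := congrArg (fun z => W.Φ z i) ((DU p).n_mul_e 0 x)
    simp only [map_mul, Pi.mul_apply, map_smul, Pi.smul_apply, h1, mul_one, DU_χ, zero_mul,
      AddChar.map_zero_eq_one, one_smul] at this
    exact this
  let H : Subgroup SL(2, ZMod p) :=
    { carrier := {g | W.Φ (δ g) i = 1}
      mul_mem' := by
        intro a b ha hb
        simp only [Set.mem_setOf_eq] at ha hb ⊢
        rw [δ_mul, map_mul, Pi.mul_apply, ha, hb, mul_one]
      one_mem' := by simp only [Set.mem_setOf_eq]; rw [δ_one, map_one, Pi.one_apply]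
      inv_mem' := by
        intro a ha
        simp only [Set.mem_setOf_eq] at ha ⊢
        have : W.Φ (δ (a * a⁻¹)) i = 1 := by rw [mul_inv_cancel, δ_one, map_one, Pi.one_apply]
        rwa [δ_mul, map_mul, Pi.mul_apply, ha, one_mul] at this }
  haveI : H.Normal := by
    constructor
    intro n hn g
    change W.Φ (δ n) i = 1 at hn
    change W.Φ (δ (g * n * g⁻¹)) i = 1
    rw [δ_mul, δ_mul, map_mul, map_mul, Pi.mul_apply, Pi.mul_apply, hn, mul_one, ← Pi.mul_apply, ← map_mul,
      ← δ_mul, mul_inv_cancel, δ_one, map_one, Pi.one_apply]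
  have := gen_U p H hU
  intro g
  have h : g ∈ H := by rw [this]; trivial
  exact h

theorem triv_unique : (∀ i j, (∀ g, W.Φ (δ g) i = 1) → (∀ g, W.Φ (δ g) j = 1) → i = j) ∧
    ∀ i, (∀ g, W.Φ (δ g) i = 1) → W.d i = 1 := by
  obtain ⟨WH⟩ := exists_wed (Unit)
  obtain ⟨f, hf, hd, hr⟩ := W.old_equiv WH (1 : SL(2, ZMod p) →* Unit) (fun x => ⟨1, rfl⟩)
  have hs : ∑ j, WH.d j * WH.d j = 1 := by
    have := WH.sum_tr_mul_d (1 : Unit)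
    simp only [δ_one, WH.tr_one, if_true, Fintype.card_unit] at this
    exact_mod_cast this
  have hdj : ∀ j, WH.d j = 1 := by
    intro j
    have h1 : WH.d j * WH.d j ≤ 1 := hs ▸ Finset.single_le_sum (f := fun j => WH.d j * WH.d j) (fun _ _ => Nat.zero_le _) (Finset.mem_univ j)
    have h2 := (WH.hd j).ne
    nlinarith [Nat.pos_of_ne_zero h2]
  simp_rw [hdj] at hs
  simp at hs
  have hsub : Subsingleton (Fin WH.r) := by rw [hs]; infer_instance
  have key : ∀ i, (∀ g, W.Φ (δ g) i = 1) → ∃ j, f j = i := fun i hi => (hr i).2 (fun g _ => hi g)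
  constructor
  · intro i j hi hj
    obtain ⟨a, rfl⟩ := key i hi
    obtain ⟨b, rfl⟩ := key j hj
    rw [Subsingleton.elim a b]
  · intro i hi
    obtain ⟨a, rfl⟩ := key i hi
    rw [hd, hdj]

theorem AA_triv (i) (hi : ∀ g, W.Φ (δ g) i = 1) (θ : DirichletCharacter ℂ p) [Decidable (θ = 1)] :
    AA p W i θ = if θ = 1 then 1 else 0 := by
  classical
  have hd := (triv_unique p W).2 i hi
  have h : (AA p W i θ : ℂ) = if θ = 1 then 1 else 0 := by
    rw [AA_cast, eB, tr_EE]
    have : ∀ g, W.tr i (δ g) = 1 := by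
      intro g
      rw [W.tr_def, hi, Matrix.trace_one, Fintype.card_fin, hd, Nat.cast_one]
    simp_rw [this, mul_one, aB, Finset.sum_const, Finset.card_univ, ZMod.card, nsmul_eq_mul, ← Finset.mul_sum]
    have h2 : ∑ t : (ZMod p)ˣ, θ ((t⁻¹ : (ZMod p)ˣ) : ZMod p) = ∑ t : (ZMod p)ˣ, θ (t : ZMod p) :=
      Fintype.sum_equiv (Equiv.inv (ZMod p)ˣ) _ _ (fun s => rfl)
    rw [h2, sum_char]
    have := pne p; have := p1ne p
    split_ifs
    · field_simp
    · simp
  split_ifs at h ⊢ <;> exact_mod_cast h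

theorem sum_mm (y z : ZMod p) : ∑ i, mm p W i y * mm p W i z = (p - 1) +
      (Finset.univ.filter fun s : (ZMod p)ˣ => z * (s : ZMod p) ^ 2 = y).card := by
  have := sum_ee p W y z
  simp_rw [← mm_cast] at this
  have h : ((p - 1 : ℕ) : ℂ) = (p : ℂ) - 1 := by rw [Nat.cast_sub hpp.out.one_le, Nat.cast_one]
  rw [← h] at this
  exact_mod_cast this

theorem sum_AAmm (θ) (z : ZMod p) (hz : z ≠ 0) : ∑ i, AA p W i θ * mm p W i z = 1 := by
  have := sum_Be p W θ z hz
  simp_rw [← mm_cast, ← AA_cast] at this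
  exact_mod_cast this

theorem sum_AA (θ θ' : DirichletCharacter ℂ p) [Decidable (θ * θ' = 1)] [Decidable (θ = θ')] :
    ∑ i, AA p W i θ * AA p W i θ' = (if θ * θ' = 1 then 1 else 0) + (if θ = θ' then 1 else 0) := by
  have := sum_BB p W θ θ'
  simp_rw [← AA_cast] at this
  exact_mod_cast this

theorem units_sq (hp : p ≠ 2) [DecidablePred fun s : (ZMod p)ˣ => s * s = 1] :
    (Finset.univ.filter fun s : (ZMod p)ˣ => s * s = 1).card = 2 := by
  classical
  have : (Finset.univ.filter fun s : (ZMod p)ˣ => s * s = 1) = {1, -1} := by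
    ext s
    simp only [Finset.mem_filter, Finset.mem_univ, true_and, Finset.mem_insert, Finset.mem_singleton]
    rw [Units.ext_iff, Units.ext_iff, Units.ext_iff, Units.val_mul, Units.val_neg, Units.val_one, mul_self_eq_one_iff]
  rw [this, Finset.card_pair]
  intro h
  have h2 := congrArg Units.val h
  rw [Units.val_neg, Units.val_one] at h2
  apply two_ne_zero_zmod p hp
  linear_combination h2

theorem sum_mm11 (hp : p ≠ 2) (y : ZMod p) (hy : y ≠ 0) : ∑ i, mm p W i y * mm p W i y = p + 1 := by
  classical
  rw [sum_mm]
  have : (Finset.univ.filter fun s : (ZMod p)ˣ => y * (s : ZMod p) ^ 2 = y) = Finset.univ.filter fun s : (ZMod p)ˣ => s * s = 1 := by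
    refine Finset.filter_congr fun s _ => ?_
    rw [mul_eq_left₀ hy, Units.ext_iff, Units.val_mul, Units.val_one, pow_two]
  rw [this, units_sq p hp]
  have := hpp.out.one_le; omega

theorem sum_mm1ν (ν : ZMod p) (hν : ¬ IsSquare ν) : ∑ i, mm p W i ν * mm p W i 1 = p - 1 := by
  rw [sum_mm, Finset.filter_false_of_mem]
  · simp
  · intro s _ h
    exact hν ⟨s, by rw [← h]; ring⟩

/-- number of quadratic characters -/
theorem card_quad (hp : p ≠ 2) [DecidablePred fun θ : DirichletCharacter ℂ p => θ * θ = 1] :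
    (Finset.univ.filter fun θ : DirichletCharacter ℂ p => θ * θ = 1).card = 2 := by
  classical
  have h : ∑ θ : DirichletCharacter ℂ p, ∑ t : (ZMod p)ˣ, (θ * θ) (t : ZMod p) =
      ∑ t : (ZMod p)ˣ, ∑ θ : DirichletCharacter ℂ p, θ ((t * t : (ZMod p)ˣ) : ZMod p) := by
    rw [Finset.sum_comm]
    refine Finset.sum_congr rfl fun t _ => Finset.sum_congr rfl fun θ _ => ?_
    rw [MulChar.mul_apply, Units.val_mul, map_mul]
  simp_rw [sum_char, sum_chars] at h
  rw [← Finset.sum_filter, ← Finset.sum_filter, Finset.sum_const, Finset.sum_const, nsmul_eq_mul, nsmul_eq_mul,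
    units_sq p hp] at h
  have := mul_right_cancel₀ (p1ne p) h
  convert (show _ = 2 by exact_mod_cast this)

theorem card_chars : Fintype.card (DirichletCharacter ℂ p) = p - 1 := by
  classical
  have := sum_chars p 1
  simp only [Units.val_one, map_one, if_true, Finset.sum_const, nsmul_eq_mul, mul_one] at this
  have h : ((p - 1 : ℕ) : ℂ) = (p : ℂ) - 1 := by rw [Nat.cast_sub hpp.out.one_le, Nat.cast_one]
  rw [← h] at this
  exact_mod_cast this
end SLZeta

namespace SLZeta
variable (p : ℕ) [hpp : Fact p.Prime] (W : Wed SL(2, ZMod p))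

theorem AA_le_one (i θ) : AA p W i θ ≤ 1 := by
  classical
  have h := sum_AA p W θ θ
  have h1 : AA p W i θ * AA p W i θ ≤ ∑ i, AA p W i θ * AA p W i θ :=
    Finset.single_le_sum (f := fun i => AA p W i θ * AA p W i θ) (fun _ _ => Nat.zero_le _) (Finset.mem_univ i)
  rw [h, if_pos rfl] at h1
  split_ifs at h1 <;> nlinarith

theorem AA_inv (i) (θ : DirichletCharacter ℂ p) : AA p W i θ⁻¹ = AA p W i θ := by
  classical
  by_cases hθ : θ * θ = 1
  · rw [inv_eq_of_mul_eq_one_right hθ]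
  have h1 := sum_AA p W θ θ
  have h2 := sum_AA p W θ θ⁻¹
  have h3 := sum_AA p W θ⁻¹ θ⁻¹
  rw [if_neg hθ, if_pos rfl] at h1
  rw [if_pos (mul_inv_cancel θ), if_neg (fun h => hθ (by nth_rewrite 1 [h]; exact inv_mul_cancel θ))] at h2
  rw [if_neg (fun h => hθ (by rw [← mul_inv, inv_eq_one] at h; exact h)), if_pos rfl] at h3
  have h : ∑ i, ((AA p W i θ : ℤ) - AA p W i θ⁻¹) ^ 2 = 0 := by
    have e : ∀ i, ((AA p W i θ : ℤ) - AA p W i θ⁻¹) ^ 2 = ((AA p W i θ * AA p W i θ : ℕ) : ℤ) -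
        2 * ((AA p W i θ * AA p W i θ⁻¹ : ℕ) : ℤ) + ((AA p W i θ⁻¹ * AA p W i θ⁻¹ : ℕ) : ℤ) := by
      intro i; push_cast; ring
    simp_rw [e, Finset.sum_add_distrib, Finset.sum_sub_distrib, ← Finset.mul_sum, ← Nat.cast_sum, h1, h2, h3]
    norm_num
  have := (Finset.sum_eq_zero_iff_of_nonneg (fun i _ => sq_nonneg _)).mp h i (Finset.mem_univ i)
  have := pow_eq_zero_iff (two_ne_zero) |>.mp this
  omega

theorem AA_ne (i) (θ θ' : DirichletCharacter ℂ p) (h : AA p W i θ ≠ 0) (h' : AA p W i θ' ≠ 0) : θ' = θ ∨ θ' = θ⁻¹ := by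
  classical
  by_contra hc
  push Not at hc
  have h1 := sum_AA p W θ θ'
  rw [if_neg (fun h => hc.2 (eq_inv_of_mul_eq_one_right h)), if_neg (fun h => hc.1 h.symm)] at h1
  have := Finset.sum_eq_zero_iff.mp h1 i (Finset.mem_univ i)
  exact mul_ne_zero h h' this

open Classical in
/-- weights -/
noncomputable def wt (F : ℕ → ℝ) (c : ℕ) (θ : DirichletCharacter ℂ p) : ℝ :=
  if θ * θ = 1 then F (c + 1) - F c else (F (c + 2) - F c) / 2

theorem F_sum (F : ℕ → ℝ) (c : ℕ) (i) :
    F (c + mm p W i 0) = F c + ∑ θ, (AA p W i θ : ℝ) * wt p F c θ := by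
  classical
  rw [mm_zero]
  by_cases h : ∀ θ, AA p W i θ = 0
  · simp [h]
  push Not at h
  obtain ⟨θ, hθ⟩ := h
  have h1 : AA p W i θ = 1 := by have := AA_le_one p W i θ; omega
  have h1' : AA p W i θ⁻¹ = 1 := by rw [AA_inv, h1]
  have hs : ∀ g : DirichletCharacter ℂ p → ℝ, ∑ θ, (AA p W i θ : ℝ) * g θ =
      ∑ θ' ∈ {θ, θ⁻¹}, g θ' := by
    intro g
    rw [← Finset.sum_subset (Finset.subset_univ {θ, θ⁻¹})]
    · refine Finset.sum_congr rfl fun θ' hθ' => ?_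
      rw [Finset.mem_insert, Finset.mem_singleton] at hθ'
      rcases hθ' with rfl | rfl
      · rw [h1]; simp
      · rw [h1']; simp
    · intro θ' _ hθ'
      rw [Finset.mem_insert, Finset.mem_singleton] at hθ'
      have : AA p W i θ' = 0 := by
        by_contra hne
        exact hθ' (AA_ne p W i θ θ' hθ hne)
      rw [this]; simp
  have hn := hs (fun _ => 1)
  rw [hs]
  simp only [mul_one] at hn
  rw [← Nat.cast_sum] at hn
  by_cases hq : θ * θ = 1
  · have e : θ⁻¹ = θ := inv_eq_of_mul_eq_one_right hq
    rw [e, Finset.pair_eq_singleton, Finset.sum_singleton] at hn ⊢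
    have hn' : ∑ i_1, AA p W i i_1 = 1 := by exact_mod_cast hn
    rw [hn', wt, if_pos hq]; ring
  · have e : θ ≠ θ⁻¹ := fun h => hq (by nth_rewrite 1 [h]; exact inv_mul_cancel θ)
    rw [Finset.sum_pair e] at hn ⊢
    have hn' : ∑ i_1, AA p W i i_1 = 2 := by
      have : ((∑ i_1, AA p W i i_1 : ℕ) : ℝ) = ((2 : ℕ) : ℝ) := by rw [hn]; norm_num
      exact_mod_cast this
    rw [hn', wt, wt, if_neg hq, if_neg (fun h => hq (by rw [← mul_inv, inv_eq_one] at h; exact h))]; ring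

theorem quad_form (b c : ℕ) (h : (b : ℤ) ^ 2 + c ^ 2 - b * c = 1) :
    (b = 1 ∧ c = 1) ∨ (b = 1 ∧ c = 0) ∨ (b = 0 ∧ c = 1) := by
  have hb : b ≤ 1 := by
    by_contra hb
    push Not at hb
    have : (2 : ℤ) ≤ b := by exact_mod_cast hb
    nlinarith [sq_nonneg (2 * (c : ℤ) - b)]
  have hc : c ≤ 1 := by
    by_contra hb
    push Not at hb
    have : (2 : ℤ) ≤ c := by exact_mod_cast hb
    nlinarith [sq_nonneg (2 * (b : ℤ) - c)]
  interval_cases b <;> interval_cases c <;> simp_all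

theorem quad_pos (b c : ℕ) (h : ¬ (b = 0 ∧ c = 0)) : 1 ≤ (b : ℤ) ^ 2 + c ^ 2 - b * c := by
  by_contra hc
  push Not at hc
  have hb : (b : ℤ) = 0 := by
    have : (b:ℤ)^2 ≤ 0 := by nlinarith [sq_nonneg (2 * (c : ℤ) - b)]
    exact pow_eq_zero_iff two_ne_zero |>.mp (le_antisymm this (sq_nonneg _))
  have hc : (c : ℤ) = 0 := by
    have : (c:ℤ)^2 ≤ 0 := by nlinarith [sq_nonneg (2 * (b : ℤ) - c)]
    exact pow_eq_zero_iff two_ne_zero |>.mp (le_antisymm this (sq_nonneg _))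
  exact h ⟨by exact_mod_cast hb, by exact_mod_cast hc⟩

theorem lvl1 (hp : p ≠ 2) : W.r ≤ p + 4 ∧ (p + 4 ≤ W.r → ∀ F : ℕ → ℝ, ∑ i, F (W.d i) =
    F 1 + F p + ((p : ℝ) - 3) / 2 * F (p + 1) + ((p : ℝ) - 1) / 2 * F (p - 1) + 2 * F ((p + 1) / 2) +
      2 * F ((p - 1) / 2)) := by
  classical
  obtain ⟨ν, hν⟩ := exists_nonsquare p hp
  have hν0 : ν ≠ 0 := by rintro rfl; exact hν ⟨0, by simp⟩
  have hp1 := hpp.out.one_le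
  have hp2 := hpp.out.two_le
  have hodd : p % 2 = 1 := by
    rcases hpp.out.eq_two_or_odd with h | h
    · exact absurd h hp
    · exact h
  set b : Fin W.r → ℕ := fun i => mm p W i 1 with hb
  set c : Fin W.r → ℕ := fun i => mm p W i ν with hc
  have Sbb : ∑ i, b i * b i = p + 1 := sum_mm11 p W hp 1 one_ne_zero
  have Scc : ∑ i, c i * c i = p + 1 := sum_mm11 p W hp ν hν0
  have Scb : ∑ i, c i * b i = p - 1 := sum_mm1ν p W ν hν
  set N0 := Finset.univ.filter fun i => b i = 0 ∧ c i = 0 with hN0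
  have hN0c : N0.card ≤ 1 := by
    rw [Finset.card_le_one]
    intro i hi j hj
    simp only [hN0, Finset.mem_filter, Finset.mem_univ, true_and] at hi hj
    exact (triv_unique p W).1 i j (triv_of p W hp ν hν i hi.1 hi.2) (triv_of p W hp ν hν j hj.1 hj.2)
  have Sf : ∑ i, ((b i : ℤ) ^ 2 + c i ^ 2 - b i * c i) = p + 3 := by
    have e : ∀ i, ((b i : ℤ) ^ 2 + c i ^ 2 - b i * c i) = ((b i * b i : ℕ) : ℤ) + ((c i * c i : ℕ) : ℤ) - ((c i * b i : ℕ) : ℤ) := by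
      intro i; push_cast; ring
    simp_rw [e, Finset.sum_sub_distrib, Finset.sum_add_distrib, ← Nat.cast_sum, Sbb, Scc, Scb]
    push_cast [hp1]; ring
  have hle : ∀ i ∈ Finset.univ, (if i ∈ N0 then 0 else 1 : ℤ) ≤ (b i : ℤ) ^ 2 + c i ^ 2 - b i * c i := by
    intro i _
    by_cases hi : i ∈ N0
    · simp only [hN0, Finset.mem_filter, Finset.mem_univ, true_and] at hi
      rw [hi.1, hi.2]; split_ifs <;> simp_all
    · rw [if_neg hi]
      apply quad_pos
      simpa [hN0] using hi
  have hcard : ∑ i, (if i ∈ N0 then 0 else 1 : ℤ) = W.r - N0.card := by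
    have : ∀ i, (if i ∈ N0 then 0 else 1 : ℤ) = 1 - if i ∈ N0 then 1 else 0 := by intro i; split_ifs <;> simp
    simp_rw [this, Finset.sum_sub_distrib]
    simp
  have hsum := Finset.sum_le_sum hle
  rw [hcard, Sf] at hsum
  refine ⟨by omega, fun hr F => ?_⟩
  have hN1 : N0.card = 1 := by omega
  obtain ⟨i0, hi0⟩ := Finset.card_eq_one.mp hN1
  have heq : ∑ i, (if i ∈ N0 then 0 else 1 : ℤ) = ∑ i, ((b i : ℤ) ^ 2 + c i ^ 2 - b i * c i) := by
    rw [hcard, Sf]; omega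
  have hpt := (Finset.sum_eq_sum_iff_of_le hle).mp heq
  have hi0' : b i0 = 0 ∧ c i0 = 0 := by
    have : i0 ∈ N0 := by rw [hi0]; simp
    simpa [hN0] using this
  have htriv := triv_of p W hp ν hν i0 hi0'.1 hi0'.2
  have cases : ∀ i, (i = i0 ∧ b i = 0 ∧ c i = 0) ∨ (i ≠ i0 ∧ ((b i = 1 ∧ c i = 1) ∨ (b i = 1 ∧ c i = 0) ∨ (b i = 0 ∧ c i = 1))) := by
    intro i
    by_cases hi : i = i0
    · left; subst hi; exact ⟨rfl, hi0'⟩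
    · right
      refine ⟨hi, quad_form _ _ ?_⟩
      rw [← hpt i (Finset.mem_univ i), if_neg]
      rw [hi0]; simpa using hi
  -- real-valued versions
  have Rbb : ∑ i, (b i : ℝ) * b i = p + 1 := by exact_mod_cast Sbb
  have Rcc : ∑ i, (c i : ℝ) * c i = p + 1 := by exact_mod_cast Scc
  have Rcb : ∑ i, (c i : ℝ) * b i = p - 1 := by
    have : ((∑ i, c i * b i : ℕ) : ℝ) = ((p - 1 : ℕ) : ℝ) := by rw [Scb]
    push_cast [hp1] at this; exact this
  have R0 : ∀ g : Fin W.r → ℝ, ∑ i, (1 - (b i : ℝ)) * (1 - c i) * g i = g i0 := by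
    intro g
    rw [Finset.sum_eq_single i0]
    · rw [hi0'.1, hi0'.2]; simp
    · intro i _ hi
      rcases cases i with h | ⟨_, ⟨h1, h2⟩ | ⟨h1, h2⟩ | ⟨h1, h2⟩⟩
      · exact absurd h.1 hi
      all_goals rw [h1, h2]; simp
    · simp
  set u : DirichletCharacter ℂ p → ℝ := fun θ => ∑ i, (c i : ℝ) * b i * AA p W i θ with hu
  have hAb : ∀ θ, ∑ i, (AA p W i θ : ℝ) * b i = 1 := fun θ => by exact_mod_cast sum_AAmm p W θ 1 one_ne_zero
  have hAc : ∀ θ, ∑ i, (AA p W i θ : ℝ) * c i = 1 := fun θ => by exact_mod_cast sum_AAmm p W θ ν hν0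
  have hu1 : ∀ θ, u θ = 1 + (if θ = 1 then 1 else 0) - (if θ * θ = 1 then 1 else 0) := by
    intro θ
    have h1 := R0 (fun i => AA p W i θ)
    have h2 := AA_triv p W i0 htriv θ
    have h3 : ∑ i, (AA p W i θ : ℝ) = (if θ * θ = 1 then 1 else 0) + 1 := by
      have h4 := sum_AA p W θ θ
      rw [if_pos (rfl : θ = θ)] at h4
      have h5 : ∀ i, AA p W i θ * AA p W i θ = AA p W i θ := by
        intro i
        have := AA_le_one p W i θ
        interval_cases AA p W i θ <;> rfl
      simp_rw [h5] at h4
      rw [← Nat.cast_sum, h4]; push_cast; split_ifs <;> simp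
    have e : ∀ i, (1 - (b i : ℝ)) * (1 - c i) * AA p W i θ = AA p W i θ - AA p W i θ * b i - AA p W i θ * c i + c i * b i * AA p W i θ := by
      intro i; ring
    simp_rw [e, Finset.sum_add_distrib, Finset.sum_sub_distrib, h3, hAb, hAc] at h1
    have h2' : (AA p W i0 θ : ℝ) = if θ = 1 then 1 else 0 := by rw [h2]; split_ifs <;> simp
    rw [h2'] at h1
    change _ + u θ = _ at h1
    linarith
  have hv : ∀ θ, ∑ i, ((b i : ℝ) * b i + c i * c i - 2 * (c i * b i)) * AA p W i θ = 2 - 2 * u θ := by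
    intro θ
    have e : ∀ i, ((b i : ℝ) * b i + c i * c i - 2 * (c i * b i)) * AA p W i θ = AA p W i θ * b i + AA p W i θ * c i - 2 * (c i * b i * AA p W i θ) := by
      intro i
      rcases cases i with ⟨_, h1, h2⟩ | ⟨_, ⟨h1, h2⟩ | ⟨h1, h2⟩ | ⟨h1, h2⟩⟩ <;> rw [h1, h2] <;> push_cast <;> ring
    simp_rw [e, Finset.sum_sub_distrib, Finset.sum_add_distrib, hAb, hAc, ← Finset.mul_sum]
    change _ - 2 * u θ = _
    ring
  have hF : ∀ i, F (W.d i) = (1 - (b i : ℝ)) * (1 - c i) * F 1 +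
      ((c i : ℝ) * b i * F (p - 1) + ∑ θ, wt p F (p - 1) θ * ((c i : ℝ) * b i * AA p W i θ)) +
      (((b i : ℝ) * b i + c i * c i - 2 * (c i * b i)) * F ((p - 1) / 2) +
        ∑ θ, wt p F ((p - 1) / 2) θ * (((b i : ℝ) * b i + c i * c i - 2 * (c i * b i)) * AA p W i θ)) := by
    intro i
    have hd : W.d i = (p - 1) / 2 * (b i + c i) + mm p W i 0 := by rw [two_d p W hp ν hν i]; ring
    rcases cases i with ⟨h0, h1, h2⟩ | ⟨_, ⟨h1, h2⟩ | ⟨h1, h2⟩ | ⟨h1, h2⟩⟩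
    · have : W.d i = 1 := by rw [h0]; exact (triv_unique p W).2 i0 htriv
      rw [this, h1, h2]; simp
    · have e : (p - 1) / 2 * (1 + 1) = p - 1 := by omega
      rw [hd, h1, h2, e, F_sum p W F]; have h9 : (1:ℝ) + 1 - 2 = 0 := by norm_num
      simp [mul_comm, h9]
    · have e : (p - 1) / 2 * (1 + 0) = (p - 1) / 2 := by omega
      rw [hd, h1, h2, e, F_sum p W F]; simp [mul_comm]
    · have e : (p - 1) / 2 * (0 + 1) = (p - 1) / 2 := by omega
      rw [hd, h1, h2, e, F_sum p W F]; simp [mul_comm]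
  have hs : ∑ i, F (W.d i) = F 1 + (((p : ℝ) - 1) * F (p - 1) + ∑ θ, wt p F (p - 1) θ * u θ) +
      (4 * F ((p - 1) / 2) + ∑ θ, wt p F ((p - 1) / 2) θ * (2 - 2 * u θ)) := by
    simp_rw [hF, Finset.sum_add_distrib]
    rw [R0 (fun _ => F 1), ← Finset.sum_mul, Rcb, ← Finset.sum_mul, Finset.sum_sub_distrib, Finset.sum_add_distrib,
      ← Finset.mul_sum, Rcb, Rbb, Rcc, Finset.sum_comm, Finset.sum_comm (s := (Finset.univ : Finset (Fin W.r)))]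
    simp_rw [← Finset.mul_sum, hv]
    congr 2
    congr 1
    ring
  have hQ : ∑ θ : DirichletCharacter ℂ p, (if θ * θ = 1 then (1 : ℝ) else 0) = 2 := by
    rw [Finset.sum_boole, card_quad p hp]; norm_num
  have hC : ∑ θ : DirichletCharacter ℂ p, (1 : ℝ) = p - 1 := by
    rw [Finset.sum_const, Finset.card_univ, card_chars, nsmul_eq_mul, mul_one]; push_cast [hp1]; ring
  have hO : ∑ θ : DirichletCharacter ℂ p, (if θ = 1 then (1 : ℝ) else 0) = 1 := by simp
  have hw1 : ∑ θ, wt p F (p - 1) θ * u θ = ((p : ℝ) - 3) * ((F (p + 1) - F (p - 1)) / 2) + (F p - F (p - 1)) := by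
    have e1 : p - 1 + 1 = p := by omega
    have e2 : p - 1 + 2 = p + 1 := by omega
    have e : ∀ θ, wt p F (p - 1) θ * u θ = (F (p + 1) - F (p - 1)) / 2 * (1 - if θ * θ = 1 then 1 else 0) + (F p - F (p - 1)) * if θ = 1 then 1 else 0 := by
      intro θ
      rw [hu1, wt, e1, e2]
      by_cases h1 : θ = 1
      · subst h1; simp
      · rw [if_neg h1]; split_ifs <;> ring
    simp_rw [e, Finset.sum_add_distrib, ← Finset.mul_sum, Finset.sum_sub_distrib, hQ, hC, hO]
    ring
  have hw2 : ∑ θ, wt p F ((p - 1) / 2) θ * (2 - 2 * u θ) = 2 * (F ((p + 1) / 2) - F ((p - 1) / 2)) := by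
    have e1 : (p - 1) / 2 + 1 = (p + 1) / 2 := by omega
    have e : ∀ θ, wt p F ((p - 1) / 2) θ * (2 - 2 * u θ) = 2 * (F ((p + 1) / 2) - F ((p - 1) / 2)) * ((if θ * θ = 1 then 1 else 0) - if θ = 1 then 1 else 0) := by
      intro θ
      rw [hu1, wt, e1]
      by_cases h1 : θ = 1
      · subst h1; simp
      · rw [if_neg h1]; split_ifs <;> ring
    simp_rw [e, ← Finset.mul_sum, Finset.sum_sub_distrib, hQ, hO]
    ring
  rw [hs, hw1, hw2]
  ring

end SLZeta

namespace SLZeta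
variable (p : ℕ) [hpp : Fact p.Prime]

theorem lvl1G (hp : p ≠ 2) (W : Wed (Gk p 0)) : W.r ≤ p + 4 ∧ (p + 4 ≤ W.r → ∀ F : ℕ → ℝ, ∑ i, F (W.d i) =
    F 1 + F p + ((p : ℝ) - 3) / 2 * F (p + 1) + ((p : ℝ) - 1) / 2 * F (p - 1) + 2 * F ((p + 1) / 2) +
      2 * F ((p - 1) / 2)) := by
  obtain ⟨WH⟩ := exists_wed SL(2, ZMod p)
  obtain ⟨f, hf, hd, hr⟩ := W.old_equiv WH (redG p 0) (redG_bij p).2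
  have hs : Function.Surjective f := by
    intro i
    refine (hr i).2 fun g hg => ?_
    have : g = 1 := (redG_bij p).1 (by rw [hg, map_one])
    rw [this, map_one, map_one, Pi.one_apply]
  let e := Equiv.ofBijective f ⟨hf, hs⟩
  have hrr : WH.r = W.r := by simpa using Fintype.card_congr e
  have hsum : ∀ F : ℕ → ℝ, ∑ i, F (W.d i) = ∑ j, F (WH.d j) := by
    intro F
    symm
    refine Fintype.sum_equiv e _ _ fun j => ?_
    change _ = F (W.d (f j))
    rw [hd]
  have := lvl1 p WH hp
  refine ⟨hrr ▸ this.1, fun h F => ?_⟩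
  rw [hsum, this.2 (h.trans hrr.ge) F]

/-- contribution of level one -/
noncomputable def base (F : ℕ → ℝ) : ℝ :=
  F 1 + F p + ((p : ℝ) - 3) / 2 * F (p + 1) + ((p : ℝ) - 1) / 2 * F (p - 1) + 2 * F ((p + 1) / 2) +
      2 * F ((p - 1) / 2)

/-- contribution of the step from level `k` to level `k+1` -/
noncomputable def step (F : ℕ → ℝ) (k : ℕ) : ℝ :=
  4 * p * (p:ℝ) ^ k * F ((p ^ 2 - 1) / 2 * p ^ k) + ((p:ℝ) - 1) ^ 2 / 2 * (p:ℝ) ^ k * F (p * (p + 1) * p ^ k)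
      + ((p:ℝ) ^ 2 - 1) / 2 * (p:ℝ) ^ k * F (p * (p - 1) * p ^ k)

theorem all_levels (hp : p ≠ 2) (k : ℕ) : ∀ W : Wed (Gk p k), W.r ≤ kap p k ∧
    ∀ F : ℕ → ℝ, ∑ i, F (W.d i) = base p F + ∑ j ∈ Finset.range k, step p F j := by
  induction k with
  | zero =>
    intro W
    have h := kap_le p hp 0 W
    have h1 := lvl1G p hp W
    have hk : kap p 0 = p + 4 := by simp [kap]
    rw [hk] at h ⊢
    refine ⟨h1.1, fun F => ?_⟩
    rw [h1.2 h F]; simp [base]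
  | succ k ih =>
    intro W
    obtain ⟨W'⟩ := exists_wed (Gk p k)
    have h := kap_le p hp (k + 1) W
    have hk : kap p (k + 1) = kap p k + p ^ k * (p ^ 2 + 3 * p) := by
      unfold kap; rw [Finset.sum_range_succ]; ring
    obtain ⟨h1, h2⟩ := new_bound p hp k W
    obtain ⟨h3, h4⟩ := ih W'
    have h5 := sum_succ p hp k W W' (fun _ => 1)
    simp only [Finset.sum_const, Finset.card_univ, Fintype.card_fin, nsmul_eq_mul, mul_one] at h5
    have h5' : W.r = W'.r + ((sysk p hp k).new W 0).card := by exact_mod_cast h5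
    have h1' : ((sysk p hp k).new W 0).card ≤ p ^ k * (p ^ 2 + 3 * p) := by exact_mod_cast h1
    have heq : ((sysk p hp k).new W 0).card = p ^ k * (p ^ 2 + 3 * p) := by omega
    refine ⟨by omega, fun F => ?_⟩
    rw [sum_succ p hp k W W' F, h4, h2 (by exact_mod_cast heq) F, Finset.sum_range_succ, add_assoc]
    rfl

end SLZeta

/-! ### Part T: continuous representations of `SL₂(ℤ_p)` -/
namespace SLZeta
variable (p : ℕ) [hpp : Fact p.Prime]

theorem no_small {Γ : Type*} [Group Γ] (N : Subgroup Γ) {n : ℕ} (ρ : Γ →* GL (Fin n) ℂ)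
    (h : ∀ g ∈ N, ∀ i j, ‖((ρ g : Matrix (Fin n) (Fin n) ℂ) - 1) i j‖ ≤ 1 / (2 * (n + 1))) :
    ∀ g ∈ N, ρ g = 1 := by
  set c : ℝ := 1 / (2 * (n + 1)) with hc
  have hnc : (n : ℝ) * c ≤ 1 / 2 := by
    rw [hc, mul_one_div, div_le_div_iff₀ (by positivity) (by positivity)]; linarith
  have key : ∀ m : ℕ, ∀ g ∈ N, ∀ i j,
      ‖((ρ g : Matrix (Fin n) (Fin n) ℂ) - 1) i j‖ ≤ (3 / 4) ^ m * c := by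
    intro m
    induction m with
    | zero => simpa using h
    | succ m ih =>
      intro g hg i j
      set x : Matrix (Fin n) (Fin n) ℂ := (ρ g : Matrix (Fin n) (Fin n) ℂ) - 1 with hx
      have h1 := ih (g * g) (N.mul_mem hg hg) i j
      have h2 : ((ρ (g * g) : GL (Fin n) ℂ) : Matrix (Fin n) (Fin n) ℂ) - 1 = x + x + x * x := by
        rw [map_mul, Units.val_mul, hx]; noncomm_ring
      rw [h2] at h1
      have h3 : ‖(x * x) i j‖ ≤ n * ((3 / 4) ^ m * c * c) := by
        rw [Matrix.mul_apply]
        refine (norm_sum_le _ _).trans ?_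
        have : ∀ k ∈ Finset.univ, ‖x i k * x k j‖ ≤ (3 / 4) ^ m * c * c := fun k _ => by
          rw [norm_mul]
          exact mul_le_mul (ih g hg i k) (h g hg k j) (norm_nonneg _) (by positivity)
        refine (Finset.sum_le_sum this).trans ?_
        simp
      have h4 : ‖x i j + x i j‖ ≤ ‖(x + x + x * x) i j‖ + ‖(x * x) i j‖ := by
        have : x i j + x i j = (x + x + x * x) i j - (x * x) i j := by simp [Matrix.add_apply]
        rw [this]; exact norm_sub_le _ _
      have h5 : ‖x i j + x i j‖ = 2 * ‖x i j‖ := by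
        rw [← two_mul, norm_mul]; simp
      have h6 : n * ((3 / 4) ^ m * c * c) ≤ (1 / 2) * ((3 / 4 : ℝ) ^ m * c) := by
        calc n * ((3 / 4) ^ m * c * c) = (n * c) * ((3 / 4 : ℝ) ^ m * c) := by ring
          _ ≤ _ := mul_le_mul_of_nonneg_right hnc (by positivity)
      rw [pow_succ]
      linarith
  intro g hg
  apply Units.ext
  ext i j
  have hz : ‖((ρ g : Matrix (Fin n) (Fin n) ℂ) - 1) i j‖ ≤ 0 := by
    refine ge_of_tendsto' (x := Filter.atTop) (f := fun m : ℕ => (3 / 4 : ℝ) ^ m * c) ?_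
      (fun m => key m g hg i j)
    have := (tendsto_pow_atTop_nhds_zero_of_lt_one (r := (3 / 4 : ℝ)) (by norm_num) (by norm_num)).mul_const c
    simpa using this
  have := norm_le_zero_iff.mp hz
  rw [Matrix.sub_apply, sub_eq_zero] at this
  simpa using this

/-- reduction modulo `p^(k+1)` -/
noncomputable def pik (k : ℕ) : SL(2, ℤ_[p]) →* Gk p k :=
  Matrix.SpecialLinearGroup.map (PadicInt.toZModPow (p := p) (k + 1))

theorem pik_surj (k) : Function.Surjective (pik p k) := map_surj _ (toZModPow_surj p _)

theorem dnG_pik (k) (g) : dnG p k (pik p (k + 1) g) = pik p k g := by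
  apply Matrix.SpecialLinearGroup.ext
  intro i j
  rw [dnG_ij]
  change dn p k (PadicInt.toZModPow (k + 1 + 1) (g i j)) = PadicInt.toZModPow (k + 1) (g i j)
  have : (dn p k).comp (PadicInt.toZModPow (p := p) (k + 1 + 1)) = PadicInt.toZModPow (k + 1) :=
    PadicInt.zmod_cast_comp_toZModPow (k + 1) (k + 2) (Nat.le_succ _)
  exact DFunLike.congr_fun this _

theorem toZModPow_eq_iff (k : ℕ) (x y : ℤ_[p]) :
    PadicInt.toZModPow k x = PadicInt.toZModPow k y ↔ ‖x - y‖ ≤ (p : ℝ) ^ (-k : ℤ) := by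
  rw [PadicInt.norm_le_pow_iff_mem_span_pow, ← PadicInt.ker_toZModPow, RingHom.mem_ker, map_sub, sub_eq_zero]

theorem val_cont : Continuous fun g : SL(2, ℤ_[p]) => (g : Matrix (Fin 2) (Fin 2) ℤ_[p]) :=
  continuous_subtype_val

theorem ent_cont (i j) : Continuous fun g : SL(2, ℤ_[p]) => g i j :=
  (continuous_apply_apply i j).comp (val_cont p)

theorem pik_cont (k) (g₀ : SL(2, ℤ_[p])) : ∀ᶠ g in nhds g₀, pik p k g = pik p k g₀ := by
  have h : ∀ i j, ∀ᶠ g : SL(2, ℤ_[p]) in nhds g₀,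
      PadicInt.toZModPow (k + 1) (g i j) = PadicInt.toZModPow (k + 1) (g₀ i j) := by
    intro i j
    have hpos : (0 : ℝ) < (p : ℝ) ^ (-((k + 1 : ℕ) : ℤ)) := zpow_pos (by exact_mod_cast hpp.out.pos) _
    have := ((ent_cont p i j).tendsto g₀).eventually (Metric.ball_mem_nhds _ hpos)
    filter_upwards [this] with g hg
    rw [toZModPow_eq_iff]
    rw [dist_eq_norm] at hg
    exact hg.le
  have h' := Filter.eventually_all.mpr fun i => Filter.eventually_all.mpr (h i)
  filter_upwards [h'] with g hg
  apply Matrix.SpecialLinearGroup.ext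
  intro i j
  exact hg i j

theorem cont_comp (k) {n : ℕ} (ρ : Gk p k →* GL (Fin n) ℂ) : RepContinuous (ρ.comp (pik p k)) := by
  unfold RepContinuous
  rw [continuous_iff_continuousAt]
  intro g₀
  refine (continuousAt_const (y := ((ρ.comp (pik p k) g₀ : GL (Fin n) ℂ) : Matrix (Fin n) (Fin n) ℂ))).congr ?_
  filter_upwards [pik_cont p k g₀] with g hg
  rw [MonoidHom.comp_apply, MonoidHom.comp_apply, hg]

theorem exists_level {n : ℕ} (ρ : SL(2, ℤ_[p]) →* GL (Fin n) ℂ) (h : RepContinuous ρ) :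
    ∃ k, ∀ g, pik p k g = 1 → ρ g = 1 := by
  by_contra! hcon
  have h1 : ∀ k, ∃ g : SL(2, ℤ_[p]), pik p k g = 1 ∧
      ¬ ∀ i j, ‖((ρ g : Matrix (Fin n) (Fin n) ℂ) - 1) i j‖ ≤ 1 / (2 * (n + 1)) := by
    intro k
    by_contra! hc
    obtain ⟨g, hg, hg'⟩ := hcon k
    exact hg' (no_small (pik p k).ker ρ (fun g hg => hc g hg) g hg)
  choose g hg hng using h1
  have hlim : Filter.Tendsto g Filter.atTop (nhds 1) := by
    have : Filter.Tendsto (fun k => (g k : Matrix (Fin 2) (Fin 2) ℤ_[p])) Filter.atTop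
        (nhds ((1 : SL(2, ℤ_[p])) : Matrix (Fin 2) (Fin 2) ℤ_[p])) := by
      refine tendsto_pi_nhds.mpr fun i => tendsto_pi_nhds.mpr fun j => ?_
      rw [tendsto_iff_norm_sub_tendsto_zero]
      refine squeeze_zero (g := fun k : ℕ => ((p : ℝ)⁻¹) ^ (k + 1)) (fun _ => norm_nonneg _) (fun k => ?_) ?_
      · have h2 : pik p k (g k) = pik p k 1 := by rw [hg, map_one]
        have h3 : PadicInt.toZModPow (k + 1) (g k i j) = PadicInt.toZModPow (k + 1) ((1 : SL(2, ℤ_[p])) i j) := by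
          have := congrArg (fun A : Gk p k => A i j) h2
          exact this
        rw [toZModPow_eq_iff] at h3
        refine h3.trans (le_of_eq ?_)
        rw [zpow_neg, zpow_natCast, inv_pow]
      · have hp1 : (1 : ℝ) < p := by exact_mod_cast hpp.out.one_lt
        exact (tendsto_pow_atTop_nhds_zero_of_lt_one (by positivity) (inv_lt_one_of_one_lt₀ hp1)).comp
          (Filter.tendsto_add_atTop_nat 1)
    exact tendsto_subtype_rng.mpr this
  have h4 : ∀ᶠ x : SL(2, ℤ_[p]) in nhds 1, ∀ i j,
      ‖((ρ x : Matrix (Fin n) (Fin n) ℂ) - 1) i j‖ ≤ 1 / (2 * (n + 1)) := by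
    refine Filter.eventually_all.mpr fun i => Filter.eventually_all.mpr fun j => ?_
    have hcont : Continuous fun x : SL(2, ℤ_[p]) => ‖((ρ x : Matrix (Fin n) (Fin n) ℂ) - 1) i j‖ :=
      (((continuous_apply_apply i j).comp h).sub continuous_const).norm
    have h5 := hcont.tendsto 1
    have h6 : ‖((ρ (1 : SL(2, ℤ_[p])) : Matrix (Fin n) (Fin n) ℂ) - 1) i j‖ < 1 / (2 * ((n : ℝ) + 1)) := by
      rw [map_one]; simp; positivity
    filter_upwards [h5.eventually (gt_mem_nhds h6)] with x hx using hx.le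
  obtain ⟨k, hk⟩ := (hlim.eventually h4).exists
  exact hng k hk

theorem descend (hp : p ≠ 2) (k : ℕ) {n : ℕ} (hn : n < p ^ k) (ρ : SL(2, ℤ_[p]) →* GL (Fin n) ℂ)
    (hI : RepIsIrreducible ρ) (h : ∀ g, pik p (k + 1) g = 1 → ρ g = 1) : ∀ g, pik p k g = 1 → ρ g = 1 := by
  obtain ⟨ρ', rfl⟩ := factor_of_trivial _ (pik_surj p (k + 1)) ρ h
  rw [irr_comp_iff _ (pik_surj p (k + 1))] at hI
  obtain ⟨W⟩ := exists_wed (Gk p (k + 1))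
  obtain ⟨i, hi⟩ := W.exists_corr hI
  have hd := hi.dim_eq
  have hnew : i ∉ (sysk p hp k).new W 0 := fun hc => by
    have := new_dim p hp k W i hc
    omega
  rw [new_iff] at hnew
  obtain ⟨L, hL⟩ := hi
  intro g hg
  have h1 := hnew (pik p (k + 1) g) (by rw [dnG_pik, hg])
  apply Units.ext
  apply Matrix.mulVec_injective
  funext v
  obtain ⟨u, rfl⟩ := L.surjective v
  have h2 := hL (pik p (k + 1) g) u
  rw [MonoidHom.id_apply] at h2
  rw [MonoidHom.comp_apply, ← h2]
  change L ((W.Φ (δ _) i).mulVec u) = _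
  rw [h1, Matrix.one_mulVec, Units.val_one, Matrix.one_mulVec]

theorem factor_level (hp : p ≠ 2) (k : ℕ) {n : ℕ} (hn : n < p ^ k) (ρ : SL(2, ℤ_[p]) →* GL (Fin n) ℂ)
    (hc : RepContinuous ρ) (hI : RepIsIrreducible ρ) : ∀ g, pik p k g = 1 → ρ g = 1 := by
  obtain ⟨l, hl⟩ := exists_level p ρ hc
  have up : ∀ j, (∀ g, pik p j g = 1 → ρ g = 1) → (∀ g, pik p (j + 1) g = 1 → ρ g = 1) := by
    intro j hj g hg
    exact hj g (by rw [← dnG_pik, hg, map_one])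
  have hup : ∀ m, ∀ g, pik p (l + m) g = 1 → ρ g = 1 := by
    intro m
    induction m with
    | zero => exact hl
    | succ m ih => exact up _ ih
  have hdown : ∀ m, (∀ g, pik p (k + m) g = 1 → ρ g = 1) → ∀ g, pik p k g = 1 → ρ g = 1 := by
    intro m
    induction m with
    | zero => exact id
    | succ m ih =>
      intro h
      exact ih (descend p hp (k + m) (hn.trans_le (Nat.pow_le_pow_right hpp.out.pos (Nat.le_add_right _ _))) ρ hI h)
  have h := hup k
  rw [add_comm] at h
  exact hdown l h

theorem count_eq (hp : p ≠ 2) (k n : ℕ) (hn : n < p ^ k) :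
    (contIrrRepCount SL(2, ℤ_[p]) n : ℝ) =
      base p (fun m => if m = n then 1 else 0) +
        ∑ j ∈ Finset.range k, step p (fun m => if m = n then 1 else 0) j := by
  classical
  obtain ⟨W⟩ := exists_wed (Gk p k)
  have h := W.card_quot (n := n) (pik p k) (pik_surj p k) (fun ρ => RepContinuous ρ)
    (fun ρ hc hI => factor_level p hp k hn ρ hc hI) (fun ρ' _ => cont_comp p k ρ')
  unfold contIrrRepCount
  rw [h, ← (all_levels p hp k W).2]
  rw [Nat.card_eq_fintype_card, Fintype.card_subtype]
  simp

end SLZeta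

/-! ### Part Z: the Dirichlet series -/
namespace SLZeta
variable (p : ℕ) [hpp : Fact p.Prime]

theorem ind_hasSum (f : ℕ → ℝ) (c : ℝ) (m : ℕ) :
    HasSum (fun n => c * (if m = n then (1 : ℝ) else 0) * f n) (c * f m) := by
  have := hasSum_single (f := fun n => c * (if m = n then (1 : ℝ) else 0) * f n) m
    (fun n hn => by simp [Ne.symm hn])
  simpa using this

theorem base_hasSum (f : ℕ → ℝ) :
    HasSum (fun n => base p (fun m => if m = n then 1 else 0) * f n) (base p f) := by
  have := (((((ind_hasSum f 1 1).add (ind_hasSum f 1 p)).add (ind_hasSum f (((p : ℝ) - 3) / 2) (p + 1))).add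
    (ind_hasSum f (((p : ℝ) - 1) / 2) (p - 1))).add (ind_hasSum f 2 ((p + 1) / 2))).add
    (ind_hasSum f 2 ((p - 1) / 2))
  convert this using 1
  · funext n; simp only [base]; ring
  · simp only [base]; ring

theorem step_hasSum (f : ℕ → ℝ) (j : ℕ) :
    HasSum (fun n => step p (fun m => if m = n then 1 else 0) j * f n) (step p f j) := by
  have := ((ind_hasSum f (4 * p * (p : ℝ) ^ j) ((p ^ 2 - 1) / 2 * p ^ j)).add
    (ind_hasSum f (((p:ℝ) - 1) ^ 2 / 2 * (p:ℝ) ^ j) (p * (p + 1) * p ^ j))).add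
    (ind_hasSum f (((p:ℝ) ^ 2 - 1) / 2 * (p:ℝ) ^ j) (p * (p - 1) * p ^ j))
  convert this using 1
  · funext n; simp only [step]; ring
  · rfl

theorem three_le (hp : p ≠ 2) : 3 ≤ p := by
  have := hpp.out.two_le; omega

theorem step_zero (hp : p ≠ 2) (n j : ℕ) (hj : n ≤ j) :
    step p (fun m => if m = n then 1 else 0) j = 0 := by
  have h3 := three_le p hp
  have h1 : n < p ^ j := hj.trans_lt (Nat.lt_pow_self hpp.out.one_lt)
  have a1 : 1 ≤ (p ^ 2 - 1) / 2 := by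
    have : 3 ^ 2 ≤ p ^ 2 := Nat.pow_le_pow_left h3 2
    omega
  have a2 : 1 ≤ p * (p + 1) := Nat.mul_pos (by omega) (by omega)
  have a3 : 1 ≤ p * (p - 1) := Nat.mul_pos (by omega) (by omega)
  have e : ∀ a, 1 ≤ a → a * p ^ j ≠ n := fun a ha => by
    have := Nat.le_mul_of_pos_left (p ^ j) ha
    omega
  simp [step, e _ a1, e _ a2, e _ a3]

theorem step_nonneg (n j : ℕ) : 0 ≤ step p (fun m => if m = n then 1 else 0) j := by
  have h1 : (1 : ℝ) ≤ p := by exact_mod_cast hpp.out.one_le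
  have h2 : 0 ≤ (p : ℝ) ^ 2 - 1 := by nlinarith
  have hi : ∀ m : ℕ, 0 ≤ (if m = n then (1 : ℝ) else 0) := fun m => by split_ifs <;> norm_num
  unfold step
  have := hi ((p ^ 2 - 1) / 2 * p ^ j)
  have := hi (p * (p + 1) * p ^ j)
  have := hi (p * (p - 1) * p ^ j)
  positivity

theorem count_hasSum (hp : p ≠ 2) (f : ℕ → ℝ) (hf : ∀ n, 0 ≤ f n) (S : ℝ)
    (hS : HasSum (fun j => step p f j) S) :
    HasSum (fun n => (contIrrRepCount SL(2, ℤ_[p]) n : ℝ) * f n) (base p f + S) := by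
  let g : ℕ × ℕ → ℝ := fun x => step p (fun m => if m = x.2 then 1 else 0) x.1 * f x.2
  have hg : Summable g := by
    rw [summable_prod_of_nonneg (fun x => mul_nonneg (step_nonneg p _ _) (hf _))]
    refine ⟨fun j => (step_hasSum p f j).summable, ?_⟩
    have : (fun j => ∑' n, g (j, n)) = fun j => step p f j := by
      funext j; exact (step_hasSum p f j).tsum_eq
    rw [this]; exact hS.summable
  have h1 : HasSum g S := by
    have h2 := hg.hasSum.prod_fiberwise (fun j => step_hasSum p f j)
    rw [← h2.unique hS]
    exact hg.hasSum
  have h3 : HasSum (fun x : ℕ × ℕ => g x.swap) S := (Equiv.prodComm ℕ ℕ).hasSum_iff.mpr h1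
  have h4 : ∀ n, HasSum (fun j => g (j, n))
      ((∑ j ∈ Finset.range n, step p (fun m => if m = n then 1 else 0) j) * f n) := by
    intro n
    refine HasSum.mul_right (f n) (hasSum_sum_of_ne_finset_zero fun j hj => ?_)
    exact step_zero p hp n j (by simpa using hj)
  have h5 := h3.prod_fiberwise h4
  convert (base_hasSum p f).add h5 using 1
  funext n
  rw [count_eq p hp n n (Nat.lt_pow_self hpp.out.one_lt), add_mul]

end SLZeta

namespace SLZeta

theorem final (p : ℕ) [hpp : Fact p.Prime] (hp : Odd p) (hp2 : p ≠ 2) (s : ℝ) (hs : 1 < s) :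
    HasSum
      (fun n : ℕ =>
        (contIrrRepCount (Matrix.SpecialLinearGroup (Fin 2) ℤ_[p]) (n + 1) : ℝ) *
          ((n + 1 : ℕ) : ℝ) ^ (-s))
      (let q : ℝ := (p : ℝ)
       (1 + q ^ (-s) + (q - 3) / 2 * (q + 1) ^ (-s) + (q - 1) / 2 * (q - 1) ^ (-s) +
           2 * ((q + 1) / 2) ^ (-s) + 2 * ((q - 1) / 2) ^ (-s)) +
         (4 * q * ((q ^ 2 - 1) / 2) ^ (-s) + (q ^ 2 - 1) / 2 * (q ^ 2 - q) ^ (-s) +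
             (q - 1) ^ 2 / 2 * (q ^ 2 + q) ^ (-s)) /
           (1 - q ^ (1 - s))) := by
  have h3 : 3 ≤ p := three_le p hp2
  have h3' : (3 : ℝ) ≤ p := by exact_mod_cast h3
  obtain ⟨m, hm⟩ := hp
  have hmr : (p : ℝ) = 2 * m + 1 := by exact_mod_cast hm
  -- casts of the dimensions
  have c1 : (((p + 1) / 2 : ℕ) : ℝ) = ((p : ℝ) + 1) / 2 := by
    have : (p + 1) / 2 = m + 1 := by omega
    rw [this, hmr]; push_cast; ring
  have c2 : (((p - 1) / 2 : ℕ) : ℝ) = ((p : ℝ) - 1) / 2 := by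
    have : (p - 1) / 2 = m := by omega
    rw [this, hmr]; ring
  have c3 : ((p - 1 : ℕ) : ℝ) = (p : ℝ) - 1 := by
    rw [Nat.cast_sub (by omega), Nat.cast_one]
  have c4 : (((p ^ 2 - 1) / 2 : ℕ) : ℝ) = ((p : ℝ) ^ 2 - 1) / 2 := by
    have h : p ^ 2 = 2 * (2 * m ^ 2 + 2 * m) + 1 := by rw [hm]; ring
    have : (p ^ 2 - 1) / 2 = 2 * m ^ 2 + 2 * m := by omega
    rw [this, hmr]; push_cast; ring
  have hq : 0 < (p : ℝ) := by linarith
  set f : ℕ → ℝ := fun n => (n : ℝ) ^ (-s) with hf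
  have hfm : ∀ a j : ℕ, (p : ℝ) ^ j * f (a * p ^ j) = ((p : ℝ) ^ (1 - s)) ^ j * (a : ℝ) ^ (-s) := by
    intro a j
    simp only [hf]
    rw [Nat.cast_mul, Real.mul_rpow (Nat.cast_nonneg _) (Nat.cast_nonneg _), Nat.cast_pow,
      ← Real.rpow_natCast, ← Real.rpow_natCast, ← Real.rpow_mul hq.le, ← Real.rpow_mul hq.le,
      mul_left_comm, ← Real.rpow_add hq, mul_comm]
    congr 2; ring
  have hlt : (p : ℝ) ^ (1 - s) < 1 := Real.rpow_lt_one_of_one_lt_of_neg (by linarith) (by linarith)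
  have hnn : 0 ≤ (p : ℝ) ^ (1 - s) := Real.rpow_nonneg hq.le _
  have hstep : ∀ j, step p f j = (4 * p * (((p : ℝ) ^ 2 - 1) / 2) ^ (-s) +
      ((p : ℝ) ^ 2 - 1) / 2 * ((p : ℝ) ^ 2 - p) ^ (-s) +
      ((p : ℝ) - 1) ^ 2 / 2 * ((p : ℝ) ^ 2 + p) ^ (-s)) * ((p : ℝ) ^ (1 - s)) ^ j := by
    intro j
    unfold step
    rw [mul_assoc (4 * (p : ℝ)), mul_assoc (((p : ℝ) - 1) ^ 2 / 2), mul_assoc (((p : ℝ) ^ 2 - 1) / 2),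
      hfm, hfm, hfm, c4, Nat.cast_mul, Nat.cast_mul, c3]
    have e1 : (p : ℝ) * ((p + 1 : ℕ) : ℝ) = (p : ℝ) ^ 2 + p := by push_cast; ring
    have e2 : (p : ℝ) * ((p : ℝ) - 1) = (p : ℝ) ^ 2 - p := by ring
    rw [e1, e2]
    ring
  have hS := (hasSum_geometric_of_lt_one hnn hlt).mul_left (4 * p * (((p : ℝ) ^ 2 - 1) / 2) ^ (-s) +
      ((p : ℝ) ^ 2 - 1) / 2 * ((p : ℝ) ^ 2 - p) ^ (-s) +
      ((p : ℝ) - 1) ^ 2 / 2 * ((p : ℝ) ^ 2 + p) ^ (-s))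
  rw [← funext hstep] at hS
  have h := count_hasSum p hp2 f (fun n => Real.rpow_nonneg (Nat.cast_nonneg _) _) _ hS
  rw [← hasSum_nat_add_iff' 1] at h
  have f0 : f 0 = 0 := by simp only [hf, Nat.cast_zero]; exact Real.zero_rpow (by linarith)
  simp only [Finset.sum_range_one, f0, mul_zero, sub_zero] at h
  convert h using 1
  all_goals first
    | rfl
    | simp only [base, hf, c1, c2, c3, Nat.cast_one, Real.one_rpow, Nat.cast_add, div_eq_mul_inv]

end SLZeta

/-- **The representation zeta function of `SL₂(ℤ_p)`** (Jaikin-Zapirain). For an odd prime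
`p` (with `q = p`) and every real `s > 1`, the Dirichlet series `∑ rₙ(SL₂(ℤ_p)) n^{-s}`
converges to
`ζ^{irr}_{SL₂(F_q)}(s) + (4q((q²-1)/2)^{-s} + ((q²-1)/2)(q²-q)^{-s} + ((q-1)²/2)(q²+q)^{-s})
/(1-q^{1-s})`. -/
theorem representation_zeta_SL2_Zp (p : ℕ) [Fact p.Prime] (hp : Odd p) (s : ℝ) (hs : 1 < s) :
    HasSum
      (fun n : ℕ =>
        (contIrrRepCount (Matrix.SpecialLinearGroup (Fin 2) ℤ_[p]) (n + 1) : ℝ) *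
          ((n + 1 : ℕ) : ℝ) ^ (-s))
      (let q : ℝ := (p : ℝ)
       (1 + q ^ (-s) + (q - 3) / 2 * (q + 1) ^ (-s) + (q - 1) / 2 * (q - 1) ^ (-s) +
           2 * ((q + 1) / 2) ^ (-s) + 2 * ((q - 1) / 2) ^ (-s)) +
         (4 * q * ((q ^ 2 - 1) / 2) ^ (-s) + (q ^ 2 - 1) / 2 * (q ^ 2 - q) ^ (-s) +
             (q - 1) ^ 2 / 2 * (q ^ 2 + q) ^ (-s)) /
           (1 - q ^ (1 - s))) := by
  have hp2 : p ≠ 2 := by rintro rfl; exact absurd hp (by decide)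
  exact SLZeta.final p hp hp2 s hs
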